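/- Let d ≥ 1, let ν ≥ 3 be an odd integer, and set F(z) := |z|^{ν-1} z (a homogeneous polynomial in z and z̄, so F∘u is Schwartz whenever u is Schwartz). Let γ ≥ 0 and let 1 < r, p < ∞ and 1 < q ≤ ∞ satisfy 1/r = 1/p + (ν-1)/q. Then there exists C > 0, depending on d, ν, γ, r, p, q, such that for every Schwartz function u on ℝ^d, ‖Λ^γ(F∘u)‖_{L^r} ≤ C ‖u‖_{L^q}^{ν-1} ‖Λ^γ u‖_{L^p}. -/

import Mathlib

open MeasureTheory Real Complex
open scoped FourierTransform ENNReal SchwartzMap RealInnerProductSpace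

/-- The fractional derivative `Λ^γ f(x) = ∫ e^{2πi x·ξ} |ξ|^γ f̂(ξ) dξ`. -/
noncomputable def lamPow {d : ℕ} (γ : ℝ) (f : EuclideanSpace ℝ (Fin d) → ℂ)
    (x : EuclideanSpace ℝ (Fin d)) : ℂ :=
  ∫ ξ : EuclideanSpace ℝ (Fin d),
    Complex.exp (2 * Real.pi * Complex.I * ((⟪x, ξ⟫ : ℝ) : ℂ)) *
      ((‖ξ‖ ^ γ : ℝ) : ℂ) * 𝓕 f ξ


namespace KP
set_option linter.unusedVariables false
set_option linter.unusedSectionVars false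
set_option linter.style.haveILetI false
/-! ### Khinchine inequality -/
section Khinchine
variable {ι : Type*} [DecidableEq ι]

/-- random sign sum -/
noncomputable def sg (s : Finset ι) (k : ι) : ℂ := if k ∈ s then 1 else -1

noncomputable def rs (I : Finset ι) (a : ι → ℂ) (s : Finset ι) : ℂ := ∑ k ∈ I, sg s k * a k

lemma rs_insert_not {I : Finset ι} {k : ι} (hk : k ∉ I) (a : ι → ℂ) {s : Finset ι}
    (hs : s ∈ I.powerset) : rs (insert k I) a s = rs I a s - a k := by
  have : k ∉ s := fun h => hk (Finset.mem_powerset.1 hs h)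
  simp [rs, Finset.sum_insert hk, sg, this]; ring

lemma rs_insert_mem {I : Finset ι} {k : ι} (hk : k ∉ I) (a : ι → ℂ) {s : Finset ι}
    (hs : s ∈ I.powerset) : rs (insert k I) a (insert k s) = rs I a s + a k := by
  have h1 : ∀ j ∈ I, sg (insert k s) j = sg s j := by
    intro j hj
    have : j ≠ k := fun h => hk (h ▸ hj)
    simp [sg, this]
  simp only [rs, Finset.sum_insert hk]
  rw [Finset.sum_congr rfl (fun j hj => by rw [h1 j hj])]
  simp [sg]; ring

lemma rs_sq (I : Finset ι) (a : ι → ℂ) :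
    ∑ s ∈ I.powerset, ‖rs I a s‖ ^ 2 = 2 ^ I.card * ∑ k ∈ I, ‖a k‖ ^ 2 := by
  induction I using Finset.induction_on with
  | empty => simp [rs]
  | insert k I hk ih =>
    rw [Finset.sum_powerset_insert hk, Finset.card_insert_of_notMem hk, Finset.sum_insert hk,
      ← Finset.sum_add_distrib]
    have : ∀ s ∈ I.powerset, ‖rs (insert k I) a s‖ ^ 2 + ‖rs (insert k I) a (insert k s)‖ ^ 2
        = 2 * ‖rs I a s‖ ^ 2 + 2 * ‖a k‖ ^ 2 := by
      intro s hs
      rw [rs_insert_not hk a hs, rs_insert_mem hk a hs]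
      have := parallelogram_law_with_norm ℝ (rs I a s) (a k)
      nlinarith [this]
    rw [Finset.sum_congr rfl this, Finset.sum_add_distrib, ← Finset.mul_sum, ih]
    simp [Finset.card_powerset]; ring

lemma four_aux (x y : ℂ) : ‖x - y‖ ^ 4 + ‖x + y‖ ^ 4 ≤
    2 * ‖x‖ ^ 4 + 12 * ‖x‖ ^ 2 * ‖y‖ ^ 2 + 2 * ‖y‖ ^ 4 := by
  have h1 := norm_sub_sq_real x y
  have h2 := norm_add_sq_real x y
  have h3 : ⟪x, y⟫ ^ 2 ≤ ‖x‖ ^ 2 * ‖y‖ ^ 2 := by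
    have := abs_real_inner_le_norm x y
    rw [← mul_pow, ← sq_abs]; gcongr
  have e1 : ‖x - y‖ ^ 4 = (‖x - y‖ ^ 2) ^ 2 := by ring
  have e2 : ‖x + y‖ ^ 4 = (‖x + y‖ ^ 2) ^ 2 := by ring
  rw [e1, e2, h1, h2]
  nlinarith [h3]

lemma rs_four (I : Finset ι) (a : ι → ℂ) :
    ∑ s ∈ I.powerset, ‖rs I a s‖ ^ 4 ≤ 3 * 2 ^ I.card * (∑ k ∈ I, ‖a k‖ ^ 2) ^ 2 := by
  induction I using Finset.induction_on with
  | empty => simp [rs]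
  | insert k I hk ih =>
    rw [Finset.sum_powerset_insert hk, Finset.card_insert_of_notMem hk, Finset.sum_insert hk,
      ← Finset.sum_add_distrib]
    have : ∀ s ∈ I.powerset, ‖rs (insert k I) a s‖ ^ 4 + ‖rs (insert k I) a (insert k s)‖ ^ 4
        ≤ 2 * ‖rs I a s‖ ^ 4 + 12 * ‖a k‖ ^ 2 * ‖rs I a s‖ ^ 2 + 2 * ‖a k‖ ^ 4 := by
      intro s hs
      rw [rs_insert_not hk a hs, rs_insert_mem hk a hs]
      have := four_aux (rs I a s) (a k)
      nlinarith [this]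
    refine (Finset.sum_le_sum this).trans ?_
    rw [Finset.sum_add_distrib, Finset.sum_add_distrib, ← Finset.mul_sum, ← Finset.mul_sum, rs_sq]
    simp only [Finset.sum_const, Finset.card_powerset, nsmul_eq_mul]
    push_cast
    have h4 : (0:ℝ) ≤ 2 ^ I.card * ‖a k‖ ^ 4 := by positivity
    have h5 : (2:ℝ) ^ (I.card + 1) = 2 * 2 ^ I.card := by ring
    rw [h5]
    nlinarith [ih, h4]

lemma khin_small (p : ℝ) (hp : 0 < p) (hp2 : p ≤ 2) (y : ℝ) (hy : 0 ≤ y) :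
    (2:ℝ) ^ (p - 2) * (y ^ 2 - y ^ 4 / 4) ≤ y ^ p := by
  rcases hy.eq_or_lt with rfl | hy0
  · simp [Real.zero_rpow hp.ne']
  by_cases h : y ≤ 2
  · have h1 : (2:ℝ) ^ (p - 2) ≤ y ^ (p - 2) := Real.rpow_le_rpow_of_nonpos hy0 h (by linarith)
    have h2 : y ^ p = y ^ (p - 2) * y ^ 2 := by
      rw [← Real.rpow_natCast, ← Real.rpow_add hy0]; norm_num
    rw [h2]
    have h3 : 0 ≤ y ^ 2 - y ^ 4 / 4 := by
      have e : y ^ 2 - y ^ 4 / 4 = y ^ 2 * ((2 - y) * (2 + y)) / 4 := by ring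
      rw [e]
      have : 0 ≤ 2 - y := by linarith
      positivity
    have h4 : y ^ 2 - y ^ 4 / 4 ≤ y ^ 2 := by nlinarith [sq_nonneg (y^2)]
    have : 0 ≤ y ^ (p-2) := Real.rpow_nonneg hy _
    gcongr
  · push Not at h
    have : y ^ 2 - y ^ 4 / 4 ≤ 0 := by
      have e : y ^ 2 - y ^ 4 / 4 = -(y ^ 2 * ((y - 2) * (2 + y)) / 4) := by ring
      rw [e]
      have : 0 ≤ y - 2 := by linarith
      have : 0 ≤ y ^ 2 * ((y - 2) * (2 + y)) / 4 := by positivity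
      linarith
    have h2 : 0 ≤ y ^ p := Real.rpow_nonneg hy _
    have h3 : 0 < (2:ℝ) ^ (p - 2) := by positivity
    nlinarith

lemma khin_big (p : ℝ) (hp2 : 2 ≤ p) (y : ℝ) (hy : 0 ≤ y) :
    1 + (p / 2) * (y ^ 2 - 1) ≤ y ^ p := by
  have := one_add_mul_self_le_rpow_one_add (s := y ^ 2 - 1) (by nlinarith [sq_nonneg y])
    (p := p / 2) (by linarith)
  have e : (1 + (y ^ 2 - 1)) ^ (p / 2) = y ^ p := by
    rw [add_sub_cancel, ← Real.rpow_natCast, ← Real.rpow_mul hy]; congr 1; push_cast; ring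
  rwa [e] at this

/-- Khinchine's inequality (lower bound). -/
lemma khinchine (p : ℝ) (hp : 0 < p) : ∃ C : ℝ, 0 < C ∧ ∀ (I : Finset ι) (a : ι → ℂ),
    (∑ k ∈ I, ‖a k‖ ^ 2) ^ (p / 2) ≤
      C * ((2:ℝ) ^ I.card)⁻¹ * ∑ s ∈ I.powerset, ‖rs I a s‖ ^ p := by
  refine ⟨(2:ℝ) ^ (4 - p) + 1, by positivity, ?_⟩
  intro I a
  set σ := ∑ k ∈ I, ‖a k‖ ^ 2 with hσ
  have hσ0 : 0 ≤ σ := by positivity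
  rcases hσ0.eq_or_lt with h0 | hpos
  · rw [← h0, Real.zero_rpow (by positivity)]; positivity
  set τ := Real.sqrt σ with hτ
  have hτ0 : 0 < τ := Real.sqrt_pos.2 hpos
  have hτ2 : τ ^ 2 = σ := Real.sq_sqrt hσ0
  have hτp : σ ^ (p / 2) = τ ^ p := by
    rw [← hτ2, ← Real.rpow_natCast, ← Real.rpow_mul hτ0.le]; congr 1; push_cast; ring
  have hN : (0:ℝ) < 2 ^ I.card := by positivity
  have e2 : ∑ s ∈ I.powerset, (‖rs I a s‖ / τ) ^ 2 = 2 ^ I.card := by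
    simp only [div_pow]
    rw [← Finset.sum_div, rs_sq, hτ2, mul_div_assoc, ← hσ, div_self hpos.ne', mul_one]
  have e4 : ∑ s ∈ I.powerset, (‖rs I a s‖ / τ) ^ 4 ≤ 3 * 2 ^ I.card := by
    simp only [div_pow]
    rw [← Finset.sum_div, div_le_iff₀ (by positivity)]
    have := rs_four I a
    rw [← hσ, ← hτ2] at this
    calc _ ≤ _ := this
      _ = _ := by ring
  have ep : ∑ s ∈ I.powerset, ‖rs I a s‖ ^ p = τ ^ p * ∑ s ∈ I.powerset, (‖rs I a s‖ / τ) ^ p := by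
    rw [Finset.mul_sum]
    refine Finset.sum_congr rfl fun s _ => ?_
    rw [Real.div_rpow (norm_nonneg _) hτ0.le]
    field_simp
  set Y := ∑ s ∈ I.powerset, (‖rs I a s‖ / τ) ^ p with hY
  have key : (2:ℝ) ^ I.card ≤ ((2:ℝ) ^ (4 - p) + 1) * Y := by
    have hY0 : 0 ≤ Y := Finset.sum_nonneg fun s _ => by positivity
    have h24 : 0 < (2:ℝ) ^ (4 - p) := by positivity
    rcases le_total p 2 with h | h
    · have : (2:ℝ) ^ (p - 2) * (2 ^ I.card - 3 * 2 ^ I.card / 4) ≤ Y := by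
        calc _ ≤ (2:ℝ) ^ (p - 2) * (∑ s ∈ I.powerset, (‖rs I a s‖ / τ) ^ 2 -
              (∑ s ∈ I.powerset, (‖rs I a s‖ / τ) ^ 4) / 4) := by
              rw [e2]; gcongr
          _ = ∑ s ∈ I.powerset, (2:ℝ) ^ (p - 2) * ((‖rs I a s‖ / τ) ^ 2 - (‖rs I a s‖ / τ) ^ 4 / 4) := by
              rw [← Finset.mul_sum, Finset.sum_sub_distrib, Finset.sum_div]
          _ ≤ _ := Finset.sum_le_sum fun s _ => khin_small p hp h _ (by positivity)
      have e : (2:ℝ) ^ (4 - p) * (2:ℝ) ^ (p - 2) = 4 := by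
        rw [← Real.rpow_add (by norm_num)]; norm_num
      have h6 := mul_le_mul_of_nonneg_left this h24.le
      nlinarith
    · have : (2:ℝ) ^ I.card ≤ Y := by
        calc (2:ℝ) ^ I.card = ∑ s ∈ I.powerset, (1 + (p / 2) * ((‖rs I a s‖ / τ) ^ 2 - 1)) := by
              rw [Finset.sum_add_distrib, ← Finset.mul_sum, Finset.sum_sub_distrib, e2]
              simp [Finset.card_powerset]
          _ ≤ Y := Finset.sum_le_sum fun s _ => khin_big p h _ (by positivity)
      nlinarith
  rw [hτp, ep]
  have hτp0 : 0 < τ ^ p := by positivity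
  calc τ ^ p = τ ^ p * (((2:ℝ) ^ I.card)⁻¹ * (2:ℝ) ^ I.card) := by field_simp
    _ ≤ τ ^ p * (((2:ℝ) ^ I.card)⁻¹ * (((2:ℝ) ^ (4 - p) + 1) * Y)) := by gcongr
    _ = _ := by ring
end Khinchine
end KP


namespace KP
set_option linter.unusedVariables false
set_option linter.unusedSectionVars false
set_option linter.style.haveILetI false
/-! ### Marcinkiewicz interpolation -/
section Marc
variable {α : Type*} [MeasurableSpace α] {μ : Measure α} [SFinite μ]

lemma inner1 {p y : ℝ} (hp : 1 < p) (hy : 0 ≤ y) :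
    ∫⁻ t in Set.Ioi (0:ℝ), (if t < y then ENNReal.ofReal y else 0) * ENNReal.ofReal (t ^ (p - 2))
      = ENNReal.ofReal (1 / (p - 1)) * ENNReal.ofReal (y ^ p) := by
  rcases hy.eq_or_lt with rfl | hy0
  · simp [Real.zero_rpow (by linarith : p ≠ 0)]
  have h1 : ∀ t : ℝ, (if t < y then ENNReal.ofReal y else 0) * ENNReal.ofReal (t ^ (p - 2)) =
      (Set.Iio y).indicator (fun t => ENNReal.ofReal y * ENNReal.ofReal (t ^ (p - 2))) t := by
    intro t; simp only [Set.indicator, Set.mem_Iio]; split_ifs <;> simp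
  simp_rw [h1]
  rw [lintegral_indicator measurableSet_Iio, Measure.restrict_restrict measurableSet_Iio,
    lintegral_const_mul' _ _ ENNReal.ofReal_ne_top]
  have h2 : Set.Iio y ∩ Set.Ioi 0 = Set.Ioo 0 y := by ext; simp [and_comm]
  rw [h2]
  have hintg : IntegrableOn (fun t : ℝ => t ^ (p - 2)) (Set.Ioo 0 y) :=
    (intervalIntegral.integrableOn_Ioo_rpow_iff hy0).2 (by linarith)
  rw [← ofReal_integral_eq_lintegral_ofReal hintg
    (by filter_upwards [ae_restrict_mem measurableSet_Ioo] with t ht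
        exact Real.rpow_nonneg ht.1.le _)]
  rw [← integral_Ioc_eq_integral_Ioo, ← intervalIntegral.integral_of_le hy,
    integral_rpow (Or.inl (by linarith)), ← ENNReal.ofReal_mul hy,
    ← ENNReal.ofReal_mul (by have : 0 < p - 1 := by linarith
                             positivity)]
  congr 1
  rw [Real.zero_rpow (by linarith)]
  have : y ^ p = y * y ^ (p - 1) := by
    rw [← Real.rpow_one_add' hy (by linarith)]; congr 1; ring
  rw [this, show p - 2 + 1 = p - 1 by ring]
  have : p - 1 ≠ 0 := by linarith
  field_simp
  ring

lemma inner2 {p y : ℝ} (hp : 1 < p) (hp2 : p < 2) (hy : 0 ≤ y) :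
    ∫⁻ t in Set.Ioi (0:ℝ), (if y ≤ t then ENNReal.ofReal (y^2) else 0) * ENNReal.ofReal (t ^ (p - 3))
      = ENNReal.ofReal (1 / (2 - p)) * ENNReal.ofReal (y ^ p) := by
  rcases hy.eq_or_lt with rfl | hy0
  · simp [Real.zero_rpow (by linarith : p ≠ 0)]
  have h1 : ∀ t : ℝ, (if y ≤ t then ENNReal.ofReal (y^2) else 0) * ENNReal.ofReal (t ^ (p - 3)) =
      (Set.Ici y).indicator (fun t => ENNReal.ofReal (y^2) * ENNReal.ofReal (t ^ (p - 3))) t := by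
    intro t; simp only [Set.indicator, Set.mem_Ici]; split_ifs <;> simp
  simp_rw [h1]
  rw [lintegral_indicator measurableSet_Ici, Measure.restrict_restrict measurableSet_Ici,
    lintegral_const_mul' _ _ ENNReal.ofReal_ne_top]
  have h2 : Set.Ici y ∩ Set.Ioi 0 = Set.Ici y := by
    ext t; simp only [Set.mem_inter_iff, Set.mem_Ici, Set.mem_Ioi]
    exact ⟨fun h => h.1, fun h => ⟨h, hy0.trans_le h⟩⟩
  rw [h2, Measure.restrict_congr_set Ioi_ae_eq_Ici.symm]
  have hintg : IntegrableOn (fun t : ℝ => t ^ (p - 3)) (Set.Ioi y) :=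
    integrableOn_Ioi_rpow_of_lt (by linarith) hy0
  rw [← ofReal_integral_eq_lintegral_ofReal hintg
    (by filter_upwards [ae_restrict_mem measurableSet_Ioi] with t ht
        exact Real.rpow_nonneg (hy0.trans ht).le _)]
  rw [integral_Ioi_rpow_of_lt (by linarith) hy0, ← ENNReal.ofReal_mul (by positivity),
    ← ENNReal.ofReal_mul (by have : 0 < 2 - p := by linarith
                             positivity)]
  congr 1
  have : y ^ p = y ^ 2 * y ^ (p - 2) := by
    rw [← Real.rpow_natCast, ← Real.rpow_add hy0]; congr 1; push_cast; ring
  rw [this, show p - 3 + 1 = p - 2 by ring]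
  have h3 : p - 2 ≠ 0 := by linarith
  have h4 : 2 - p ≠ 0 := by linarith
  field_simp
  ring

lemma marc1 {p : ℝ} (hp : 1 < p) {f : α → ℝ} (hf : Measurable f) (hf0 : ∀ x, 0 ≤ f x) :
    ∫⁻ t in Set.Ioi (0:ℝ), (∫⁻ x, (if t < f x then ENNReal.ofReal (f x) else 0) ∂μ) *
      ENNReal.ofReal (t ^ (p - 2)) = ENNReal.ofReal (1 / (p - 1)) * ∫⁻ x, ENNReal.ofReal (f x ^ p) ∂μ := by
  have : ∀ t : ℝ, (∫⁻ x, (if t < f x then ENNReal.ofReal (f x) else 0) ∂μ) *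
      ENNReal.ofReal (t ^ (p - 2)) = ∫⁻ x, (if t < f x then ENNReal.ofReal (f x) else 0) *
      ENNReal.ofReal (t ^ (p - 2)) ∂μ := fun t => by
    rw [lintegral_mul_const' _ _ ENNReal.ofReal_ne_top]
  simp_rw [this]
  rw [lintegral_lintegral_swap]
  · simp_rw [inner1 hp (hf0 _)]
    rw [lintegral_const_mul' _ _ ENNReal.ofReal_ne_top]
  · apply Measurable.aemeasurable
    refine Measurable.mul (Measurable.ite ?_ ?_ measurable_const) ?_
    · exact measurableSet_lt measurable_fst (hf.comp measurable_snd)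
    · exact ENNReal.measurable_ofReal.comp (hf.comp measurable_snd)
    · exact ENNReal.measurable_ofReal.comp (measurable_fst.pow_const _)

lemma marc2 {p : ℝ} (hp : 1 < p) (hp2 : p < 2) {f : α → ℝ} (hf : Measurable f) (hf0 : ∀ x, 0 ≤ f x) :
    ∫⁻ t in Set.Ioi (0:ℝ), (∫⁻ x, (if f x ≤ t then ENNReal.ofReal (f x ^ 2) else 0) ∂μ) *
      ENNReal.ofReal (t ^ (p - 3)) = ENNReal.ofReal (1 / (2 - p)) * ∫⁻ x, ENNReal.ofReal (f x ^ p) ∂μ := by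
  have : ∀ t : ℝ, (∫⁻ x, (if f x ≤ t then ENNReal.ofReal (f x ^ 2) else 0) ∂μ) *
      ENNReal.ofReal (t ^ (p - 3)) = ∫⁻ x, (if f x ≤ t then ENNReal.ofReal (f x ^ 2) else 0) *
      ENNReal.ofReal (t ^ (p - 3)) ∂μ := fun t => by
    rw [lintegral_mul_const' _ _ ENNReal.ofReal_ne_top]
  simp_rw [this]
  rw [lintegral_lintegral_swap]
  · simp_rw [inner2 hp hp2 (hf0 _)]
    rw [lintegral_const_mul' _ _ ENNReal.ofReal_ne_top]
  · apply Measurable.aemeasurable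
    refine Measurable.mul (Measurable.ite ?_ ?_ measurable_const) ?_
    · exact measurableSet_le (hf.comp measurable_snd) measurable_fst
    · exact ENNReal.measurable_ofReal.comp ((hf.comp measurable_snd).pow_const _)
    · exact ENNReal.measurable_ofReal.comp (measurable_fst.pow_const _)

lemma marcA {p : ℝ} (hp : 1 < p) (A : ℝ≥0∞) {f G : α → ℝ}
    (hf : Measurable f) (hf0 : ∀ x, 0 ≤ f x) (hG : Measurable G) (hG0 : ∀ x, 0 ≤ G x)
    (h : ∀ t : ℝ, 0 < t → μ {x | t < G x} ≤ A * ENNReal.ofReal (t⁻¹) *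
      ∫⁻ x, (if t < f x then ENNReal.ofReal (f x) else 0) ∂μ) :
    ∫⁻ x, ENNReal.ofReal (G x ^ p) ∂μ ≤
      ENNReal.ofReal p * (A * ENNReal.ofReal (1 / (p - 1))) * ∫⁻ x, ENNReal.ofReal (f x ^ p) ∂μ := by
  rw [lintegral_rpow_eq_lintegral_meas_lt_mul μ (Filter.Eventually.of_forall hG0) hG.aemeasurable
    (by linarith), mul_assoc, mul_assoc A, ← marc1 hp hf hf0]
  gcongr
  rw [← lintegral_const_mul]
  · refine setLIntegral_mono' measurableSet_Ioi fun t ht => ?_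
    have ht : 0 < t := ht
    calc μ {a | t < G a} * ENNReal.ofReal (t ^ (p - 1)) ≤ (A * ENNReal.ofReal (t⁻¹) *
      ∫⁻ x, (if t < f x then ENNReal.ofReal (f x) else 0) ∂μ) * ENNReal.ofReal (t ^ (p - 1)) := by
          gcongr; exact h t ht
      _ = A * ((∫⁻ x, (if t < f x then ENNReal.ofReal (f x) else 0) ∂μ) *
          (ENNReal.ofReal (t⁻¹) * ENNReal.ofReal (t ^ (p - 1)))) := by ring
      _ = _ := by
        rw [← ENNReal.ofReal_mul (by positivity)]
        congr 4
        rw [← Real.rpow_neg_one, ← Real.rpow_add ht]; congr 1; ring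
  · refine Measurable.mul ?_ (ENNReal.measurable_ofReal.comp (measurable_id.pow_const _))
    apply Measurable.lintegral_prod_right'
      (f := fun z : ℝ × α => if z.1 < f z.2 then ENNReal.ofReal (f z.2) else 0)
    refine (Measurable.ite ?_ ?_ measurable_const)
    · exact measurableSet_lt measurable_fst (hf.comp measurable_snd)
    · exact ENNReal.measurable_ofReal.comp (hf.comp measurable_snd)

lemma marcB {p : ℝ} (hp : 1 < p) (hp2 : p < 2) (A B : ℝ≥0∞) {f G : α → ℝ}
    (hf : Measurable f) (hf0 : ∀ x, 0 ≤ f x) (hG : Measurable G) (hG0 : ∀ x, 0 ≤ G x)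
    (h : ∀ t : ℝ, 0 < t → μ {x | t < G x} ≤ A * ENNReal.ofReal (t⁻¹) *
      ∫⁻ x, (if t < f x then ENNReal.ofReal (f x) else 0) ∂μ + B * ENNReal.ofReal ((t^2)⁻¹) *
      ∫⁻ x, (if f x ≤ t then ENNReal.ofReal (f x ^ 2) else 0) ∂μ) :
    ∫⁻ x, ENNReal.ofReal (G x ^ p) ∂μ ≤
      ENNReal.ofReal p * (A * ENNReal.ofReal (1 / (p - 1)) + B * ENNReal.ofReal (1 / (2 - p)))
       * ∫⁻ x, ENNReal.ofReal (f x ^ p) ∂μ := by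
  rw [lintegral_rpow_eq_lintegral_meas_lt_mul μ (Filter.Eventually.of_forall hG0) hG.aemeasurable
    (by linarith), mul_assoc, add_mul, mul_assoc A, mul_assoc B, ← marc1 hp hf hf0,
    ← marc2 hp hp2 hf hf0]
  gcongr
  have m1 : Measurable fun t : ℝ => (∫⁻ x, (if t < f x then ENNReal.ofReal (f x) else 0) ∂μ) *
      ENNReal.ofReal (t ^ (p - 2)) := by
    refine Measurable.mul ?_ (ENNReal.measurable_ofReal.comp (measurable_id.pow_const _))
    apply Measurable.lintegral_prod_right'
      (f := fun z : ℝ × α => if z.1 < f z.2 then ENNReal.ofReal (f z.2) else 0)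
    refine (Measurable.ite ?_ ?_ measurable_const)
    · exact measurableSet_lt measurable_fst (hf.comp measurable_snd)
    · exact ENNReal.measurable_ofReal.comp (hf.comp measurable_snd)
  have m2 : Measurable fun t : ℝ => (∫⁻ x, (if f x ≤ t then ENNReal.ofReal (f x ^ 2) else 0) ∂μ) *
      ENNReal.ofReal (t ^ (p - 3)) := by
    refine Measurable.mul ?_ (ENNReal.measurable_ofReal.comp (measurable_id.pow_const _))
    apply Measurable.lintegral_prod_right'
      (f := fun z : ℝ × α => if f z.2 ≤ z.1 then ENNReal.ofReal (f z.2 ^ 2) else 0)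
    refine (Measurable.ite ?_ ?_ measurable_const)
    · exact measurableSet_le (hf.comp measurable_snd) measurable_fst
    · exact ENNReal.measurable_ofReal.comp ((hf.comp measurable_snd).pow_const _)
  rw [← lintegral_const_mul _ m1, ← lintegral_const_mul _ m2, ← lintegral_add_left (m1.const_mul _)]
  refine setLIntegral_mono' measurableSet_Ioi fun t ht => ?_
  have ht : 0 < t := ht
  have e1 : ENNReal.ofReal (t ^ (p - 2)) = ENNReal.ofReal (t⁻¹) * ENNReal.ofReal (t ^ (p - 1)) := by
    rw [← ENNReal.ofReal_mul (by positivity), ← Real.rpow_neg_one, ← Real.rpow_add ht]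
    congr 2; ring
  have e2 : ENNReal.ofReal (t ^ (p - 3)) = ENNReal.ofReal ((t^2)⁻¹) * ENNReal.ofReal (t ^ (p - 1)) := by
    rw [← ENNReal.ofReal_mul (by positivity), ← Real.rpow_natCast, ← Real.rpow_neg ht.le,
      ← Real.rpow_add ht]
    congr 2; push_cast; ring
  refine (mul_le_mul_left (h t ht) _).trans (le_of_eq ?_)
  rw [e1, e2]
  ring
end Marc

/-! ### Cutoffs and duality -/
section Dual
variable {E : Type*} [NormedAddCommGroup E] [NormedSpace ℝ E] [FiniteDimensional ℝ E]
  [MeasurableSpace E] [BorelSpace E] {μ : Measure E}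

/-- tent cutoff -/
noncomputable def tent (n : ℕ) (x : E) : ℝ := max 0 (min 1 ((n:ℝ) - ‖x‖))

lemma tent_cont (n : ℕ) : Continuous (tent n : E → ℝ) := by unfold tent; fun_prop
lemma tent_nonneg (n : ℕ) (x : E) : 0 ≤ tent n x := le_max_left _ _
lemma tent_le_one (n : ℕ) (x : E) : tent n x ≤ 1 := max_le zero_le_one (min_le_left _ _)
lemma tent_supp (n : ℕ) : HasCompactSupport (tent n : E → ℝ) := by
  haveI : ProperSpace E := FiniteDimensional.proper_real E
  refine HasCompactSupport.intro (isCompact_closedBall (0:E) n) fun x hx => ?_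
  simp only [Metric.mem_closedBall, dist_zero_right, not_le] at hx
  unfold tent
  exact max_eq_left ((min_le_right _ _).trans (by linarith))
lemma tent_tendsto (x : E) : Filter.Tendsto (fun n => tent n x) Filter.atTop (nhds 1) := by
  refine tendsto_const_nhds.congr' ?_
  filter_upwards [Filter.eventually_ge_atTop (Nat.ceil (‖x‖ + 1))] with n hn
  have : ‖x‖ + 1 ≤ n := Nat.ceil_le.1 hn
  unfold tent
  rw [min_eq_left (by linarith), max_eq_right zero_le_one]

lemma cont_pow_conj {p : ℝ} (hp : 1 < p) :
    Continuous fun z : ℂ => ((‖z‖ ^ (p - 2) : ℝ) : ℂ) * (starRingEnd ℂ) z := by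
  rw [continuous_iff_continuousAt]
  intro z
  by_cases hz : z = 0
  · subst hz
    rw [ContinuousAt]
    simp only [map_zero, mul_zero]
    rw [tendsto_zero_iff_norm_tendsto_zero]
    have : ∀ z : ℂ, ‖((‖z‖ ^ (p - 2) : ℝ) : ℂ) * (starRingEnd ℂ) z‖ = ‖z‖ ^ (p - 1) := by
      intro z
      rw [norm_mul, Complex.norm_real, RCLike.norm_conj, Real.norm_of_nonneg (by positivity)]
      by_cases hz : z = 0
      · simp [hz, Real.zero_rpow (by linarith : p - 1 ≠ 0)]
      · rw [← Real.rpow_add_one (norm_ne_zero_iff.2 hz)]; congr 1; ring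
    simp_rw [this]
    have h : Continuous fun z : ℂ => ‖z‖ ^ (p - 1) :=
      continuous_norm.rpow_const fun _ => Or.inr (by linarith)
    have := h.tendsto 0
    simpa [Real.zero_rpow (by linarith : p - 1 ≠ 0)] using this
  · refine ContinuousAt.mul ?_ (Complex.continuous_conj.continuousAt)
    refine Complex.continuous_ofReal.continuousAt.comp ?_
    exact continuous_norm.continuousAt.rpow_const (Or.inl (norm_ne_zero_iff.2 hz))

lemma dual_bound [IsFiniteMeasureOnCompacts μ] {p q : ℝ} (hpq : p.HolderConjugate q) {H : E → ℂ}
    (hH : Continuous H) (A : ℝ≥0∞)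
    (h : ∀ g : E → ℂ, Continuous g → HasCompactSupport g →
      ‖∫ x, H x * g x ∂μ‖ₑ ≤ A * eLpNorm g (ENNReal.ofReal q) μ) :
    eLpNorm H (ENNReal.ofReal p) μ ≤ A := by
  have hp := hpq.lt
  have hp0 : 0 < p := hpq.pos
  have hq0 : 0 < q := hpq.symm.pos
  -- truncated bound
  have key : ∀ n : ℕ, ∫⁻ x, ENNReal.ofReal (tent n x * ‖H x‖ ^ p) ∂μ ≤ A ^ p := by
    intro n
    set g : E → ℂ := fun x => (tent n x : ℂ) * (((‖H x‖ ^ (p - 2) : ℝ) : ℂ) * (starRingEnd ℂ) (H x)) with hg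
    have gc : Continuous g :=
      (Complex.continuous_ofReal.comp (tent_cont n)).mul ((cont_pow_conj hp).comp hH)
    have gs : HasCompactSupport g :=
      HasCompactSupport.mul_right ((tent_supp n).comp_left (g := fun r : ℝ => (r:ℂ)) Complex.ofReal_zero)
    have hHp : ∀ x, ‖H x‖ ^ (p - 2) * ‖H x‖ ^ 2 = ‖H x‖ ^ p := by
      intro x
      by_cases hz : H x = 0
      · simp [hz, Real.zero_rpow hp0.ne']
      · rw [← Real.rpow_natCast, ← Real.rpow_add (norm_pos_iff.2 hz)]; congr 1; push_cast; ring
    have e1 : ∀ x, H x * g x = ((tent n x * ‖H x‖ ^ p : ℝ) : ℂ) := by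
      intro x
      have : H x * (starRingEnd ℂ) (H x) = ((‖H x‖ ^ 2 : ℝ) : ℂ) := by
        rw [Complex.mul_conj, Complex.normSq_eq_norm_sq]
      rw [hg, ← hHp x]
      push_cast at this ⊢
      linear_combination (tent n x : ℂ) * ((‖H x‖ ^ (p - 2) : ℝ) : ℂ) * this
    have hcont : Continuous fun x => tent n x * ‖H x‖ ^ p :=
      (tent_cont n).mul ((continuous_norm.comp hH).rpow_const fun _ => Or.inr hp0.le)
    have hintg : Integrable (fun x => tent n x * ‖H x‖ ^ p) μ :=
      hcont.integrable_of_hasCompactSupport (tent_supp n).mul_right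
    have hnn : ∀ x, 0 ≤ tent n x * ‖H x‖ ^ p := fun x =>
      mul_nonneg (tent_nonneg n x) (by positivity)
    set I := ∫⁻ x, ENNReal.ofReal (tent n x * ‖H x‖ ^ p) ∂μ with hI
    have hItop : I ≠ ∞ := by
      rw [hI, ← ofReal_integral_eq_lintegral_ofReal hintg (Filter.Eventually.of_forall hnn)]
      exact ENNReal.ofReal_ne_top
    have e2 : ‖∫ x, H x * g x ∂μ‖ₑ = I := by
      simp_rw [e1]
      rw [integral_complex_ofReal, ← ofReal_norm, Complex.norm_real,
        Real.norm_of_nonneg (integral_nonneg hnn), ofReal_integral_eq_lintegral_ofReal hintg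
          (Filter.Eventually.of_forall hnn)]
    have e3 : eLpNorm g (ENNReal.ofReal q) μ ≤ I ^ (1 / q) := by
      rw [eLpNorm_eq_lintegral_rpow_enorm_toReal (by simpa using hq0) ENNReal.ofReal_ne_top,
        ENNReal.toReal_ofReal hq0.le]
      gcongr
      refine lintegral_mono fun x => ?_
      rw [← ofReal_norm, ENNReal.ofReal_rpow_of_nonneg (norm_nonneg _) hq0.le]
      apply ENNReal.ofReal_le_ofReal
      have : ‖g x‖ = tent n x * ‖H x‖ ^ (p - 1) := by
        rw [hg, norm_mul, norm_mul, Complex.norm_real, Complex.norm_real, RCLike.norm_conj,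
          Real.norm_of_nonneg (tent_nonneg n x), Real.norm_of_nonneg (by positivity)]
        by_cases hz : H x = 0
        · simp [hz, Real.zero_rpow (by linarith : p - 1 ≠ 0)]
        · rw [← Real.rpow_add_one (norm_ne_zero_iff.2 hz)]; congr 2; ring
      rw [this, Real.mul_rpow (tent_nonneg n x) (by positivity), ← Real.rpow_mul (norm_nonneg _),
        hpq.sub_one_mul_conj]
      gcongr
      exact Real.rpow_le_self_of_le_one (tent_nonneg n x) (tent_le_one n x) hpq.symm.lt.le
    have h2 : I ≤ A * I ^ (1 / q) := by
      calc I = _ := e2.symm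
        _ ≤ _ := h g gc gs
        _ ≤ _ := by gcongr
    by_cases hI0 : I = 0
    · rw [hI0]; exact zero_le
    have h3 : I = I ^ (1 / p) * I ^ (1 / q) := by
      rw [← ENNReal.rpow_add _ _ hI0 hItop, one_div, one_div, hpq.inv_add_inv_eq_one, ENNReal.rpow_one]
    have h4 : I ^ (1 / p) ≤ A := by
      have hn0 : I ^ (1 / q) ≠ 0 := by
        simp [ENNReal.rpow_eq_zero_iff, hI0, hItop]
      have hnt : I ^ (1 / q) ≠ ∞ := ENNReal.rpow_ne_top_of_nonneg (by positivity) hItop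
      have h2' : I ^ (1 / p) * I ^ (1 / q) ≤ A * I ^ (1 / q) := by
        calc I ^ (1 / p) * I ^ (1 / q) = I := h3.symm
          _ = ‖∫ x, H x * g x ∂μ‖ₑ := e2.symm
          _ ≤ _ := h g gc gs
          _ ≤ _ := by gcongr
      exact (ENNReal.mul_le_mul_iff_left hn0 hnt).1 h2'
    calc I = (I ^ (1 / p)) ^ p := by
          rw [← ENNReal.rpow_mul, one_div, inv_mul_cancel₀ hp0.ne', ENNReal.rpow_one]
      _ ≤ A ^ p := by gcongr
  rw [eLpNorm_eq_lintegral_rpow_enorm_toReal (by simpa using hp0) ENNReal.ofReal_ne_top,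
        ENNReal.toReal_ofReal hp0.le]
  have h5 : ∫⁻ x, ‖H x‖ₑ ^ p ∂μ ≤ A ^ p := by
    have : ∀ x, ‖H x‖ₑ ^ p = Filter.liminf (fun n => ENNReal.ofReal (tent n x * ‖H x‖ ^ p)) Filter.atTop := by
      intro x
      refine (Filter.Tendsto.liminf_eq ?_).symm
      rw [← ofReal_norm, ENNReal.ofReal_rpow_of_nonneg (norm_nonneg _) hp0.le]
      refine ENNReal.tendsto_ofReal ?_
      simpa using (tent_tendsto x).mul_const (‖H x‖ ^ p)
    simp_rw [this]
    refine (lintegral_liminf_le fun n => ?_).trans ?_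
    · refine ENNReal.measurable_ofReal.comp (Continuous.measurable ?_)
      exact (tent_cont n).mul ((continuous_norm.comp hH).rpow_const fun _ => Or.inr hp0.le)
    · exact Filter.liminf_le_of_le (by isBoundedDefault) (fun b hb => by
        obtain ⟨n, hn⟩ := hb.exists
        exact hn.trans (key n))
  calc _ ≤ (A ^ p) ^ (1 / p) := by gcongr
    _ = A := by rw [← ENNReal.rpow_mul, mul_one_div_cancel hp0.ne', ENNReal.rpow_one]
end Dual
end KP


namespace KP
set_option linter.unusedVariables false
set_option linter.unusedSectionVars false
set_option linter.style.haveILetI false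

section conv
variable {E : Type*} [NormedAddCommGroup E] [InnerProductSpace ℝ E] [FiniteDimensional ℝ E]
  [MeasurableSpace E] [BorelSpace E]

/-- Convolution with a kernel. -/
noncomputable def cv (K : E → ℂ) (f : E → ℂ) (x : E) : ℂ := ∫ y, K (x - y) * f y

lemma cv_eq_conv (K f : E → ℂ) :
    cv K f = convolution f K (ContinuousLinearMap.mul ℂ ℂ) volume := by
  funext x
  simp only [cv, convolution]
  congr 1; funext y; simp [mul_comm]

lemma cv_comm (K f : E → ℂ) : cv K f = cv f K := by
  funext x
  simp only [cv]
  rw [← integral_sub_left_eq_self _ volume x]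
  congr 1; funext y; simp [mul_comm]

lemma cv_cont_of_int {K f : E → ℂ} (hK : Continuous K) {M : ℝ} (hM : ∀ x, ‖K x‖ ≤ M)
    (hf : Integrable f) : Continuous (cv K f) := by
  rw [cv_eq_conv]
  exact BddAbove.continuous_convolution_right_of_integrable _ ⟨M, by rintro _ ⟨x, rfl⟩; exact hM x⟩ hf hK

lemma sch_bdd (K : 𝓢(E, ℂ)) : ∃ M : ℝ, 0 ≤ M ∧ ∀ x, ‖K x‖ ≤ M := by
  obtain ⟨C, h, hC⟩ := K.decay 0 0
  exact ⟨C, h.le, fun x => by simpa using hC x⟩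

lemma cv_cont_int (K : 𝓢(E, ℂ)) {f : E → ℂ} (hf : Integrable f) : Continuous (cv K f) := by
  obtain ⟨M, _, hM⟩ := sch_bdd K
  exact cv_cont_of_int K.continuous hM hf

lemma cv_cont_bdd (K : 𝓢(E, ℂ)) {f : E → ℂ} (hf : Continuous f) {M : ℝ} (hM : ∀ x, ‖f x‖ ≤ M) :
    Continuous (cv K f) := by
  rw [cv_comm]
  exact cv_cont_of_int hf hM K.integrable

lemma cv_integrand_bdd (K : 𝓢(E, ℂ)) {f : E → ℂ} (hf : AEStronglyMeasurable f volume) {M : ℝ}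
    (hM : ∀ x, ‖f x‖ ≤ M) (x : E) : Integrable (fun y => K (x - y) * f y) := by
  have h1 : Integrable (fun y => K (x - y)) := K.integrable.comp_sub_left x
  exact h1.mul_bdd hf (c := M) (Filter.Eventually.of_forall hM)

lemma cv_integrand_int (K : 𝓢(E, ℂ)) {f : E → ℂ} (hf : Integrable f) (x : E) :
    Integrable (fun y => K (x - y) * f y) := by
  obtain ⟨M, _, hM⟩ := sch_bdd K
  exact hf.bdd_mul (c := M) (by
    exact (K.continuous.comp (by fun_prop)).aestronglyMeasurable)
    (Filter.Eventually.of_forall fun y => hM _)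

lemma cv_bound (K : 𝓢(E, ℂ)) {f : E → ℂ} {M : ℝ}
    (hM : ∀ x, ‖f x‖ ≤ M) (x : E) : ‖cv K f x‖ ≤ (∫ y, ‖K y‖) * M := by
  calc ‖cv K f x‖ ≤ ∫ y, ‖K (x - y)‖ * M := by
        refine norm_integral_le_of_norm_le ?_ (Filter.Eventually.of_forall fun y => ?_)
        · exact ((K.integrable.comp_sub_left x).norm).mul_const M
        · rw [norm_mul]; gcongr; exact hM y
    _ = _ := by
        rw [integral_mul_const, integral_sub_left_eq_self (fun y => ‖K y‖) volume x]

lemma cv_fourier (K : 𝓢(E, ℂ)) {h : E → ℂ} (hh : Integrable h) (x : E) :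
    cv K (𝓕⁻ h) x = 𝓕⁻ (fun ξ => 𝓕 (K : E → ℂ) ξ * h ξ) x := by
  have e1 : cv K (𝓕⁻ h) x = ∫ y, K y * 𝓕 (fun ξ => 𝐞 ⟪ξ, x⟫ • h ξ) y := by
    rw [cv, ← integral_sub_left_eq_self _ volume x]
    congr 1; funext y
    rw [sub_sub_cancel, Real.fourierInv_eq, Real.fourier_eq]
    congr 2; funext ξ
    rw [smul_smul, ← AddChar.map_add_eq_mul]
    congr 2
    rw [inner_sub_right]; ring
  have hh' : Integrable (fun ξ => 𝐞 ⟪ξ, x⟫ • h ξ) := by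
    refine (hh.norm).mono' ?_ (Filter.Eventually.of_forall fun ξ => by simp)
    simp only [Circle.smul_def, smul_eq_mul]
    refine AEStronglyMeasurable.mul ?_ hh.1
    have hc : Continuous (fun ξ : E => 𝐞 ⟪ξ, x⟫) :=
      Real.continuous_fourierChar.comp (continuous_id.inner (continuous_const (y := x)))
    exact (continuous_subtype_val.comp hc).aestronglyMeasurable
  have e2 := VectorFourier.integral_fourierIntegral_smul_eq_flip (L := innerₗ E) (μ := volume)
    (ν := volume) (f := (K : E → ℂ)) (g := fun ξ => 𝐞 ⟪ξ, x⟫ • h ξ) Real.continuous_fourierChar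
    (by exact continuous_inner) K.integrable hh'
  rw [flip_innerₗ] at e2
  rw [e1, Real.fourierInv_eq]
  refine Eq.trans ?_ (e2.symm.trans ?_)
  · rfl
  · congr 1; funext ξ
    change 𝓕 (K : E → ℂ) ξ • _ = _
    rw [smul_eq_mul, Circle.smul_def, Circle.smul_def]
    simp only [smul_eq_mul]; ring

/-- convolution of Schwartz functions as a Schwartz function -/
noncomputable def scv (K g : 𝓢(E, ℂ)) : 𝓢(E, ℂ) :=
  SchwartzMap.convolution (ContinuousLinearMap.mul ℂ ℂ) g K

lemma scv_coe (K g : 𝓢(E, ℂ)) : ⇑(scv K g) = cv K g := by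
  rw [cv_eq_conv]; funext x
  exact SchwartzMap.convolution_apply _ _ _ _

lemma scv_fourier (K g : 𝓢(E, ℂ)) (ξ : E) : 𝓕 (scv K g) ξ = 𝓕 K ξ * 𝓕 g ξ := by
  rw [scv, SchwartzMap.fourier_convolution]
  simp [mul_comm]

lemma eLp2_fourier (g : 𝓢(E, ℂ)) : eLpNorm (⇑(𝓕 g : 𝓢(E, ℂ))) 2 volume = eLpNorm (⇑g) 2 volume := by
  have h := SchwartzMap.norm_fourier_toL2_eq g
  rw [SchwartzMap.norm_toLp, SchwartzMap.norm_toLp] at h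
  have h1 := (SchwartzMap.eLpNorm_lt_top (𝓕 g : 𝓢(E, ℂ)) 2 volume).ne
  have h2 := (SchwartzMap.eLpNorm_lt_top g 2 volume).ne
  exact (ENNReal.toReal_eq_toReal_iff' h1 h2).1 h

lemma cv_l2_schwartz (K g : 𝓢(E, ℂ)) {A : ℝ} (hA : ∀ ξ, ‖𝓕 K ξ‖ ≤ A) :
    eLpNorm (cv K g) 2 volume ≤ ENNReal.ofReal A * eLpNorm g 2 volume := by
  rw [← scv_coe, ← eLp2_fourier, ← eLp2_fourier g]
  refine (eLpNorm_le_mul_eLpNorm_of_ae_le_mul (c := A) (g := ⇑(𝓕 g : 𝓢(E, ℂ))) ?_ 2)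
  refine Filter.Eventually.of_forall fun ξ => ?_
  rw [scv_fourier, norm_mul]
  exact mul_le_mul_of_nonneg_right (hA ξ) (norm_nonneg _)

lemma cv_l2_bound (K : 𝓢(E, ℂ)) {f : E → ℂ} (hf : MemLp f 2 volume) (x : E) :
    ‖cv K f x‖ₑ ≤ eLpNorm K 2 volume * eLpNorm f 2 volume := by
  calc ‖cv K f x‖ₑ ≤ ∫⁻ y, ‖K (x - y) * f y‖ₑ := enorm_integral_le_lintegral_enorm _
    _ = eLpNorm ((fun y => K (x - y)) • f) 1 volume := by
        rw [eLpNorm_one_eq_lintegral_enorm]; rfl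
    _ ≤ eLpNorm (fun y => K (x - y)) 2 volume * eLpNorm f 2 volume :=
        eLpNorm_smul_le_mul_eLpNorm (p := 2) (q := 2) (r := 1) hf.1 
          (K.continuous.comp (continuous_const.sub continuous_id)).aestronglyMeasurable
    _ = _ := by
        congr 1
        exact eLpNorm_comp_measurePreserving (g := ⇑K) (f := fun y => x - y) K.continuous.aestronglyMeasurable
          (Measure.measurePreserving_sub_left volume x)

lemma cv_integrand_l2 (K : 𝓢(E, ℂ)) {f : E → ℂ} (hf : MemLp f 2 volume) (x : E) :
    Integrable (fun y => K (x - y) * f y) := by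
  have : MemLp (fun y => K (x - y)) 2 volume :=
    (K.memLp 2 volume).comp_measurePreserving (Measure.measurePreserving_sub_left volume x)
  exact MemLp.integrable_mul this hf

lemma cv_sub {K : E → ℂ} {f g : E → ℂ} {x : E} (hf : Integrable (fun y => K (x - y) * f y))
    (hg : Integrable (fun y => K (x - y) * g y)) : cv K (f - g) x = cv K f x - cv K g x := by
  simp only [cv]
  rw [← integral_sub hf hg]
  congr 1; funext y; simp [mul_sub]

lemma cv_add {K : E → ℂ} {f g : E → ℂ} {x : E} (hf : Integrable (fun y => K (x - y) * f y))
    (hg : Integrable (fun y => K (x - y) * g y)) : cv K (f + g) x = cv K f x + cv K g x := by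
  simp only [cv]
  rw [← integral_add hf hg]
  congr 1; funext y; simp [mul_add]

/-- L² bound. -/
lemma cv_l2 (K : 𝓢(E, ℂ)) {A : ℝ} (hA : ∀ ξ, ‖𝓕 K ξ‖ ≤ A) {f : E → ℂ} (hf : MemLp f 2 volume) :
    eLpNorm (cv K f) 2 volume ≤ ENNReal.ofReal A * eLpNorm f 2 volume := by
  have hd := SchwartzMap.denseRange_toLpCLM (E := E) (F := ℂ) (p := 2) (μ := volume) (by simp)
  have hmem := hd (hf.toLp f)
  obtain ⟨s, hs, hlim⟩ := mem_closure_iff_seq_limit.1 hmem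
  choose g hg using hs
  have hlim' : Filter.Tendsto (fun n => eLpNorm (⇑(g n) - f) 2 volume) Filter.atTop (nhds 0) := by
    rw [Lp.tendsto_Lp_iff_tendsto_eLpNorm'] at hlim
    refine hlim.congr fun n => ?_
    refine eLpNorm_congr_ae ?_
    rw [← hg n]
    filter_upwards [(g n).coeFn_toLp 2 volume, hf.coeFn_toLp] with x h1 h2
    simp only [Pi.sub_apply, SchwartzMap.toLpCLM_apply, h1, h2]
  have hKf := (SchwartzMap.eLpNorm_lt_top K 2 volume).ne
  have hpt : ∀ x, Filter.Tendsto (fun n => cv K (g n) x) Filter.atTop (nhds (cv K f x)) := by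
    intro x
    rw [tendsto_iff_edist_tendsto_0]
    have : Filter.Tendsto (fun n => eLpNorm K 2 volume * eLpNorm (⇑(g n) - f) 2 volume) Filter.atTop (nhds 0) := by
      have := ENNReal.Tendsto.const_mul (a := eLpNorm K 2 volume) hlim' (Or.inr hKf)
      simpa using this
    refine tendsto_of_tendsto_of_tendsto_of_le_of_le tendsto_const_nhds this (fun _ => zero_le) fun n => ?_
    have h1 := cv_l2_bound K (((g n).memLp 2 volume).sub hf) x
    rw [edist_eq_enorm_sub]
    rw [cv_sub (cv_integrand_l2 K ((g n).memLp 2 volume) x) (cv_integrand_l2 K hf x)] at h1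
    exact h1
  have hFat := Lp.eLpNorm_lim_le_liminf_eLpNorm (μ := volume) (p := 2)
    (f := fun n => cv K (g n)) (fun n => by
      rw [← scv_coe]; exact (scv K (g n)).continuous.aestronglyMeasurable) (cv K f)
    (Filter.Eventually.of_forall hpt)
  refine hFat.trans ?_
  have hconv : Filter.Tendsto (fun n => ENNReal.ofReal A * (eLpNorm (⇑(g n) - f) 2 volume + eLpNorm f 2 volume))
      Filter.atTop (nhds (ENNReal.ofReal A * eLpNorm f 2 volume)) := by
    have := ENNReal.Tendsto.const_mul (a := ENNReal.ofReal A)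
      (hlim'.add (tendsto_const_nhds (x := eLpNorm f 2 volume))) (Or.inr ENNReal.ofReal_ne_top)
    simpa using this
  rw [← hconv.liminf_eq]
  refine Filter.liminf_le_liminf (Filter.Eventually.of_forall fun n => ?_)
  refine (cv_l2_schwartz K (g n) hA).trans ?_
  gcongr
  calc eLpNorm (g n) 2 volume = eLpNorm ((⇑(g n) - f) + f) 2 volume := by simp
    _ ≤ _ := eLpNorm_add_le (((g n).memLp 2 volume).sub hf).1 hf.1 (by norm_num)

lemma cv_meas (K : 𝓢(E, ℂ)) {f : E → ℂ} (hf : AEStronglyMeasurable f volume) :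
    AEStronglyMeasurable (cv K f) volume := by
  unfold cv
  apply AEStronglyMeasurable.integral_prod_right' (f := fun z : E × E => K (z.1 - z.2) * f z.2)
  apply AEStronglyMeasurable.mul
  · exact (K.continuous.comp (by fun_prop)).aestronglyMeasurable
  · exact hf.comp_snd

end conv
end KP


namespace KP
set_option linter.unusedVariables false
set_option linter.unusedSectionVars false
set_option linter.style.haveILetI false

section cz
variable {E : Type*} [NormedAddCommGroup E] [InnerProductSpace ℝ E] [FiniteDimensional ℝ E]
  [MeasurableSpace E] [BorelSpace E]

open Metric in
lemma vol_cb (x : E) {c : ℝ} (hc : 0 < c) (r : ℝ) :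
    volume (closedBall x (c * r)) = ENNReal.ofReal (c ^ Module.finrank ℝ E) * volume (closedBall x r) := by
  rw [Measure.addHaar_closedBall_mul_of_pos volume x hc, Measure.addHaar_closedBall_center volume x r]

open Metric in
lemma cover_radius [Nontrivial E] {f : E → ℂ} (hf : Continuous f) (hi : ∫⁻ x, ‖f x‖ₑ ≠ ∞) {h : ℝ} (hh : 0 < h)
    {x : E} (hx : h ≤ ‖f x‖) : ∃ r : ℝ, 0 < r ∧
      ENNReal.ofReal (h/2) * volume (closedBall x r) ≤ ∫⁻ y in closedBall x r, ‖f y‖ₑ ∧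
      ∫⁻ y in closedBall x (5 * r), ‖f y‖ₑ < ENNReal.ofReal (h/2) * volume (closedBall x (5 * r)) := by
  obtain ⟨ρ, hρ, hball⟩ : ∃ ρ > 0, ∀ y ∈ closedBall x ρ, h/2 ≤ ‖f y‖ := by
    have h1 : ∀ᶠ y in nhds x, h/2 < ‖f y‖ := 
      (hf.norm.tendsto x).eventually (lt_mem_nhds (by linarith))
    obtain ⟨ε, hε, hb⟩ := Metric.nhds_basis_closedBall.eventually_iff.1 h1
    exact ⟨ε, hε, fun y hy => (hb hy).le⟩
  let P : ℕ → Prop := fun n => ∫⁻ y in closedBall x (5^n * ρ), ‖f y‖ₑ < ENNReal.ofReal (h/2) * volume (closedBall x (5^n * ρ))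
  have hpos : volume (closedBall x ρ) ≠ 0 := (measure_closedBall_pos volume x hρ).ne'
  have hfin : volume (closedBall x ρ) ≠ ∞ := measure_closedBall_lt_top.ne
  have hex : ∃ n, P n := by
    have hd : 1 ≤ Module.finrank ℝ E := Module.finrank_pos
    have hT : ENNReal.ofReal (h/2) * volume (closedBall x ρ) ≠ 0 := by
      simp [hpos, hh]
    have hT' : ENNReal.ofReal (h/2) * volume (closedBall x ρ) ≠ ∞ := 
      ENNReal.mul_ne_top ENNReal.ofReal_ne_top hfin
    have htend : Filter.Tendsto (fun n : ℕ => ENNReal.ofReal ((5:ℝ)^n)) Filter.atTop (nhds ∞) :=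
      ENNReal.tendsto_ofReal_nhds_top.2 (tendsto_pow_atTop_atTop_of_one_lt (by norm_num))
    have hlt : (∫⁻ x, ‖f x‖ₑ) / (ENNReal.ofReal (h/2) * volume (closedBall x ρ)) < ∞ :=
      ENNReal.div_lt_top hi hT
    obtain ⟨n, hn⟩ := (htend.eventually (lt_mem_nhds hlt)).exists
    refine ⟨n, ?_⟩
    show _ < _
    calc ∫⁻ y in closedBall x (5^n * ρ), ‖f y‖ₑ ≤ ∫⁻ y, ‖f y‖ₑ := setLIntegral_le_lintegral _ _
      _ < ENNReal.ofReal ((5:ℝ)^n) * (ENNReal.ofReal (h/2) * volume (closedBall x ρ)) := by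
          exact (ENNReal.div_lt_iff (Or.inl hT) (Or.inl hT')).1 hn
      _ ≤ ENNReal.ofReal (h/2) * volume (closedBall x (5^n * ρ)) := by
          rw [vol_cb x (by positivity) ρ, mul_left_comm]
          gcongr
          exact le_self_pow₀ (one_le_pow₀ (by norm_num)) (by lia)
  classical
  have hn0 : Nat.find hex ≠ 0 := by
    intro h0
    have := Nat.find_spec hex
    rw [h0] at this
    have h2 : ENNReal.ofReal (h/2) * volume (closedBall x ρ) ≤ ∫⁻ y in closedBall x ρ, ‖f y‖ₑ := by
      rw [← setLIntegral_const]
      refine setLIntegral_mono' isClosed_closedBall.measurableSet fun y hy => ?_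
      rw [← ofReal_norm]
      exact ENNReal.ofReal_le_ofReal (hball y hy)
    simp only [P, pow_zero, one_mul] at this
    exact absurd this (not_lt.2 h2)
  obtain ⟨m, hm⟩ := Nat.exists_eq_succ_of_ne_zero hn0
  refine ⟨5^m * ρ, by positivity, ?_, ?_⟩
  · have := Nat.find_min hex (m := m) (by lia)
    exact not_lt.1 this
  · have := Nat.find_spec hex
    rw [hm] at this
    simp only [P, pow_succ] at this
    convert this using 3 <;> ring_nf

open Metric in
lemma cover_balls [Nontrivial E] {f : E → ℂ} (hf : Continuous f) (hs : HasCompactSupport f) {h : ℝ} (hh : 0 < h) :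
    ∃ (t : Finset E) (r : E → ℝ), (∀ i ∈ t, 0 < r i) ∧
      ((t : Set E).PairwiseDisjoint fun i => closedBall i (r i)) ∧
      (∀ i ∈ t, ENNReal.ofReal (h/2) * volume (closedBall i (r i)) ≤ ∫⁻ y in closedBall i (r i), ‖f y‖ₑ) ∧
      (∀ i ∈ t, ∫⁻ y in closedBall i (5 * r i), ‖f y‖ₑ ≤ ENNReal.ofReal (h/2) * volume (closedBall i (5 * r i))) ∧
      (∀ x, h ≤ ‖f x‖ → ∃ i ∈ t, x ∈ closedBall i (5 * r i)) := by
  have hi : ∫⁻ x, ‖f x‖ₑ ≠ ∞ := (hf.integrable_of_hasCompactSupport hs).2.ne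
  have hS : IsCompact {x | h ≤ ‖f x‖} := by
    refine hs.of_isClosed_subset (isClosed_le continuous_const hf.norm) fun x hx => ?_
    apply subset_tsupport
    simp only [Function.mem_support]
    intro h0
    simp only [Set.mem_ofPred_eq, h0, norm_zero] at hx
    linarith
  have hr := fun (x : E) (hx : h ≤ ‖f x‖) => cover_radius hf hi hh hx
  choose! r hr0 hr1 hr2 using hr
  obtain ⟨t0, ht0, hcov⟩ := hS.elim_nhds_subcover (fun x => ball x (r x)) (fun x hx => ball_mem_nhds x (hr0 x hx))
  obtain ⟨R, hR⟩ := (t0.finite_toSet.image r).bddAbove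
  obtain ⟨u, hu, hdis, hcv⟩ := Vitali.exists_disjoint_subfamily_covering_enlargement_closedBall (t0 : Set E) (fun x => x) r R
    (fun a ha => hR ⟨a, ha, rfl⟩) 5 (by norm_num)
  have hufin : u.Finite := t0.finite_toSet.subset hu
  have hmem : ∀ i ∈ hufin.toFinset, h ≤ ‖f i‖ := fun i hi => ht0 i (hu (hufin.mem_toFinset.1 hi))
  refine ⟨hufin.toFinset, r, fun i hi => hr0 i (hmem i hi), by simpa using hdis, fun i hi => hr1 i (hmem i hi), fun i hi => (hr2 i (hmem i hi)).le, ?_⟩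
  intro x hx
  obtain ⟨a, ha, hxa⟩ := Set.mem_iUnion₂.1 (hcov hx)
  obtain ⟨b, hb, hab⟩ := hcv a ha
  exact ⟨b, by simpa using hb, hab (ball_subset_closedBall hxa)⟩

open Metric in
lemma bad_bound (K : 𝓢(E, ℂ)) {A : ℝ≥0∞} 
    (hK : ∀ y : E, ∫⁻ x in {x | 2 * ‖y‖ < ‖x‖}, ‖K (x - y) - K x‖ₑ ≤ A)
    {b : E → ℂ} (hb : Integrable b) {c : E} {R : ℝ} (hsupp : ∀ x, x ∉ closedBall c R → b x = 0)
    (h0 : ∫ x, b x = 0) :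
    ∫⁻ x in {x | 2 * R < ‖x - c‖}, ‖cv K b x‖ₑ ≤ A * ∫⁻ x, ‖b x‖ₑ := by
  have e1 : ∀ x, ‖cv K b x‖ₑ ≤ ∫⁻ y, ‖K (x - y) - K (x - c)‖ₑ * ‖b y‖ₑ := by
    intro x
    have : cv K b x = ∫ y, (K (x - y) - K (x - c)) * b y := by
      simp only [sub_mul]
      rw [integral_sub (cv_integrand_int K hb x) (hb.const_mul _), integral_const_mul, h0]
      simp [cv]
    rw [this]
    refine (enorm_integral_le_lintegral_enorm _).trans (le_of_eq ?_)
    simp only [enorm_mul]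
  calc ∫⁻ x in {x | 2 * R < ‖x - c‖}, ‖cv K b x‖ₑ 
      ≤ ∫⁻ x in {x | 2 * R < ‖x - c‖}, ∫⁻ y, ‖K (x - y) - K (x - c)‖ₑ * ‖b y‖ₑ := lintegral_mono e1
    _ = ∫⁻ y, ∫⁻ x in {x | 2 * R < ‖x - c‖}, ‖K (x - y) - K (x - c)‖ₑ * ‖b y‖ₑ := by
        apply lintegral_lintegral_swap
        have h1 : Continuous (fun z : E × E => K (z.1 - z.2) - K (z.1 - c)) := by
          have := K.continuous; fun_prop
        exact (h1.measurable.enorm.aemeasurable).mul (hb.1.enorm.comp_snd)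
    _ ≤ ∫⁻ y, A * ‖b y‖ₑ := by
        refine lintegral_mono fun y => ?_
        rw [lintegral_mul_const' _ _ (by simp)]
        by_cases hy : y ∈ closedBall c R
        · gcongr
          have hy' : ‖y - c‖ ≤ R := by simpa [dist_eq_norm] using hy
          calc ∫⁻ x in {x | 2 * R < ‖x - c‖}, ‖K (x - y) - K (x - c)‖ₑ
              ≤ ∫⁻ x in {x | 2 * ‖y - c‖ < ‖x - c‖}, ‖K (x - y) - K (x - c)‖ₑ := by
                refine lintegral_mono_set fun x hx => ?_
                simp only [Set.mem_ofPred_eq] at hx ⊢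
                linarith
            _ = ∫⁻ x in {x | 2 * ‖y - c‖ < ‖x‖}, ‖K (x - (y - c)) - K x‖ₑ := by
                have hm1 : MeasurableSet {x : E | 2 * ‖y - c‖ < ‖x - c‖} :=
                  measurableSet_lt measurable_const (by fun_prop)
                have hm2 : MeasurableSet {x : E | 2 * ‖y - c‖ < ‖x‖} :=
                  measurableSet_lt measurable_const (by fun_prop)
                rw [← lintegral_indicator hm1, ← lintegral_indicator hm2,
                  ← lintegral_add_right_eq_self _ c]
                congr 1; funext x
                simp only [Set.indicator, Set.mem_ofPred_eq]
                rw [show x - (y - c) = x + c - y by abel, add_sub_cancel_right]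
            _ ≤ A := hK _
        · simp [hsupp y hy]
    _ = _ := by rw [lintegral_const_mul'' _ hb.1.enorm]

end cz
end KP


namespace KP
set_option linter.unusedVariables false
set_option linter.unusedSectionVars false
set_option linter.style.haveILetI false

section cz
variable {E : Type*} [NormedAddCommGroup E] [InnerProductSpace ℝ E] [FiniteDimensional ℝ E]
  [MeasurableSpace E] [BorelSpace E]

open Metric in
lemma cz_decomp [Nontrivial E] {f : E → ℂ} (hf : Continuous f) (hs : HasCompactSupport f) {h : ℝ} (hh : 0 < h) :
    ∃ (t : Finset E) (r : E → ℝ) (b : E → E → ℂ) (g : E → ℂ),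
      (∀ i ∈ t, 0 < r i) ∧ Integrable g ∧ (∀ i ∈ t, Integrable (b i)) ∧
      (∀ x, f x = g x + ∑ i ∈ t, b i x) ∧ (∀ x, ‖g x‖ ≤ 5 ^ (Module.finrank ℝ E) * h) ∧
      (∫⁻ x, ‖g x‖ₑ ≤ 2 * ∫⁻ x, ‖f x‖ₑ) ∧
      (∀ i ∈ t, ∀ x, x ∉ closedBall i (5 * r i) → b i x = 0) ∧
      (∀ i ∈ t, ∫ x, b i x = 0) ∧
      (∑ i ∈ t, ∫⁻ x, ‖b i x‖ₑ ≤ 2 * ∫⁻ x, ‖f x‖ₑ) ∧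
      (∑ i ∈ t, ENNReal.ofReal (h/2) * volume (closedBall i (r i)) ≤ ∫⁻ x, ‖f x‖ₑ) := by
  obtain ⟨t, r, hr, hdis, hB, hQ, hcov⟩ := cover_balls hf hs hh
  have hfi : Integrable f := hf.integrable_of_hasCompactSupport hs
  set d := Module.finrank ℝ E
  set B : E → Set E := fun i => closedBall i (r i) with hBdef
  set Q : E → Set E := fun i => closedBall i (5 * r i) with hQdef
  have mB : ∀ i, MeasurableSet (B i) := fun i => isClosed_closedBall.measurableSet
  have mQ : ∀ i, MeasurableSet (Q i) := fun i => isClosed_closedBall.measurableSet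
  have hBQ : ∀ i ∈ t, B i ⊆ Q i := fun i hi => closedBall_subset_closedBall (by linarith [hr i hi])
  set N : E → ℝ := fun x => ∑ i ∈ t, (Q i).indicator (fun _ => (1:ℝ)) x with hN
  set w : E → E → ℝ := fun i x => (Q i).indicator (fun _ => (1:ℝ)) x / N x with hw
  have ind0 : ∀ i x, 0 ≤ (Q i).indicator (fun _ => (1:ℝ)) x := fun i x => 
    Set.indicator_nonneg (fun _ _ => zero_le_one) x
  have hN0 : ∀ x, 0 ≤ N x := fun x => Finset.sum_nonneg fun i _ => ind0 i x
  have w0 : ∀ i x, 0 ≤ w i x := fun i x => div_nonneg (ind0 i x) (hN0 x)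
  have wQ : ∀ i x, x ∉ Q i → w i x = 0 := fun i x hx => by simp [hw, hx]
  have w1 : ∀ i ∈ t, ∀ x, w i x ≤ 1 := fun i hi x => 
    div_le_one_of_le₀ (Finset.single_le_sum (f := fun i => (Q i).indicator (fun _ => (1:ℝ)) x) (fun j _ => ind0 j x) hi) (hN0 x)
  have wsum : ∀ x, (∃ i ∈ t, x ∈ Q i) → ∑ i ∈ t, w i x = 1 := by
    rintro x ⟨i, hi, hx⟩
    simp only [hw]
    rw [← Finset.sum_div]
    refine div_self (ne_of_gt ?_)
    refine lt_of_lt_of_le ?_ (Finset.single_le_sum (f := fun i => (Q i).indicator (fun _ => (1:ℝ)) x) (fun j _ => ind0 j x) hi)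
    simp [hx]
  have wsum0 : ∀ x, (¬ ∃ i ∈ t, x ∈ Q i) → ∑ i ∈ t, w i x = 0 := by
    intro x hx
    push Not at hx
    exact Finset.sum_eq_zero fun i hi => wQ i x (hx i hi)
  have wsumle : ∀ x, ∑ i ∈ t, w i x ≤ 1 := by
    intro x
    by_cases hx : ∃ i ∈ t, x ∈ Q i
    · exact (wsum x hx).le
    · rw [wsum0 x hx]; exact zero_le_one
  have mw : ∀ i, Measurable (w i) := by
    intro i
    refine (measurable_const.indicator (mQ i)).div ?_
    exact Finset.measurable_sum _ fun j _ => measurable_const.indicator (mQ j)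
  have volB0 : ∀ i ∈ t, volume (B i) ≠ 0 := fun i hi => (measure_closedBall_pos volume i (hr i hi)).ne'
  have volBT : ∀ i, volume (B i) ≠ ∞ := fun i => measure_closedBall_lt_top.ne
  set c : E → ℂ := fun i => (∫ x, (w i x : ℂ) * f x) / ((volume (B i)).toReal : ℂ) with hc
  set m : E → ℝ≥0∞ := fun i => ∫⁻ x, ENNReal.ofReal (w i x) * ‖f x‖ₑ with hm
  have iwf : ∀ i ∈ t, Integrable (fun x => (w i x : ℂ) * f x) := fun i hi => by
    refine hfi.bdd_mul (c := 1) (Complex.measurable_ofReal.comp (mw i)).aestronglyMeasurable 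
      (Filter.Eventually.of_forall fun x => ?_)
    simp [abs_of_nonneg (w0 i x), w1 i hi x]
  have enw : ∀ i x, ‖(w i x : ℂ) * f x‖ₑ = ENNReal.ofReal (w i x) * ‖f x‖ₑ := by
    intro i x
    rw [enorm_mul]; congr 1
    rw [← ofReal_norm, Complex.norm_real, Real.norm_of_nonneg (w0 i x)]
  have hcB : ∀ i ∈ t, ‖c i‖ₑ * volume (B i) ≤ m i := by
    intro i hi
    have h1 : c i * ((volume (B i)).toReal : ℂ) = ∫ x, (w i x : ℂ) * f x := by
      refine div_mul_cancel₀ _ ?_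
      exact_mod_cast (ENNReal.toReal_pos (volB0 i hi) (volBT i)).ne'
    have h2 : ‖((volume (B i)).toReal : ℂ)‖ₑ = volume (B i) := by
      rw [← ofReal_norm, Complex.norm_real, Real.norm_of_nonneg ENNReal.toReal_nonneg, ENNReal.ofReal_toReal (volBT i)]
    calc ‖c i‖ₑ * volume (B i) = ‖∫ x, (w i x : ℂ) * f x‖ₑ := by rw [← h1, enorm_mul, h2]
      _ ≤ ∫⁻ x, ‖(w i x : ℂ) * f x‖ₑ := enorm_integral_le_lintegral_enorm _
      _ = m i := by simp only [enw, hm]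
  have hmQ : ∀ i ∈ t, m i ≤ ENNReal.ofReal (h/2) * volume (Q i) := by
    intro i hi
    refine le_trans ?_ (hQ i hi)
    rw [← lintegral_indicator (mQ i)]
    refine lintegral_mono fun x => ?_
    by_cases hx : x ∈ Q i
    · rw [Set.indicator_of_mem hx]
      calc ENNReal.ofReal (w i x) * ‖f x‖ₑ ≤ ENNReal.ofReal 1 * ‖f x‖ₑ := by gcongr; exact w1 i hi x
        _ = _ := by simp
    · simp [wQ i x hx]
  have hcn : ∀ i ∈ t, ‖c i‖ ≤ 5 ^ d * h := by
    intro i hi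
    have h1 := (hcB i hi).trans (hmQ i hi)
    rw [show Q i = closedBall i (5 * r i) from rfl, vol_cb i (by norm_num) (r i), ← mul_assoc] at h1
    have h2 := (ENNReal.mul_le_mul_iff_left (volB0 i hi) (volBT i)).1 h1
    rw [← ENNReal.ofReal_mul (by positivity), ← ofReal_norm, ENNReal.ofReal_le_ofReal_iff (by positivity)] at h2
    refine h2.trans ?_
    have : (0:ℝ) < 5 ^ Module.finrank ℝ E := by positivity
    nlinarith
  have hmsum : ∑ i ∈ t, m i ≤ ∫⁻ x, ‖f x‖ₑ := by
    simp only [hm]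
    rw [← lintegral_finsetSum' (f := fun i x => ENNReal.ofReal (w i x) * ‖f x‖ₑ) _ (fun i _ => ((mw i).ennreal_ofReal.mul hf.measurable.enorm).aemeasurable)]
    refine lintegral_mono fun x => ?_
    rw [← Finset.sum_mul, ← ENNReal.ofReal_sum_of_nonneg (fun i _ => w0 i x)]
    calc _ ≤ ENNReal.ofReal 1 * ‖f x‖ₑ := by gcongr; exact wsumle x
      _ = _ := by simp
  set b : E → E → ℂ := fun i x => (w i x : ℂ) * f x - (B i).indicator (fun _ => c i) x with hb
  have iind : ∀ i, Integrable ((B i).indicator (fun _ => c i)) := fun i => 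
    (integrable_indicator_iff (mB i)).2 (integrableOn_const (volBT i))
  have lind : ∀ i, ∫⁻ x, ‖(B i).indicator (fun _ => c i) x‖ₑ = ‖c i‖ₑ * volume (B i) := by
    intro i
    simp only [enorm_indicator_eq_indicator_enorm]
    rw [lintegral_indicator (mB i), setLIntegral_const]
  have ib : ∀ i ∈ t, Integrable (b i) := fun i hi => (iwf i hi).sub (iind i)
  have gform : ∀ x, f x - ∑ i ∈ t, b i x = (1 - ∑ i ∈ t, (w i x : ℂ)) * f x + ∑ i ∈ t, (B i).indicator (fun _ => c i) x := by
    intro x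
    simp only [hb, Finset.sum_sub_distrib, ← Finset.sum_mul]
    ring
  refine ⟨t, r, b, fun x => f x - ∑ i ∈ t, b i x, hr, ?_, ib, fun x => by ring, ?_, ?_, ?_, ?_, ?_, ?_⟩
  · exact hfi.sub (integrable_finsetSum _ ib)
  · intro x
    simp only [gform]
    have h5 : (1:ℝ) ≤ 5 ^ d := one_le_pow₀ (by norm_num)
    by_cases hx : ∃ i ∈ t, x ∈ Q i
    · have : ∑ i ∈ t, (w i x : ℂ) = 1 := by exact_mod_cast wsum x hx
      rw [this, sub_self, zero_mul, zero_add]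
      by_cases hxB : ∃ j ∈ t, x ∈ B j
      · obtain ⟨j, hj, hxj⟩ := hxB
        rw [Finset.sum_eq_single j]
        · rw [Set.indicator_of_mem hxj]; exact hcn j hj
        · intro i hi hij
          refine Set.indicator_of_notMem (fun hxi => ?_) _
          exact Set.disjoint_left.1 (hdis hi hj hij) hxi hxj
        · exact fun h => absurd hj h
      · push Not at hxB
        rw [Finset.sum_eq_zero fun i hi => Set.indicator_of_notMem (hxB i hi) _, norm_zero]
        positivity
    · have : ∑ i ∈ t, (w i x : ℂ) = 0 := by exact_mod_cast wsum0 x hx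
      have hlt : ‖f x‖ < h := by
        by_contra hcon
        exact hx (hcov x (not_lt.1 hcon))
      push Not at hx
      rw [this, Finset.sum_eq_zero fun i hi => Set.indicator_of_notMem (fun hxB => hx i hi (hBQ i hi hxB)) _]
      simp only [sub_zero, one_mul, add_zero]
      nlinarith
  · calc ∫⁻ x, ‖f x - ∑ i ∈ t, b i x‖ₑ ≤ ∫⁻ x, (‖f x‖ₑ + ∑ i ∈ t, ‖(B i).indicator (fun _ => c i) x‖ₑ) := by
          refine lintegral_mono fun x => ?_
          rw [gform]
          refine (enorm_add_le _ _).trans (add_le_add ?_ (enorm_sum_le _ _))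
          rw [enorm_mul]
          refine mul_le_of_le_one_left zero_le ?_
          rw [show (1 - ∑ i ∈ t, (w i x : ℂ)) = ((1 - ∑ i ∈ t, w i x : ℝ) : ℂ) by push_cast; ring]
          rw [← ofReal_norm, Complex.norm_real, Real.norm_of_nonneg (by linarith [wsumle x])]
          rw [ENNReal.ofReal_le_one]
          linarith [Finset.sum_nonneg fun i (_ : i ∈ t) => w0 i x]
      _ = (∫⁻ x, ‖f x‖ₑ) + ∑ i ∈ t, ‖c i‖ₑ * volume (B i) := by
          rw [lintegral_add_left hf.measurable.enorm, lintegral_finsetSum']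
          · simp only [lind]
          · exact fun i _ => (iind i).1.enorm
      _ ≤ (∫⁻ x, ‖f x‖ₑ) + ∫⁻ x, ‖f x‖ₑ := by
          gcongr
          exact (Finset.sum_le_sum hcB).trans hmsum
      _ = _ := by rw [two_mul]
  · intro i hi x hx
    simp only [hb, wQ i x hx, Set.indicator_of_notMem (fun h => hx (hBQ i hi h))]
    simp
  · intro i hi
    simp only [hb]
    rw [integral_sub (iwf i hi) (iind i), integral_indicator (mB i), setIntegral_const, Measure.real]
    have : ((volume (B i)).toReal : ℂ) ≠ 0 := by
      exact_mod_cast (ENNReal.toReal_pos (volB0 i hi) (volBT i)).ne'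
    simp only [hc, Complex.real_smul]
    rw [mul_div_cancel₀ _ this, sub_self]
  · calc ∑ i ∈ t, ∫⁻ x, ‖b i x‖ₑ ≤ ∑ i ∈ t, (m i + m i) := by
          refine Finset.sum_le_sum fun i hi => ?_
          calc ∫⁻ x, ‖b i x‖ₑ ≤ ∫⁻ x, (‖(w i x : ℂ) * f x‖ₑ + ‖(B i).indicator (fun _ => c i) x‖ₑ) :=
                lintegral_mono fun x => enorm_sub_le
            _ = m i + ‖c i‖ₑ * volume (B i) := by
                rw [lintegral_add_left' (iwf i hi).1.enorm, lind]
                simp only [enw, hm]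
            _ ≤ m i + m i := by gcongr; exact hcB i hi
      _ = 2 * ∑ i ∈ t, m i := by rw [Finset.sum_add_distrib, two_mul]
      _ ≤ _ := by gcongr
  · calc _ ≤ ∑ i ∈ t, ∫⁻ y in B i, ‖f y‖ₑ := Finset.sum_le_sum hB
      _ = ∫⁻ y in ⋃ i ∈ t, B i, ‖f y‖ₑ := by
          rw [lintegral_biUnion_finset hdis (fun i _ => mB i)]
      _ ≤ _ := setLIntegral_le_lintegral _ _

end cz
end KP


namespace KP
set_option linter.unusedVariables false
set_option linter.unusedSectionVars false
set_option linter.style.haveILetI false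

lemma eLp_pow {α F : Type*} [MeasurableSpace α] {μ : Measure α} [NormedAddCommGroup F] {p : ℝ} (hp : 0 < p) (f : α → F) :
    eLpNorm f (ENNReal.ofReal p) μ = (∫⁻ x, ENNReal.ofReal (‖f x‖ ^ p) ∂μ) ^ (1 / p) := by
  rw [eLpNorm_eq_lintegral_rpow_enorm_toReal (by simpa using hp) (by simp), ENNReal.toReal_ofReal hp.le]
  congr 2; funext x
  rw [← ofReal_norm, ENNReal.ofReal_rpow_of_nonneg (norm_nonneg _) hp.le]

lemma eLp_le_of_pow {α F F' : Type*} [MeasurableSpace α] {μ : Measure α} [NormedAddCommGroup F]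
    [NormedAddCommGroup F'] {p : ℝ} (hp : 0 < p) {f : α → F} {g : α → F'} {C : ℝ≥0∞}
    (h : ∫⁻ x, ENNReal.ofReal (‖f x‖ ^ p) ∂μ ≤ C * ∫⁻ x, ENNReal.ofReal (‖g x‖ ^ p) ∂μ) :
    eLpNorm f (ENNReal.ofReal p) μ ≤ C ^ (1 / p) * eLpNorm g (ENNReal.ofReal p) μ := by
  rw [eLp_pow hp, eLp_pow hp, ← ENNReal.mul_rpow_of_nonneg _ _ (by positivity)]
  exact ENNReal.rpow_le_rpow h (by positivity)

lemma pow_le_of_eLp {α F F' : Type*} [MeasurableSpace α] {μ : Measure α} [NormedAddCommGroup F]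
    [NormedAddCommGroup F'] {p : ℝ} (hp : 0 < p) {f : α → F} {g : α → F'} {C : ℝ≥0∞}
    (h : eLpNorm f (ENNReal.ofReal p) μ ≤ C * eLpNorm g (ENNReal.ofReal p) μ) :
    ∫⁻ x, ENNReal.ofReal (‖f x‖ ^ p) ∂μ ≤ C ^ p * ∫⁻ x, ENNReal.ofReal (‖g x‖ ^ p) ∂μ := by
  have := ENNReal.rpow_le_rpow h hp.le
  rw [ENNReal.mul_rpow_of_nonneg _ _ hp.le, eLp_pow hp, eLp_pow hp, ← ENNReal.rpow_mul, ← ENNReal.rpow_mul,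
    one_div_mul_cancel hp.ne', ENNReal.rpow_one, ENNReal.rpow_one] at this
  exact this

lemma eLp_two_sq {α F : Type*} [MeasurableSpace α] {μ : Measure α} [NormedAddCommGroup F] (f : α → F) :
    eLpNorm f 2 μ ^ 2 = ∫⁻ x, ‖f x‖ₑ ^ 2 ∂μ := by
  have := eLpNorm_nnreal_pow_eq_lintegral (μ := μ) (f := f) (p := 2) (by norm_num)
  simpa using this

lemma div_aux {a b : ℝ} (ha : 0 < a) (hb : 0 ≤ b) {v F : ℝ≥0∞} (h : ENNReal.ofReal a * v ≤ ENNReal.ofReal b * F) :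
    v ≤ ENNReal.ofReal (b / a) * F := by
  have h0 : ENNReal.ofReal a ≠ 0 := by simpa using ha
  rw [ENNReal.ofReal_div_of_pos ha, ENNReal.div_eq_inv_mul, mul_assoc]
  calc v = (ENNReal.ofReal a)⁻¹ * (ENNReal.ofReal a * v) := by
        rw [← mul_assoc, ENNReal.inv_mul_cancel h0 ENNReal.ofReal_ne_top, one_mul]
    _ ≤ _ := by gcongr

section cz
variable {E : Type*} [NormedAddCommGroup E] [InnerProductSpace ℝ E] [FiniteDimensional ℝ E]
  [MeasurableSpace E] [BorelSpace E]

lemma cheb2 (K : 𝓢(E, ℂ)) {A : ℝ} (hA0 : 0 ≤ A) (hF : ∀ ξ, ‖𝓕 K ξ‖ ≤ A) {g : E → ℂ} (hg : MemLp g 2 volume)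
    {h : ℝ} (hh : 0 < h) : volume {x | h ≤ ‖cv K g x‖} ≤ ENNReal.ofReal (A ^ 2 / h ^ 2) * ∫⁻ x, ‖g x‖ₑ ^ 2 := by
  apply div_aux (by positivity) (by positivity)
  have h1 := mul_meas_ge_le_lintegral₀ (μ := volume) (f := fun x => ‖cv K g x‖ₑ ^ 2) ((cv_meas K hg.1).enorm.pow_const 2) (ENNReal.ofReal (h^2))
  have h2 : ∫⁻ x, ‖cv K g x‖ₑ ^ 2 ≤ ENNReal.ofReal (A ^ 2) * ∫⁻ x, ‖g x‖ₑ ^ 2 := by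
    rw [← eLp_two_sq, ← eLp_two_sq, ENNReal.ofReal_pow hA0, ← mul_pow]
    exact pow_le_pow_left' (cv_l2 K hF hg) 2
  refine le_trans ?_ (h1.trans h2)
  gcongr ENNReal.ofReal (h^2) * volume ?_
  intro x hx
  simp only [Set.mem_ofPred_eq] at hx ⊢
  rw [← ofReal_norm, ← ENNReal.ofReal_pow (norm_nonneg _)]
  exact ENNReal.ofReal_le_ofReal (by gcongr)

open Metric in
lemma weak11 [Nontrivial E] (K : 𝓢(E, ℂ)) {A : ℝ} (hA0 : 0 ≤ A) (hF : ∀ ξ, ‖𝓕 K ξ‖ ≤ A)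
    (hK : ∀ y : E, ∫⁻ x in {x | 2 * ‖y‖ < ‖x‖}, ‖K (x - y) - K x‖ₑ ≤ ENNReal.ofReal A)
    {f : E → ℂ} (hf : Continuous f) (hs : HasCompactSupport f) {h : ℝ} (hh : 0 < h) :
    volume {x | h < ‖cv K f x‖} ≤ 
      ENNReal.ofReal ((8 * A ^ 2 * 5 ^ (Module.finrank ℝ E) + 2 * 10 ^ (Module.finrank ℝ E) + 4 * A) / h) * ∫⁻ x, ‖f x‖ₑ := by
  obtain ⟨t, r, b, g, hr, ig, ib, hfe, hgb, hg1, hbs, hb0, hb1, hv⟩ := cz_decomp hf hs hh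
  have hfi : Integrable f := hf.integrable_of_hasCompactSupport hs
  set d := Module.finrank ℝ E
  set F := ∫⁻ x, ‖f x‖ₑ with hFdef
  have hFT : F ≠ ∞ := hfi.2.ne
  have hg2 : ∫⁻ x, ‖g x‖ₑ ^ 2 ≤ ENNReal.ofReal (5 ^ d * h) * (2 * F) := by
    refine le_trans ?_ (mul_le_mul_right hg1 _)
    rw [← lintegral_const_mul'' _ ig.1.enorm]
    refine lintegral_mono fun x => ?_
    rw [sq]
    gcongr
    rw [← ofReal_norm]
    exact ENNReal.ofReal_le_ofReal (hgb x)
  have hgm : MemLp g 2 volume := by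
    refine ⟨ig.1, ?_⟩
    have : eLpNorm g 2 volume ^ 2 ≠ ∞ := by
      rw [eLp_two_sq]
      exact ne_top_of_le_ne_top (ENNReal.mul_ne_top ENNReal.ofReal_ne_top (ENNReal.mul_ne_top (by simp) hFT)) hg2
    exact lt_top_iff_ne_top.2 fun hc => this (by rw [hc]; simp)
  -- first set
  have S1 : volume {x | h/2 ≤ ‖cv K g x‖} ≤ ENNReal.ofReal (8 * A ^ 2 * 5 ^ d / h) * F := by
    refine (cheb2 K hA0 hF hgm (half_pos hh)).trans ?_
    calc _ ≤ ENNReal.ofReal (A ^ 2 / (h/2) ^ 2) * (ENNReal.ofReal (5 ^ d * h) * (2 * F)) := by gcongr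
      _ = _ := by
        rw [show (2:ℝ≥0∞) = ENNReal.ofReal 2 by simp, ← mul_assoc, ← mul_assoc, ← ENNReal.ofReal_mul (by positivity),
          ← ENNReal.ofReal_mul (by positivity)]
        congr 2
        field_simp; ring
  set Ω : Set E := ⋃ i ∈ t, closedBall i (10 * r i) with hΩ
  have mΩ : MeasurableSet Ω := t.measurableSet_biUnion fun i _ => isClosed_closedBall.measurableSet
  have S2 : volume Ω ≤ ENNReal.ofReal (2 * 10 ^ d / h) * F := by
    have : volume Ω ≤ ENNReal.ofReal (10 ^ d / (h/2)) * F := by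
      apply div_aux (by positivity) (by positivity)
      calc ENNReal.ofReal (h/2) * volume Ω ≤ ENNReal.ofReal (h/2) * ∑ i ∈ t, volume (closedBall i (10 * r i)) := by
            gcongr; exact measure_biUnion_finset_le _ _
        _ = ENNReal.ofReal (10 ^ d) * ∑ i ∈ t, ENNReal.ofReal (h/2) * volume (closedBall i (r i)) := by
            rw [Finset.mul_sum, Finset.mul_sum]
            refine Finset.sum_congr rfl fun i _ => ?_
            rw [vol_cb i (by norm_num), mul_left_comm]
        _ ≤ _ := by gcongr
    convert this using 3
    field_simp
  have hcve : ∀ x, cv K f x = cv K g x + ∑ i ∈ t, cv K (b i) x := by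
    intro x
    simp only [cv]
    rw [← integral_finsetSum _ (fun i hi => cv_integrand_int K (ib i hi) x), ← integral_add (cv_integrand_int K ig x)
      (integrable_finsetSum _ (fun i hi => cv_integrand_int K (ib i hi) x))]
    congr 1; funext y
    rw [hfe y, mul_add, Finset.mul_sum]
  have S3 : volume ({x | h/2 ≤ ‖∑ i ∈ t, cv K (b i) x‖} ∩ Ωᶜ) ≤ ENNReal.ofReal (4 * A / h) * F := by
    have : volume ({x | h/2 ≤ ‖∑ i ∈ t, cv K (b i) x‖} ∩ Ωᶜ) ≤ ENNReal.ofReal ((2 * A) / (h/2)) * F := by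
      apply div_aux (by positivity) (by positivity)
      have h1 := mul_meas_ge_le_lintegral₀ (μ := volume.restrict Ωᶜ) (f := fun x => ‖∑ i ∈ t, cv K (b i) x‖ₑ)
        (by
          refine AEStronglyMeasurable.enorm (AEStronglyMeasurable.restrict ?_)
          exact Finset.aestronglyMeasurable_fun_sum _ fun i hi => cv_meas K (ib i hi).1) (ENNReal.ofReal (h/2))
      have h2 : ∫⁻ x in Ωᶜ, ‖∑ i ∈ t, cv K (b i) x‖ₑ ≤ ENNReal.ofReal (2 * A) * F := by
        calc ∫⁻ x in Ωᶜ, ‖∑ i ∈ t, cv K (b i) x‖ₑ ≤ ∫⁻ x in Ωᶜ, ∑ i ∈ t, ‖cv K (b i) x‖ₑ := 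
              lintegral_mono fun x => enorm_sum_le _ _
          _ = ∑ i ∈ t, ∫⁻ x in Ωᶜ, ‖cv K (b i) x‖ₑ := 
              lintegral_finsetSum' _ fun i hi => ((cv_meas K (ib i hi).1).restrict).enorm
          _ ≤ ∑ i ∈ t, ENNReal.ofReal A * ∫⁻ x, ‖b i x‖ₑ := by
              refine Finset.sum_le_sum fun i hi => ?_
              refine le_trans ?_ (bad_bound K hK (ib i hi) (hbs i hi) (hb0 i hi))
              refine lintegral_mono_set fun x hx => ?_
              simp only [hΩ, Set.mem_compl_iff, Set.mem_iUnion, not_exists, mem_closedBall, dist_eq_norm, not_le] at hx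
              have := hx i hi
              simp only [Set.mem_ofPred_eq]
              linarith
          _ ≤ ENNReal.ofReal A * (2 * F) := by
              rw [← Finset.mul_sum]; gcongr
          _ = _ := by
              rw [← mul_assoc, show (2:ℝ≥0∞) = ENNReal.ofReal 2 by simp, ← ENNReal.ofReal_mul hA0]
              congr 2; ring
      refine le_trans ?_ (h1.trans h2)
      rw [Measure.restrict_apply₀' mΩ.compl.nullMeasurableSet]
      gcongr ENNReal.ofReal (h/2) * volume (?_ ∩ _)
      intro x hx
      simp only [Set.mem_ofPred_eq] at hx ⊢
      rw [← ofReal_norm]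
      exact ENNReal.ofReal_le_ofReal hx
    convert this using 3
    field_simp; ring
  calc volume {x | h < ‖cv K f x‖} 
      ≤ volume ({x | h/2 ≤ ‖cv K g x‖} ∪ (Ω ∪ ({x | h/2 ≤ ‖∑ i ∈ t, cv K (b i) x‖} ∩ Ωᶜ))) := by
        refine measure_mono fun x hx => ?_
        simp only [Set.mem_ofPred_eq] at hx
        by_cases h1 : h/2 ≤ ‖cv K g x‖
        · exact Or.inl h1
        · refine Or.inr ?_
          by_cases h2 : x ∈ Ω
          · exact Or.inl h2
          · refine Or.inr ⟨?_, h2⟩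
            simp only [Set.mem_ofPred_eq]
            rw [hcve x] at hx
            have := norm_add_le (cv K g x) (∑ i ∈ t, cv K (b i) x)
            linarith
    _ ≤ ENNReal.ofReal (8 * A ^ 2 * 5 ^ d / h) * F + (ENNReal.ofReal (2 * 10 ^ d / h) * F + ENNReal.ofReal (4 * A / h) * F) :=
        (measure_union_le _ _).trans (add_le_add S1 ((measure_union_le _ _).trans (add_le_add S2 S3)))
    _ = _ := by
        rw [← add_mul, ← add_mul, ← ENNReal.ofReal_add (by positivity) (by positivity), ← ENNReal.ofReal_add (by positivity) (by positivity)]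
        congr 2; ring

end cz
end KP


namespace KP
set_option linter.unusedVariables false
set_option linter.unusedSectionVars false
set_option linter.style.haveILetI false

section cz
variable {E : Type*} [NormedAddCommGroup E] [InnerProductSpace ℝ E] [FiniteDimensional ℝ E]
  [MeasurableSpace E] [BorelSpace E]

/-- Hypotheses for a Calderón–Zygmund kernel. -/
structure CZ (K : 𝓢(E, ℂ)) (A : ℝ) : Prop where
  even : ∀ x, K (-x) = K x
  four : ∀ ξ, ‖𝓕 K ξ‖ ≤ A
  horm : ∀ y : E, ∫⁻ x in {x | 2 * ‖y‖ < ‖x‖}, ‖K (x - y) - K x‖ₑ ≤ ENNReal.ofReal A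

lemma cv_symm {K : 𝓢(E, ℂ)} (hK : ∀ x, K (-x) = K x) {f g : E → ℂ} (hf : Integrable f) (hg : Integrable g) :
    ∫ x, cv K f x * g x = ∫ x, f x * cv K g x := by
  obtain ⟨M, hM0, hM⟩ := sch_bdd K
  have hintg : Integrable (fun z : E × E => K (z.1 - z.2) * (g z.1 * f z.2)) (volume.prod volume) := by
    refine (hg.mul_prod hf).bdd_mul (c := M) ?_ (Filter.Eventually.of_forall fun z => hM _)
    exact (K.continuous.comp (by fun_prop)).aestronglyMeasurable
  calc ∫ x, cv K f x * g x = ∫ x, ∫ y, K (x - y) * (g x * f y) := by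
        congr 1; funext x
        rw [cv, ← integral_mul_const]
        congr 1; funext y; ring
    _ = ∫ y, ∫ x, K (x - y) * (g x * f y) := integral_integral_swap hintg
    _ = _ := by
        congr 1; funext y
        rw [cv, ← integral_const_mul]
        congr 1; funext x
        rw [← hK (y - x), neg_sub]; ring

lemma cz_lt2 [Nontrivial E] (A : ℝ) (hA0 : 0 ≤ A) {p : ℝ} (hp : 1 < p) (hp2 : p < 2) :
    ∃ C : ℝ≥0∞, C ≠ ∞ ∧ ∀ K : 𝓢(E, ℂ), CZ K A → ∀ f : E → ℂ, Continuous f → HasCompactSupport f →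
      eLpNorm (cv K f) (ENNReal.ofReal p) volume ≤ C * eLpNorm f (ENNReal.ofReal p) volume := by
  set c := 8 * A ^ 2 * 5 ^ (Module.finrank ℝ E) + 2 * 10 ^ (Module.finrank ℝ E) + 4 * A with hc
  have hc0 : 0 ≤ c := by positivity
  refine ⟨(ENNReal.ofReal p * (ENNReal.ofReal (2 * c + 4 * A ^ 2) * ENNReal.ofReal (1 / (p - 1)) + 
    ENNReal.ofReal (4 * A ^ 2) * ENNReal.ofReal (1 / (2 - p)))) ^ (1 / p), ?_, ?_⟩
  · refine ENNReal.rpow_ne_top_of_nonneg (by positivity) ?_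
    exact ENNReal.mul_ne_top (ENNReal.ofReal_ne_top) (ENNReal.add_ne_top.2 ⟨ENNReal.mul_ne_top (ENNReal.ofReal_ne_top) (ENNReal.ofReal_ne_top), ENNReal.mul_ne_top (ENNReal.ofReal_ne_top) (ENNReal.ofReal_ne_top)⟩)
  intro K hK f hf hs
  have hfi : Integrable f := hf.integrable_of_hasCompactSupport hs
  apply eLp_le_of_pow (by linarith)
  refine marcB hp hp2 _ _ hf.norm.measurable (fun x => norm_nonneg _) (cv_cont_int K hfi).norm.measurable
    (fun x => norm_nonneg _) ?_
  intro t ht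
  have hmax : ∀ x, 0 < max t ‖f x‖ := fun x => lt_max_of_lt_left ht
  set f2 : E → ℂ := fun x => ((t / max t ‖f x‖ : ℝ) : ℂ) * f x with hf2
  have hf2c : Continuous f2 := by
    refine Continuous.mul (Complex.continuous_ofReal.comp ?_) hf
    exact continuous_const.div (continuous_const.max hf.norm) fun x => (hmax x).ne'
  have hf2s : HasCompactSupport f2 := hs.mul_left
  set f1 : E → ℂ := f - f2 with hf1
  have hf1c : Continuous f1 := hf.sub hf2c
  have hf1s : HasCompactSupport f1 := hs.sub hf2s
  have hsmall : ∀ x, ‖f x‖ ≤ t → f2 x = f x := by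
    intro x hx
    simp only [hf2, max_eq_left hx, div_self ht.ne']; simp
  have n2 : ∀ x, t < ‖f x‖ → ‖f2 x‖ = t := by
    intro x hx
    simp only [hf2, max_eq_right hx.le]
    rw [norm_mul, Complex.norm_real, Real.norm_of_nonneg (by positivity), div_mul_cancel₀ _ (by linarith)]
  have n1 : ∀ x, t < ‖f x‖ → ‖f1 x‖ ≤ ‖f x‖ := by
    intro x hx
    have : f1 x = ((1 - t / ‖f x‖ : ℝ) : ℂ) * f x := by
      simp only [hf1, hf2, Pi.sub_apply, max_eq_right hx.le]; push_cast; ring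
    have h1 : t / ‖f x‖ ≤ 1 := div_le_one_of_le₀ hx.le (norm_nonneg _)
    have h2 : 0 ≤ t / ‖f x‖ := by positivity
    rw [this, norm_mul, Complex.norm_real, Real.norm_of_nonneg (by linarith)]
    exact mul_le_of_le_one_left (norm_nonneg _) (by linarith)
  set I1 := ∫⁻ x, (if t < ‖f x‖ then ENNReal.ofReal ‖f x‖ else 0) with hI1
  set I2 := ∫⁻ x, (if ‖f x‖ ≤ t then ENNReal.ofReal (‖f x‖ ^ 2) else 0) with hI2
  have b1 : ∫⁻ x, ‖f1 x‖ₑ ≤ I1 := by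
    refine lintegral_mono fun x => ?_
    by_cases hx : t < ‖f x‖
    · simp only [hx, if_true]; rw [← ofReal_norm]; exact ENNReal.ofReal_le_ofReal (n1 x hx)
    · simp [hf1, hsmall x (not_lt.1 hx)]
  have mI1 : Measurable (fun x => (if t < ‖f x‖ then ENNReal.ofReal ‖f x‖ else 0)) :=
    Measurable.ite (measurableSet_lt measurable_const hf.norm.measurable) hf.norm.measurable.ennreal_ofReal measurable_const
  have b2 : ∫⁻ x, ‖f2 x‖ₑ ^ 2 ≤ I2 + ENNReal.ofReal t * I1 := by
    rw [hI1, ← lintegral_const_mul _ mI1, hI2, ← lintegral_add_right _ (mI1.const_mul _)]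
    refine lintegral_mono fun x => ?_
    simp only
    by_cases hx : t < ‖f x‖
    · simp only [hx, if_true, not_le.2 hx, if_false, zero_add]
      rw [← ofReal_norm, n2 x hx, sq]
      gcongr
    · simp only [hx, if_false, not_lt.1 hx, if_true, mul_zero, add_zero]
      rw [hsmall x (not_lt.1 hx), ← ofReal_norm, ENNReal.ofReal_pow (norm_nonneg _)]
  have s1 := weak11 K hA0 hK.four hK.horm hf1c hf1s (half_pos ht)
  have s2 := cheb2 K hA0 hK.four (hf2c.memLp_of_hasCompactSupport hf2s) (half_pos ht)
  have hcve : ∀ x, cv K f x = cv K f1 x + cv K f2 x := by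
    intro x
    rw [← cv_add (cv_integrand_int K (hf1c.integrable_of_hasCompactSupport hf1s) x)
      (cv_integrand_int K (hf2c.integrable_of_hasCompactSupport hf2s) x), hf1, sub_add_cancel]
  calc volume {x | t < ‖cv K f x‖} ≤ volume ({x | t/2 < ‖cv K f1 x‖} ∪ {x | t/2 ≤ ‖cv K f2 x‖}) := by
        refine measure_mono fun x hx => ?_
        simp only [Set.mem_ofPred_eq] at hx
        by_cases h1 : t/2 < ‖cv K f1 x‖
        · exact Or.inl h1
        · refine Or.inr ?_
          simp only [Set.mem_ofPred_eq]
          rw [hcve x] at hx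
          have := norm_add_le (cv K f1 x) (cv K f2 x)
          linarith
    _ ≤ ENNReal.ofReal (c / (t/2)) * I1 + ENNReal.ofReal (A ^ 2 / (t/2) ^ 2) * (I2 + ENNReal.ofReal t * I1) := by
        refine (measure_union_le _ _).trans (add_le_add (s1.trans ?_) (s2.trans ?_))
        · gcongr
        · gcongr
    _ = _ := by
        rw [mul_add, add_comm (_ * I2), ← add_assoc, ← mul_assoc, ← add_mul, ← ENNReal.ofReal_mul (by positivity),
          ← ENNReal.ofReal_add (by positivity) (by positivity), ← ENNReal.ofReal_mul (by positivity), ← ENNReal.ofReal_mul (by positivity)]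
        congr 3
        · congr 1
          field_simp; ring
        · field_simp; ring

lemma holder_enorm {p q : ℝ} (hpq : p.HolderConjugate q) {f g : E → ℂ} (hf : AEStronglyMeasurable f volume)
    (hg : AEStronglyMeasurable g volume) :
    ‖∫ x, f x * g x‖ₑ ≤ eLpNorm f (ENNReal.ofReal p) volume * eLpNorm g (ENNReal.ofReal q) volume := by
  haveI := hpq.ennrealOfReal
  calc ‖∫ x, f x * g x‖ₑ ≤ ∫⁻ x, ‖f x * g x‖ₑ := enorm_integral_le_lintegral_enorm _
    _ = eLpNorm (f • g) 1 volume := by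
        rw [eLpNorm_one_eq_lintegral_enorm]; rfl
    _ ≤ _ := eLpNorm_smul_le_mul_eLpNorm hg hf

lemma cz_Lp [Nontrivial E] (A : ℝ) (hA0 : 0 ≤ A) {p : ℝ} (hp : 1 < p) :
    ∃ C : ℝ≥0∞, C ≠ ∞ ∧ ∀ K : 𝓢(E, ℂ), CZ K A → ∀ f : E → ℂ, Continuous f → HasCompactSupport f →
      eLpNorm (cv K f) (ENNReal.ofReal p) volume ≤ C * eLpNorm f (ENNReal.ofReal p) volume := by
  rcases lt_trichotomy p 2 with h | h | h
  · exact cz_lt2 A hA0 hp h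
  · refine ⟨ENNReal.ofReal A, ENNReal.ofReal_ne_top, fun K hK f hf hs => ?_⟩
    subst h
    have := cv_l2 K hK.four (hf.memLp_of_hasCompactSupport (p := 2) (μ := volume) hs)
    simpa using this
  · have hpq := Real.HolderConjugate.conjExponent hp
    set q := p.conjExponent with hq
    have hq2 : q < 2 := by
      rw [hq, Real.conjExponent, div_lt_iff₀ (by linarith)]; linarith
    obtain ⟨C, hC, hb⟩ := cz_lt2 (E := E) A hA0 hpq.symm.lt hq2
    refine ⟨C, hC, fun K hK f hf hs => ?_⟩
    have hfi : Integrable f := hf.integrable_of_hasCompactSupport hs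
    refine dual_bound hpq (cv_cont_int K hfi) _ fun g hg hgs => ?_
    have hgi : Integrable g := hg.integrable_of_hasCompactSupport hgs
    rw [cv_symm hK.even hfi hgi]
    refine (holder_enorm hpq hf.aestronglyMeasurable (cv_cont_int K hgi).aestronglyMeasurable).trans ?_
    calc _ ≤ eLpNorm f (ENNReal.ofReal p) volume * (C * eLpNorm g (ENNReal.ofReal q) volume) := by
          gcongr; exact hb K hK g hg hgs
      _ = _ := by ring

end cz
end KP


namespace KP
set_option linter.unusedVariables false
set_option linter.unusedSectionVars false
set_option linter.style.haveILetI false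

section hl
variable {E : Type*} [NormedAddCommGroup E] [InnerProductSpace ℝ E] [FiniteDimensional ℝ E]
  [MeasurableSpace E] [BorelSpace E]

open Metric in
lemma hl_weak [Nontrivial E] (f : E → ℝ≥0∞) (hf : ∫⁻ x, f x ≠ ∞) {t : ℝ} (ht : 0 < t) :
    volume {x : E | ∃ r : ℝ, 0 < r ∧ ENNReal.ofReal t * volume (closedBall x r) < ∫⁻ y in closedBall x r, f y} ≤
      ENNReal.ofReal (5 ^ Module.finrank ℝ E) * ENNReal.ofReal (t⁻¹) * ∫⁻ x, f x := by
  set S := {x : E | ∃ r : ℝ, 0 < r ∧ ENNReal.ofReal t * volume (closedBall x r) < ∫⁻ y in closedBall x r, f y} with hS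
  have hch : ∀ x : E, ∃ r : ℝ, x ∈ S → 0 < r ∧ ENNReal.ofReal t * volume (closedBall x r) < ∫⁻ y in closedBall x r, f y := by
    intro x
    by_cases hx : x ∈ S
    · obtain ⟨r, hr⟩ := hx
      exact ⟨r, fun _ => hr⟩
    · exact ⟨0, fun h => absurd h hx⟩
  choose r hr using hch
  have hd : 1 ≤ Module.finrank ℝ E := Module.finrank_pos
  obtain ⟨R, hR⟩ : ∃ R : ℝ, ∀ x ∈ S, r x ≤ R := by
    set V := volume (closedBall (0:E) 1) with hV
    have hV0 : V ≠ 0 := (measure_closedBall_pos volume _ one_pos).ne'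
    have hVt : V ≠ ∞ := measure_closedBall_lt_top.ne
    set Q := (∫⁻ x, f x) / (ENNReal.ofReal t * V) with hQ
    have hT : ENNReal.ofReal t * V ≠ 0 := by simp [hV0, ht]
    have hT' : ENNReal.ofReal t * V ≠ ∞ := ENNReal.mul_ne_top ENNReal.ofReal_ne_top hVt
    have hQt : Q ≠ ∞ := (ENNReal.div_lt_top hf hT).ne
    refine ⟨max 1 Q.toReal, fun x hx => ?_⟩
    obtain ⟨h1, h2⟩ := hr x hx
    by_contra hcon
    push Not at hcon
    obtain ⟨h3, h4⟩ := max_lt_iff.1 hcon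
    have h5 : volume (closedBall x (r x)) = ENNReal.ofReal (r x ^ Module.finrank ℝ E) * V := by
      have := vol_cb x h1 1
      rwa [mul_one, Measure.addHaar_closedBall_center volume x 1] at this
    have h6 : ∫⁻ y in closedBall x (r x), f y ≤ ∫⁻ y, f y := setLIntegral_le_lintegral _ _
    have h7 : ENNReal.ofReal (r x) * (ENNReal.ofReal t * V) ≤ ∫⁻ y, f y := by
      refine le_trans ?_ (h2.le.trans h6)
      rw [h5, mul_left_comm]
      gcongr
      exact le_self_pow₀ h3.le (by lia)
    have h8 : ENNReal.ofReal (r x) ≤ Q := (ENNReal.le_div_iff_mul_le (Or.inl hT) (Or.inl hT')).2 h7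
    have h9 := (ENNReal.ofReal_le_iff_le_toReal hQt).1 h8
    linarith
  obtain ⟨u, hu, hdis, hcov⟩ := Vitali.exists_disjoint_subfamily_covering_enlargement_closedBall S id r R hR 5 (by norm_num)
  simp only [id] at hdis hcov
  have hcount : u.Countable := by
    refine hdis.countable_of_nonempty_interior fun i hi => ?_
    refine ⟨i, ?_⟩
    exact ball_subset_interior_closedBall (mem_ball_self (hr i (hu hi)).1)
  calc volume S ≤ volume (⋃ i ∈ u, closedBall i (5 * r i)) := by
        refine measure_mono fun x hx => ?_
        obtain ⟨b, hb, hb2⟩ := hcov x hx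
        exact Set.mem_biUnion hb (hb2 (mem_closedBall_self (hr x hx).1.le))
    _ ≤ ∑' i : u, volume (closedBall (i:E) (5 * r i)) := measure_biUnion_le volume hcount _
    _ ≤ ∑' i : u, ENNReal.ofReal (5 ^ Module.finrank ℝ E) * ENNReal.ofReal (t⁻¹) * ∫⁻ y in closedBall (i:E) (r i), f y := by
        refine ENNReal.tsum_le_tsum fun i => ?_
        rw [vol_cb _ (by norm_num), mul_assoc]
        gcongr
        have := (hr i (hu i.2)).2.le
        rw [ENNReal.ofReal_inv_of_pos ht, mul_comm, ← div_eq_mul_inv, ENNReal.le_div_iff_mul_le]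
        · rwa [mul_comm]
        · left; simpa using ht
        · left; simp
    _ = ENNReal.ofReal (5 ^ Module.finrank ℝ E) * ENNReal.ofReal (t⁻¹) * ∫⁻ y in ⋃ i ∈ u, closedBall (i:E) (r i), f y := by
        rw [ENNReal.tsum_mul_left, lintegral_biUnion hcount (fun i _ => isClosed_closedBall.measurableSet) hdis]
    _ ≤ _ := by gcongr; exact Measure.restrict_le_self

/-- dilated symbol `a (t⁻¹ ξ)` -/
noncomputable def dil (a : 𝓢(E, ℂ)) (t : ℝ) (ht : 0 < t) : 𝓢(E, ℂ) :=
  SchwartzMap.compCLMOfContinuousLinearEquiv ℂ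
    (ContinuousLinearEquiv.smulLeft (Units.mk0 (t⁻¹) (inv_ne_zero ht.ne')) : E ≃L[ℝ] E) a

lemma dil_apply (a : 𝓢(E, ℂ)) (t : ℝ) (ht : 0 < t) (ξ : E) : dil a t ht ξ = a (t⁻¹ • ξ) := by
  simp [dil]

/-- kernel with symbol `a (t⁻¹ ξ)` -/
noncomputable def ker (a : 𝓢(E, ℂ)) (t : ℝ) (ht : 0 < t) : 𝓢(E, ℂ) := 𝓕⁻ (dil a t ht)

lemma ker_fourier (a : 𝓢(E, ℂ)) (t : ℝ) (ht : 0 < t) (ξ : E) : 𝓕 (ker a t ht : E → ℂ) ξ = a (t⁻¹ • ξ) := by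
  rw [← SchwartzMap.fourier_coe, ker, FourierTransform.fourier_fourierInv_eq, dil_apply]

lemma ker_apply (a : 𝓢(E, ℂ)) (t : ℝ) (ht : 0 < t) (x : E) :
    ker a t ht x = ((t ^ Module.finrank ℝ E : ℝ) : ℂ) * (𝓕⁻ a : 𝓢(E, ℂ)) (t • x) := by
  rw [ker, SchwartzMap.fourierInv_coe, SchwartzMap.fourierInv_coe, Real.fourierInv_eq, Real.fourierInv_eq]
  have := Measure.integral_comp_smul (volume : Measure E) (fun v => 𝐞 ⟪v, t • x⟫ • a v) t⁻¹
  simp only [dil_apply]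
  have h2 : (fun v => 𝐞 ⟪v, x⟫ • a (t⁻¹ • v)) = fun v => 𝐞 ⟪t⁻¹ • v, t • x⟫ • a (t⁻¹ • v) := by
    funext v
    rw [inner_smul_left, inner_smul_right]
    congr 2
    simp
    field_simp
  rw [h2, this]
  simp [abs_of_pos ht]

lemma sch_decay (K : 𝓢(E, ℂ)) (n : ℕ) : ∃ B : ℝ, 0 < B ∧ ∀ x, ‖K x‖ * (1 + ‖x‖) ^ n ≤ B := by
  have h := SchwartzMap.one_add_le_sup_seminorm_apply (𝕜 := ℝ) (m := (n, 0)) (le_refl n) (le_refl 0) K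
  refine ⟨max 1 _, lt_of_lt_of_le one_pos (le_max_left _ _), fun x => le_trans ?_ ((h x).trans (le_max_right _ _))⟩
  rw [norm_iteratedFDeriv_zero, mul_comm]

lemma dyadic_dom (n : ℕ) {s : ℝ} (hs : 0 ≤ s) :
    ENNReal.ofReal (((1 + s) ^ n)⁻¹) ≤ ∑' j : ℕ, ENNReal.ofReal (2 ^ n * ((2:ℝ) ^ (j * n))⁻¹) * (if s ≤ 2 ^ j then 1 else 0) := by
  classical
  have hex : ∃ j : ℕ, s ≤ 2 ^ j := by
    obtain ⟨j, hj⟩ := pow_unbounded_of_one_lt s (one_lt_two)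
    exact ⟨j, hj.le⟩
  refine le_trans ?_ (ENNReal.le_tsum (Nat.find hex))
  rw [if_pos (Nat.find_spec hex), mul_one]
  apply ENNReal.ofReal_le_ofReal
  rw [pow_mul, ← inv_pow, ← inv_pow, ← mul_pow]
  apply pow_le_pow_left₀ (by positivity)
  rw [inv_eq_one_div, div_le_iff₀ (by positivity), mul_assoc, ← div_eq_inv_mul, mul_div_assoc', le_div_iff₀ (by positivity), one_mul]
  rcases Nat.eq_zero_or_pos (Nat.find hex) with h0 | h0
  · rw [h0]; simp; linarith
  · have := Nat.find_min hex (m := Nat.find hex - 1) (by lia)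
    push Not at this
    have h2 : (2:ℝ) ^ (Nat.find hex) = 2 ^ (Nat.find hex - 1) * 2 := by
      rw [← pow_succ]; congr 1; lia
    rw [h2]; linarith

open Metric in
lemma max_point [Nontrivial E] (a : 𝓢(E, ℂ)) : ∃ C : ℝ, 0 < C ∧ ∀ (t : ℝ) (ht : 0 < t) (f : E → ℂ) (hf : Continuous f) (x : E) (s : ℝ), 0 ≤ s → 
    (∀ r : ℝ, 0 < r → ∫⁻ y in closedBall x r, ‖f y‖ₑ ≤ ENNReal.ofReal s * volume (closedBall x r)) →
    ‖cv (ker a t ht) f x‖ ≤ C * s := by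
  set n := Module.finrank ℝ E with hn
  obtain ⟨B, hB, hK⟩ := sch_decay (𝓕⁻ a : 𝓢(E, ℂ)) (n + 1)
  set V := volume (closedBall (0:E) 1) with hV
  have hVt : V ≠ ∞ := measure_closedBall_lt_top.ne
  have hV0 : 0 < V := measure_closedBall_pos volume _ one_pos
  have hV1 : 0 < V.toReal := ENNReal.toReal_pos hV0.ne' hVt
  refine ⟨B * 2 ^ (n + 1) * 2 * V.toReal, by positivity, fun t ht f hf x s hs h => ?_⟩
  have key : ∀ y, ‖ker a t ht (x - y) * f y‖ₑ ≤ ∑' j : ℕ, ENNReal.ofReal (t ^ n * B * (2 ^ (n+1) * ((2:ℝ) ^ (j * (n+1)))⁻¹)) *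
      (closedBall x (2 ^ j / t)).indicator (fun y => ‖f y‖ₑ) y := by
    intro y
    have h1 : ‖ker a t ht (x - y)‖ₑ ≤ ENNReal.ofReal (t ^ n * B) * ENNReal.ofReal (((1 + t * ‖x - y‖) ^ (n+1))⁻¹) := by
      rw [← ENNReal.ofReal_mul (by positivity), ← ofReal_norm]
      apply ENNReal.ofReal_le_ofReal
      rw [ker_apply, norm_mul, Complex.norm_real, Real.norm_of_nonneg (by positivity), mul_assoc]
      gcongr
      have := hK (t • (x - y))
      rw [norm_smul, Real.norm_of_nonneg ht.le] at this
      rw [← div_eq_mul_inv, le_div_iff₀ (by positivity)]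
      exact this
    rw [enorm_mul]
    calc _ ≤ ENNReal.ofReal (t ^ n * B) * (∑' j : ℕ, ENNReal.ofReal (2 ^ (n+1) * ((2:ℝ) ^ (j * (n+1)))⁻¹) * (if t * ‖x - y‖ ≤ 2 ^ j then 1 else 0)) * ‖f y‖ₑ := by
          gcongr
          exact h1.trans (by gcongr; exact dyadic_dom _ (by positivity))
      _ = _ := by
          rw [← ENNReal.tsum_mul_left, ← ENNReal.tsum_mul_right]
          congr 1; funext j
          rw [ENNReal.ofReal_mul (p := t ^ n * B) (by positivity)]
          by_cases hj : t * ‖x - y‖ ≤ 2 ^ j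
          · rw [if_pos hj, Set.indicator_of_mem, mul_one]
            rw [mem_closedBall, dist_comm, dist_eq_norm, le_div_iff₀ ht]; linarith
          · rw [if_neg hj, Set.indicator_of_notMem]
            · simp
            rw [mem_closedBall, dist_comm, dist_eq_norm, le_div_iff₀ ht]
            rwa [mul_comm]
  have h2 : ‖cv (ker a t ht) f x‖ₑ ≤ ENNReal.ofReal (B * 2 ^ (n + 1) * 2 * V.toReal * s) := by
    calc ‖cv (ker a t ht) f x‖ₑ ≤ ∫⁻ y, ‖ker a t ht (x - y) * f y‖ₑ := enorm_integral_le_lintegral_enorm _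
      _ ≤ ∫⁻ y, ∑' j : ℕ, ENNReal.ofReal (t ^ n * B * (2 ^ (n+1) * ((2:ℝ) ^ (j * (n+1)))⁻¹)) *
      (closedBall x (2 ^ j / t)).indicator (fun y => ‖f y‖ₑ) y := lintegral_mono key
      _ = ∑' j : ℕ, ENNReal.ofReal (t ^ n * B * (2 ^ (n+1) * ((2:ℝ) ^ (j * (n+1)))⁻¹)) * ∫⁻ y in closedBall x (2 ^ j / t), ‖f y‖ₑ := by
          rw [lintegral_tsum]
          · congr 1; funext j
            rw [lintegral_const_mul, lintegral_indicator isClosed_closedBall.measurableSet]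
            exact hf.enorm.measurable.indicator isClosed_closedBall.measurableSet
          · intro j
            exact ((hf.enorm.measurable.indicator isClosed_closedBall.measurableSet).const_mul _).aemeasurable
      _ ≤ ∑' j : ℕ, ENNReal.ofReal (B * 2 ^ (n + 1) * V.toReal * s) * (2⁻¹) ^ j := by
          refine ENNReal.tsum_le_tsum fun j => ?_
          refine (mul_le_mul_right (h _ (by positivity)) _).trans (le_of_eq ?_)
          have := vol_cb x (c := 2 ^ j / t) (by positivity) 1
          rw [mul_one, Measure.addHaar_closedBall_center volume x 1, ← hV, ← ENNReal.ofReal_toReal hVt] at this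
          rw [this, ← ENNReal.ofReal_mul (by positivity), ← ENNReal.ofReal_mul (by positivity), ← ENNReal.ofReal_mul (by positivity)]
          have h3 : ((2:ℝ≥0∞)⁻¹) ^ j = ENNReal.ofReal ((2⁻¹) ^ j) := by
            rw [ENNReal.ofReal_pow (by positivity), ENNReal.ofReal_inv_of_pos (by norm_num)]; simp
          rw [h3, ← ENNReal.ofReal_mul (by positivity), ← hn]
          congr 1
          rw [div_pow, pow_mul, inv_pow, pow_succ ((2:ℝ)^j) n]
          field_simp
      _ = _ := by
          rw [ENNReal.tsum_mul_left, ENNReal.tsum_geometric, ENNReal.one_sub_inv_two, inv_inv]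
          have h4 : (2:ℝ≥0∞) = ENNReal.ofReal 2 := by simp
          rw [h4, ← ENNReal.ofReal_mul (by positivity)]
          congr 1; ring
  rw [← ofReal_norm] at h2
  exact (ENNReal.ofReal_le_ofReal_iff (by positivity)).1 h2
end hl
end KP


namespace KP
set_option linter.unusedVariables false
set_option linter.unusedSectionVars false
set_option linter.style.haveILetI false

section hl2
variable {E : Type*} [NormedAddCommGroup E] [InnerProductSpace ℝ E] [FiniteDimensional ℝ E]
  [MeasurableSpace E] [BorelSpace E]

lemma tz (k : ℤ) : (0:ℝ) < 2 ^ k := by positivity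

/-- kernel with symbol `a (2^{-k} ξ)` -/
noncomputable def kz (a : 𝓢(E, ℂ)) (k : ℤ) : 𝓢(E, ℂ) := ker a (2 ^ k) (tz k)

/-- finite dyadic maximal function -/
noncomputable def mx (a : 𝓢(E, ℂ)) (I : Finset ℤ) (u : E → ℂ) (x : E) : ℝ :=
  ((I.sup fun k => ‖cv (kz a k) u x‖₊ : NNReal) : ℝ)

lemma mx_nonneg (a : 𝓢(E, ℂ)) (I : Finset ℤ) (u : E → ℂ) (x : E) : 0 ≤ mx a I u x := NNReal.coe_nonneg _

lemma le_mx (a : 𝓢(E, ℂ)) {I : Finset ℤ} (u : E → ℂ) (x : E) {k : ℤ} (hk : k ∈ I) :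
    ‖cv (kz a k) u x‖ ≤ mx a I u x := by
  rw [mx, ← coe_nnnorm, NNReal.coe_le_coe]
  exact Finset.le_sup (f := fun k => ‖cv (kz a k) u x‖₊) hk

lemma mx_le (a : 𝓢(E, ℂ)) {I : Finset ℤ} (u : E → ℂ) (x : E) {c : ℝ} (hc : 0 ≤ c)
    (h : ∀ k ∈ I, ‖cv (kz a k) u x‖ ≤ c) : mx a I u x ≤ c := by
  lift c to NNReal using hc
  rw [mx, NNReal.coe_le_coe]
  exact Finset.sup_le fun k hk => by
    rw [← NNReal.coe_le_coe, coe_nnnorm]; exact h k hk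

lemma mx_cont (a : 𝓢(E, ℂ)) (I : Finset ℤ) (u : 𝓢(E, ℂ)) : Continuous (mx a I u) := by
  refine NNReal.continuous_coe.comp ?_
  refine Continuous.finset_sup_apply fun k _ => ?_
  exact (cv_cont_int _ u.integrable).nnnorm

open Metric in
lemma mx_Lp [Nontrivial E] (a : 𝓢(E, ℂ)) {q : ℝ≥0∞} (hq : 1 < q) : ∃ C : ℝ≥0∞, C ≠ ∞ ∧ ∀ (I : Finset ℤ) (u : 𝓢(E, ℂ)),
    eLpNorm (mx a I u) q volume ≤ C * eLpNorm u q volume := by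
  obtain ⟨C, hC, h⟩ := max_point a
  have hp : ∀ (I : Finset ℤ) (u : 𝓢(E, ℂ)) (x : E) (s : ℝ), 0 ≤ s →  (∀ r : ℝ, 0 < r → ∫⁻ y in closedBall x r, ‖u y‖ₑ ≤ ENNReal.ofReal s * volume (closedBall x r)) → mx a I u x ≤ C * s := by
    intro I u x s hs hr
    exact mx_le a u x (by positivity) fun k _ => h _ _ u u.continuous x s hs hr
  by_cases hqt : q = ∞
  · subst hqt
    refine ⟨ENNReal.ofReal C, ENNReal.ofReal_ne_top, fun I u => ?_⟩
    have hN : eLpNorm u ∞ volume ≠ ∞ := (SchwartzMap.eLpNorm_lt_top u ∞ volume).ne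
    conv_rhs => rw [← ENNReal.ofReal_toReal hN]
    rw [← ENNReal.ofReal_mul hC.le, eLpNorm_exponent_top]
    refine eLpNormEssSup_le_of_ae_bound (Filter.Eventually.of_forall fun x => ?_)
    rw [Real.norm_of_nonneg (mx_nonneg _ _ _ _)]
    refine hp I u x _ ENNReal.toReal_nonneg fun r hr => ?_
    rw [ENNReal.ofReal_toReal hN, ← setLIntegral_const]
    refine lintegral_mono_ae (ae_restrict_of_ae ?_)
    rw [eLpNorm_exponent_top]
    exact enorm_ae_le_eLpNormEssSup _ _
  · lift q to NNReal using hqt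
    have hq1 : (1:ℝ) < q := by exact_mod_cast hq
    have hqe : (q : ℝ≥0∞) = ENNReal.ofReal (q:ℝ) := by simp
    rw [hqe]
    set Q : ℝ≥0∞ := ENNReal.ofReal (q:ℝ) * (ENNReal.ofReal (5 ^ Module.finrank ℝ E) * ENNReal.ofReal (1 / ((q:ℝ) - 1)))
    refine ⟨ENNReal.ofReal (2 * C) * Q ^ (1 / (q:ℝ)), ENNReal.mul_ne_top ENNReal.ofReal_ne_top (ENNReal.rpow_ne_top_of_nonneg (by positivity) ?_), fun I u => ?_⟩
    · exact ENNReal.mul_ne_top ENNReal.ofReal_ne_top (ENNReal.mul_ne_top ENNReal.ofReal_ne_top ENNReal.ofReal_ne_top)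
    have hG : mx a I u = (2 * C) • fun x => (mx a I u x / (2 * C)) := by
      funext x; simp; field_simp
    rw [hG, eLpNorm_const_smul, mul_assoc]
    have : ‖2 * C‖ₑ = ENNReal.ofReal (2 * C) := Real.enorm_of_nonneg (by positivity)
    rw [this]
    gcongr
    apply eLp_le_of_pow (by linarith)
    simp only [Real.norm_of_nonneg (div_nonneg (mx_nonneg a I u _) (by positivity : 0 ≤ 2 * C))]
    refine marcA hq1 _ u.continuous.norm.measurable (fun x => norm_nonneg _) 
      ((mx_cont a I u).div_const _).measurable (fun x => div_nonneg (mx_nonneg a I u _) (by positivity)) ?_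
    intro t ht
    set f : E → ℝ≥0∞ := fun x => if t < ‖u x‖ then ENNReal.ofReal ‖u x‖ else 0 with hf
    have hfm : Measurable f := Measurable.ite (measurableSet_lt measurable_const u.continuous.norm.measurable) 
      u.continuous.norm.measurable.ennreal_ofReal measurable_const
    have hle : ∀ x, f x ≤ ‖u x‖ₑ := by
      intro x; simp only [hf]; rw [← ofReal_norm]; split_ifs <;> simp
    have hle2 : ∀ x, ‖u x‖ₑ ≤ f x + ENNReal.ofReal t := by
      intro x; simp only [hf]; rw [← ofReal_norm]; split_ifs with hh
      · simp
      · rw [zero_add]; exact ENNReal.ofReal_le_ofReal (not_lt.1 hh)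
    have hfi : ∫⁻ x, f x ≠ ∞ := ((lintegral_mono hle).trans_lt (u.integrable (μ := volume)).2).ne
    refine (measure_mono ?_).trans (hl_weak f hfi ht)
    intro x hx
    by_contra hcon
    simp only [Set.mem_ofPred_eq, not_exists, not_and, not_lt] at hcon hx
    have := hp I u x (2 * t) (by positivity) fun r hr => by
      calc ∫⁻ y in closedBall x r, ‖u y‖ₑ ≤ ∫⁻ y in closedBall x r, (f y + ENNReal.ofReal t) := lintegral_mono hle2
        _ = (∫⁻ y in closedBall x r, f y) + ENNReal.ofReal t * volume (closedBall x r) := by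
            rw [lintegral_add_left hfm, setLIntegral_const]
        _ ≤ _ := by
            rw [two_mul, ENNReal.ofReal_add ht.le ht.le, add_mul]
            gcongr
            exact hcon r hr
    rw [lt_div_iff₀ (by positivity)] at hx
    linarith
end hl2
end KP


namespace KP
set_option linter.unusedVariables false
set_option linter.unusedSectionVars false
set_option linter.style.haveILetI false

lemma zgeo {ρ : ℝ} (h0 : 0 ≤ ρ) (h1 : ρ < 1) : ∃ C : ℝ, 0 < C ∧ ∀ (I : Finset ℤ) (m : ℤ),
    ∑ k ∈ I, ρ ^ (k + m).natAbs ≤ C := by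
  have hs : Summable (fun k : ℤ => ρ ^ k.natAbs) := by
    rw [summable_int_iff_summable_nat_and_neg]
    constructor <;> simpa using summable_geometric_of_lt_one h0 h1
  refine ⟨1 + ∑' k : ℤ, ρ ^ k.natAbs, add_pos_of_pos_of_nonneg one_pos (tsum_nonneg fun _ => by positivity), fun I m => ?_⟩
  have h2 : ∑ k ∈ I, ρ ^ (k + m).natAbs = ∑ k ∈ I.map (Equiv.addRight m).toEmbedding, ρ ^ k.natAbs := by
    rw [Finset.sum_map]; simp
  rw [h2]
  have := hs.sum_le_tsum (I.map (Equiv.addRight m).toEmbedding) (fun _ _ => by positivity)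
  linarith

lemma zmin : ∃ C : ℝ, 0 < C ∧ ∀ (I : Finset ℤ) (s : ℝ), 0 < s →
    ∑ k ∈ I, min ((2:ℝ) ^ k * s) ((2:ℝ) ^ k * s)⁻¹ ≤ C := by
  obtain ⟨C, hC, h⟩ := zgeo (ρ := 1/2) (by norm_num) (by norm_num)
  refine ⟨2 * C, by positivity, fun I s hs => ?_⟩
  obtain ⟨m, hm1, hm2⟩ := exists_mem_Ico_zpow hs (one_lt_two)
  refine le_trans ?_ (mul_le_mul_of_nonneg_left (h I m) (by norm_num))
  rw [Finset.mul_sum]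
  refine Finset.sum_le_sum fun k _ => ?_
  have hk := tz k
  have e1 : (2:ℝ) ^ (k + m) ≤ 2 ^ k * s := by
    rw [zpow_add₀ two_ne_zero]; gcongr
  have e2 : 2 ^ k * s ≤ 2 * (2:ℝ) ^ (k + m) := by
    have : 2 * (2:ℝ) ^ (k + m) = 2 ^ k * 2 ^ (m + 1) := by
      rw [zpow_add₀ two_ne_zero, zpow_add₀ two_ne_zero]; simp; ring
    rw [this]; gcongr
  rcases le_total 0 (k + m) with hkm | hkm
  · refine (min_le_right _ _).trans ?_
    obtain ⟨j, hj⟩ := Int.eq_ofNat_of_zero_le hkm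
    rw [hj] at e1 ⊢
    simp only [zpow_natCast, Int.natAbs_natCast] at e1 ⊢
    have : (2 ^ k * s)⁻¹ ≤ ((2:ℝ) ^ j)⁻¹ := by gcongr
    have h3 : 0 < ((2:ℝ) ^ j)⁻¹ := by positivity
    rw [one_div, inv_pow]; linarith
  · refine (min_le_left _ _).trans (e2.trans ?_)
    gcongr
    obtain ⟨j, hj⟩ := Int.eq_ofNat_of_zero_le (neg_nonneg.2 hkm)
    have : k + m = - (j:ℤ) := by linarith
    rw [this]; simp

section sq
variable {E : Type*} [NormedAddCommGroup E] [InnerProductSpace ℝ E] [FiniteDimensional ℝ E]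
  [MeasurableSpace E] [BorelSpace E]

lemma sch_decay_lint [Nontrivial E] : ∃ C : ℝ, 0 < C ∧
    ∫⁻ x : E, ENNReal.ofReal (((1 + ‖x‖) ^ (Module.finrank ℝ E + 1))⁻¹) ≤ ENNReal.ofReal C := by
  have := integrable_one_add_norm (E := E) (μ := volume) (r := Module.finrank ℝ E + 1) (by linarith)
  have h2 : ∫⁻ x : E, ENNReal.ofReal (((1 + ‖x‖) ^ (Module.finrank ℝ E + 1))⁻¹) ≠ ∞ := by
    refine (lt_of_le_of_lt (lintegral_mono fun x => ?_) this.2).ne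
    rw [← ofReal_norm, Real.norm_of_nonneg (by positivity)]
    beta_reduce
    rw [Real.rpow_neg (by positivity)]
    apply le_of_eq
    congr 2
    rw [← Real.rpow_natCast]; push_cast; rfl
  refine ⟨_, add_pos_of_pos_of_nonneg one_pos (ENNReal.toReal_nonneg (a := ∫⁻ x : E, ENNReal.ofReal (((1 + ‖x‖) ^ (Module.finrank ℝ E + 1))⁻¹))), ?_⟩
  rw [ENNReal.le_ofReal_iff_toReal_le h2 (by positivity)]
  linarith

lemma sch_lip (κ : 𝓢(E, ℂ)) (n : ℕ) : ∃ B : ℝ, 0 < B ∧ ∀ z w : E, ‖w‖ ≤ 1 →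
    ‖κ (z - w) - κ z‖ ≤ B * ‖w‖ * ((1 + ‖z‖) ^ n)⁻¹ := by
  have h := SchwartzMap.one_add_le_sup_seminorm_apply (𝕜 := ℝ) (m := (n, 1)) (le_refl n) (le_refl 1) κ
  set B := 2 ^ (n, 1).1 * ((Finset.Iic (n, 1)).sup fun m => SchwartzMap.seminorm ℝ m.1 m.2) κ
  refine ⟨max 1 B * 2 ^ n, by positivity, fun z w hw => ?_⟩
  have hd : ∀ x ∈ Metric.closedBall z ‖w‖, ‖fderiv ℝ κ x‖ ≤ max 1 B * 2 ^ n * ((1 + ‖z‖) ^ n)⁻¹ := by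
    intro x hx
    have h1 := h x
    rw [norm_iteratedFDeriv_one] at h1
    have h2 : 1 + ‖z‖ ≤ 2 * (1 + ‖x‖) := by
      rw [mem_closedBall_iff_norm, norm_sub_rev] at hx
      have : ‖z‖ ≤ ‖z - x‖ + ‖x‖ := by simpa using norm_add_le (z - x) x
      have := norm_nonneg x
      linarith
    have h3 : (1 + ‖z‖) ^ n ≤ 2 ^ n * (1 + ‖x‖) ^ n := by rw [← mul_pow]; gcongr
    rw [← div_eq_mul_inv, le_div_iff₀ (by positivity)]
    calc ‖fderiv ℝ κ x‖ * (1 + ‖z‖) ^ n ≤ ‖fderiv ℝ κ x‖ * (2 ^ n * (1 + ‖x‖) ^ n) := by gcongr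
      _ = ((1 + ‖x‖) ^ n * ‖fderiv ℝ κ x‖) * 2 ^ n := by ring
      _ ≤ _ := by
        gcongr
        exact h1.trans (le_max_right _ _)
  have := (convex_closedBall z ‖w‖).norm_image_sub_le_of_norm_fderiv_le (𝕜 := ℝ) (f := κ)
    (fun x _ => κ.differentiable x) hd (x := z) (y := z - w) (Metric.mem_closedBall_self (norm_nonneg _)) (by simp)
  refine this.trans (le_of_eq ?_)
  rw [sub_sub_cancel_left, norm_neg]; ring

lemma hk_base [Nontrivial E] (κ : 𝓢(E, ℂ)) : ∃ C : ℝ, 0 < C ∧ ∀ w : E, w ≠ 0 →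
    ∫⁻ z in {z | 2 * ‖w‖ < ‖z‖}, ‖κ (z - w) - κ z‖ₑ ≤ ENNReal.ofReal (C * min ‖w‖ ‖w‖⁻¹) := by
  set n := Module.finrank ℝ E with hn
  obtain ⟨B, hB, h1⟩ := sch_lip κ (n + 1)
  obtain ⟨C, hC, h2⟩ := sch_decay_lint (E := E)
  rw [← hn] at h2
  set M := ∫ z, ‖z‖ ^ 1 * ‖κ z‖ with hM
  have hMi : Integrable (fun z => ‖z‖ ^ 1 * ‖κ z‖) := SchwartzMap.integrable_pow_mul volume κ 1
  have hM0 : 0 ≤ M := integral_nonneg fun z => by positivity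
  refine ⟨B * C + 2 * M, by positivity, fun w hw => ?_⟩
  have hw0 : 0 < ‖w‖ := norm_pos_iff.2 hw
  rcases le_total ‖w‖ 1 with hw1 | hw1
  · rw [min_eq_left (hw1.trans (by rw [one_le_inv₀ hw0]; exact hw1))]
    calc ∫⁻ z in {z | 2 * ‖w‖ < ‖z‖}, ‖κ (z - w) - κ z‖ₑ ≤ ∫⁻ z, ‖κ (z - w) - κ z‖ₑ := setLIntegral_le_lintegral _ _
      _ ≤ ∫⁻ z : E, ENNReal.ofReal (B * ‖w‖) * ENNReal.ofReal (((1 + ‖z‖) ^ (n + 1))⁻¹) := by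
          refine lintegral_mono fun z => ?_
          rw [← ofReal_norm, ← ENNReal.ofReal_mul (by positivity)]
          exact ENNReal.ofReal_le_ofReal (h1 z w hw1)
      _ ≤ ENNReal.ofReal (B * ‖w‖) * ENNReal.ofReal C := by
          rw [lintegral_const_mul' _ _ ENNReal.ofReal_ne_top]; gcongr
      _ ≤ _ := by
          rw [← ENNReal.ofReal_mul (by positivity)]
          apply ENNReal.ofReal_le_ofReal
          have : 0 ≤ 2 * M * ‖w‖ := by positivity
          nlinarith
  · rw [min_eq_right ((inv_le_one_of_one_le₀ hw1).trans hw1)]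
    have hS : MeasurableSet {z : E | ‖w‖ < ‖z‖} := measurableSet_lt measurable_const measurable_norm
    have h3 : ∫⁻ z in {z | ‖w‖ < ‖z‖}, ‖κ z‖ₑ ≤ ENNReal.ofReal (M * ‖w‖⁻¹) := by
      calc ∫⁻ z in {z | ‖w‖ < ‖z‖}, ‖κ z‖ₑ ≤ ∫⁻ z in {z | ‖w‖ < ‖z‖}, ENNReal.ofReal (‖z‖ ^ 1 * ‖κ z‖) * ENNReal.ofReal ‖w‖⁻¹ := by
            refine setLIntegral_mono' hS fun z hz => ?_
            rw [← ENNReal.ofReal_mul (by positivity), ← ofReal_norm]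
            apply ENNReal.ofReal_le_ofReal
            rw [← div_eq_mul_inv, le_div_iff₀ hw0, pow_one, mul_comm]
            gcongr
            exact (show ‖w‖ < ‖z‖ from hz).le
        _ ≤ ∫⁻ z, ENNReal.ofReal (‖z‖ ^ 1 * ‖κ z‖) * ENNReal.ofReal ‖w‖⁻¹ := setLIntegral_le_lintegral _ _
        _ = _ := by
            rw [lintegral_mul_const' _ _ ENNReal.ofReal_ne_top, ← ofReal_integral_eq_lintegral_ofReal hMi
              (Filter.Eventually.of_forall fun z => by positivity), ENNReal.ofReal_mul hM0]
    have h4 : ∫⁻ z in {z | 2 * ‖w‖ < ‖z‖}, ‖κ (z - w)‖ₑ ≤ ∫⁻ z in {z | ‖w‖ < ‖z‖}, ‖κ z‖ₑ := by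
      rw [← lintegral_indicator hS, ← lintegral_indicator (measurableSet_lt measurable_const measurable_norm),
        ← lintegral_sub_right_eq_self ({z : E | ‖w‖ < ‖z‖}.indicator _) w]
      refine lintegral_mono fun z => ?_
      by_cases hz : 2 * ‖w‖ < ‖z‖
      · rw [Set.indicator_of_mem (by exact hz), Set.indicator_of_mem]
        have : ‖z‖ ≤ ‖z - w‖ + ‖w‖ := by simpa using norm_add_le (z - w) w
        show ‖w‖ < ‖z - w‖
        linarith
      · rw [Set.indicator_of_notMem (by exact hz)]; exact zero_le
    have h5 : ∫⁻ z in {z | 2 * ‖w‖ < ‖z‖}, ‖κ z‖ₑ ≤ ∫⁻ z in {z | ‖w‖ < ‖z‖}, ‖κ z‖ₑ := by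
      refine lintegral_mono_set fun z hz => ?_
      have : 2 * ‖w‖ < ‖z‖ := hz
      show ‖w‖ < ‖z‖
      linarith
    calc ∫⁻ z in {z | 2 * ‖w‖ < ‖z‖}, ‖κ (z - w) - κ z‖ₑ ≤ ∫⁻ z in {z | 2 * ‖w‖ < ‖z‖}, (‖κ (z - w)‖ₑ + ‖κ z‖ₑ) := 
          lintegral_mono fun z => enorm_sub_le
      _ = (∫⁻ z in {z | 2 * ‖w‖ < ‖z‖}, ‖κ (z - w)‖ₑ) + ∫⁻ z in {z | 2 * ‖w‖ < ‖z‖}, ‖κ z‖ₑ := 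
          lintegral_add_right _ κ.continuous.enorm.measurable
      _ ≤ ENNReal.ofReal (M * ‖w‖⁻¹) + ENNReal.ofReal (M * ‖w‖⁻¹) := add_le_add (h4.trans h3) (h5.trans h3)
      _ ≤ _ := by
          rw [← ENNReal.ofReal_add (by positivity) (by positivity)]
          apply ENNReal.ofReal_le_ofReal
          have : 0 ≤ B * C * ‖w‖⁻¹ := by positivity
          nlinarith

lemma hk_scale [Nontrivial E] (a : 𝓢(E, ℂ)) {t : ℝ} (ht : 0 < t) (y : E) :
    ∫⁻ x in {x | 2 * ‖y‖ < ‖x‖}, ‖ker a t ht (x - y) - ker a t ht x‖ₑ = 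
    ∫⁻ z in {z | 2 * ‖t • y‖ < ‖z‖}, ‖(𝓕⁻ a : 𝓢(E, ℂ)) (z - t • y) - (𝓕⁻ a : 𝓢(E, ℂ)) z‖ₑ := by
  set κ := (𝓕⁻ a : 𝓢(E, ℂ))
  have hS : ∀ c : ℝ, MeasurableSet {z : E | c < ‖z‖} := fun c => measurableSet_lt measurable_const measurable_norm
  set G : E → ℝ≥0∞ := {z : E | 2 * ‖t • y‖ < ‖z‖}.indicator fun z => ‖κ (z - t • y) - κ z‖ₑ with hG
  have hGm : Measurable G := by
    refine Measurable.indicator ?_ (hS _)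
    exact (((κ.continuous.comp (continuous_id.sub continuous_const)).sub κ.continuous).enorm).measurable
  have h1 : ∫⁻ x, G (t • x) = ENNReal.ofReal ((t ^ Module.finrank ℝ E)⁻¹) * ∫⁻ z, G z := by
    have := lintegral_map (μ := (volume : Measure E)) hGm (measurable_const_smul t)
    rw [← this, Measure.map_addHaar_smul volume ht.ne', lintegral_smul_measure, abs_of_pos (by positivity), smul_eq_mul]
  rw [← lintegral_indicator (hS _), ← lintegral_indicator (hS _), ← hG]
  have h2 : ∀ x, ({x : E| 2 * ‖y‖ < ‖x‖}.indicator (fun x => ‖ker a t ht (x - y) - ker a t ht x‖ₑ)) x = ENNReal.ofReal (t ^ Module.finrank ℝ E) * G (t • x) := by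
    intro x
    by_cases hx : 2 * ‖y‖ < ‖x‖
    · rw [Set.indicator_of_mem (by exact hx), hG, Set.indicator_of_mem]
      · rw [ker_apply, ker_apply, ← mul_sub, enorm_mul, smul_sub]
        congr 1
        rw [← ofReal_norm, Complex.norm_real, Real.norm_of_nonneg (by positivity)]
      · show 2 * ‖t • y‖ < ‖t • x‖
        rw [norm_smul, norm_smul, Real.norm_of_nonneg ht.le]
        nlinarith
    · rw [Set.indicator_of_notMem (by exact hx), hG, Set.indicator_of_notMem, mul_zero]
      show ¬ (2 * ‖t • y‖ < ‖t • x‖)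
      rw [norm_smul, norm_smul, Real.norm_of_nonneg ht.le]
      push Not at hx ⊢
      nlinarith
  simp_rw [h2]
  rw [lintegral_const_mul' _ _ ENNReal.ofReal_ne_top, h1, ← mul_assoc, ← ENNReal.ofReal_mul (by positivity), 
    mul_inv_cancel₀ (by positivity)]
  simp
end sq
end KP


namespace KP
set_option linter.unusedVariables false
set_option linter.unusedSectionVars false
set_option linter.style.haveILetI false

section sq
variable {E : Type*} [NormedAddCommGroup E] [InnerProductSpace ℝ E] [FiniteDimensional ℝ E]
  [MeasurableSpace E] [BorelSpace E]

lemma ker_even {a : 𝓢(E, ℂ)} (ha : ∀ ξ, a (-ξ) = a ξ) {t : ℝ} (ht : 0 < t) (x : E) :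
    ker a t ht (-x) = ker a t ht x := by
  rw [ker_apply, ker_apply]
  congr 1
  rw [SchwartzMap.fourierInv_coe, Real.fourierInv_eq, Real.fourierInv_eq, ← integral_neg_eq_self]
  congr 1; funext v
  rw [ha, smul_neg, inner_neg_neg]

lemma sch_min {a : 𝓢(E, ℂ)} (ha0 : a 0 = 0) : ∃ C : ℝ, 0 < C ∧ ∀ ξ : E, ξ ≠ 0 → ‖a ξ‖ ≤ C * min ‖ξ‖ ‖ξ‖⁻¹ := by
  obtain ⟨B, hB, h1⟩ := sch_lip a 0
  obtain ⟨D, hD, h2⟩ := sch_decay a 1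
  refine ⟨B + D, by positivity, fun ξ hξ => ?_⟩
  have h0 : 0 < ‖ξ‖ := norm_pos_iff.2 hξ
  rcases le_total ‖ξ‖ 1 with hw1 | hw1
  · rw [min_eq_left (hw1.trans (by rw [one_le_inv₀ h0]; exact hw1))]
    have := h1 ξ ξ hw1
    rw [sub_self, ha0, zero_sub, norm_neg] at this
    simp at this
    nlinarith
  · rw [min_eq_right ((inv_le_one_of_one_le₀ hw1).trans hw1), ← div_eq_mul_inv, le_div_iff₀ h0]
    have := h2 ξ
    have := norm_nonneg (a ξ)
    rw [pow_one] at *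
    nlinarith

lemma sum_cz [Nontrivial E] {a : 𝓢(E, ℂ)} (ha : ∀ ξ, a (-ξ) = a ξ) (ha0 : a 0 = 0) : ∃ A : ℝ, 0 ≤ A ∧
    ∀ (I : Finset ℤ) (ε : ℤ → ℂ), (∀ k, ‖ε k‖ ≤ 1) → CZ (∑ k ∈ I, ε k • kz a k) A := by
  obtain ⟨C0, hC0, hz⟩ := zmin
  obtain ⟨C1, hC1, h1⟩ := sch_min ha0
  obtain ⟨C2, hC2, h2⟩ := hk_base (𝓕⁻ a : 𝓢(E, ℂ))
  refine ⟨C1 * C0 + C2 * C0, by positivity, fun I ε hε => ⟨?_, ?_, ?_⟩⟩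
  · intro x
    simp only [sum_apply, smul_apply]
    refine Finset.sum_congr rfl fun k _ => ?_
    rw [kz, ker_even ha]
  · intro ξ
    rw [FourierTransform.fourier_sum]
    simp only [sum_apply, FourierTransform.fourier_smul, smul_apply]
    have e : ∀ k, (𝓕 (kz a k) : 𝓢(E, ℂ)) ξ = a (((2:ℝ)^k)⁻¹ • ξ) := fun k => by
      rw [SchwartzMap.fourier_coe, kz, ker_fourier]
    by_cases hξ : ξ = 0
    · have : ∑ k ∈ I, ε k • (𝓕 (kz a k) : 𝓢(E, ℂ)) ξ = 0 := by
        refine Finset.sum_eq_zero fun k _ => ?_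
        rw [e, hξ, smul_zero, ha0, smul_zero]
      rw [this, norm_zero]; positivity
    have h0 : 0 < ‖ξ‖ := norm_pos_iff.2 hξ
    calc ‖∑ k ∈ I, ε k • (𝓕 (kz a k) : 𝓢(E, ℂ)) ξ‖ ≤ ∑ k ∈ I, C1 * min ((2:ℝ)^k * ‖ξ‖⁻¹) ((2:ℝ)^k * ‖ξ‖⁻¹)⁻¹ := by
          refine norm_sum_le_of_le _ fun k _ => ?_
          have hk := tz k
          rw [norm_smul, e]
          calc _ ≤ 1 * ‖a (((2:ℝ)^k)⁻¹ • ξ)‖ := by gcongr; exact hε k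
            _ ≤ _ := by
              rw [one_mul]
              refine (h1 _ (smul_ne_zero (by positivity) hξ)).trans (le_of_eq ?_)
              rw [norm_smul, norm_inv, Real.norm_of_nonneg hk.le, min_comm]
              simp [mul_comm]
      _ ≤ C1 * C0 := by rw [← Finset.mul_sum]; gcongr; exact hz I _ (by positivity)
      _ ≤ _ := by have : 0 ≤ C2 * C0 := by positivity
                  linarith
  · intro y
    simp only [sum_apply, smul_apply]
    by_cases hy : y = 0
    · simp [hy]
    have h0 : 0 < ‖y‖ := norm_pos_iff.2 hy
    calc ∫⁻ x in {x | 2 * ‖y‖ < ‖x‖}, ‖∑ k ∈ I, ε k • kz a k (x - y) - ∑ k ∈ I, ε k • kz a k x‖ₑ 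
        ≤ ∫⁻ x in {x | 2 * ‖y‖ < ‖x‖}, ∑ k ∈ I, ‖kz a k (x - y) - kz a k x‖ₑ := by
          refine lintegral_mono fun x => ?_
          rw [← Finset.sum_sub_distrib]
          refine (enorm_sum_le _ _).trans (Finset.sum_le_sum fun k _ => ?_)
          rw [← smul_sub, enorm_smul]
          calc _ ≤ 1 * ‖kz a k (x - y) - kz a k x‖ₑ := by
                gcongr
                rw [← ofReal_norm, ← ENNReal.ofReal_one]; exact ENNReal.ofReal_le_ofReal (hε k)
            _ = _ := one_mul _
      _ = ∑ k ∈ I, ∫⁻ x in {x | 2 * ‖y‖ < ‖x‖}, ‖kz a k (x - y) - kz a k x‖ₑ := by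
          refine lintegral_finsetSum' _ fun k _ => ?_
          exact ((((kz a k).continuous.comp (continuous_id.sub continuous_const)).sub (kz a k).continuous).enorm).measurable.aemeasurable
      _ ≤ ∑ k ∈ I, ENNReal.ofReal (C2 * min ((2:ℝ)^k * ‖y‖) ((2:ℝ)^k * ‖y‖)⁻¹) := by
          refine Finset.sum_le_sum fun k _ => ?_
          have hk := tz k
          rw [kz, hk_scale]
          refine (h2 _ (smul_ne_zero (by positivity) hy)).trans (le_of_eq ?_)
          rw [norm_smul, Real.norm_of_nonneg hk.le]
      _ = ENNReal.ofReal (∑ k ∈ I, C2 * min ((2:ℝ)^k * ‖y‖) ((2:ℝ)^k * ‖y‖)⁻¹) := by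
          rw [ENNReal.ofReal_sum_of_nonneg]
          intro k _
          have hk := tz k
          positivity
      _ ≤ _ := by
          apply ENNReal.ofReal_le_ofReal
          rw [← Finset.mul_sum]
          have := mul_le_mul_of_nonneg_left (hz I _ h0) hC2.le
          have : 0 ≤ C1 * C0 := by positivity
          linarith

/-- finite dyadic square function -/
noncomputable def sqf (a : 𝓢(E, ℂ)) (I : Finset ℤ) (f : E → ℂ) (x : E) : ℝ :=
  √(∑ k ∈ I, ‖cv (kz a k) f x‖ ^ 2)

lemma sqf_nonneg (a : 𝓢(E, ℂ)) (I : Finset ℤ) (f : E → ℂ) (x : E) : 0 ≤ sqf a I f x := Real.sqrt_nonneg _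

lemma sqf_Cc [Nontrivial E] {a : 𝓢(E, ℂ)} (ha : ∀ ξ, a (-ξ) = a ξ) (ha0 : a 0 = 0) {p : ℝ} (hp : 1 < p) :
    ∃ C : ℝ≥0∞, C ≠ ∞ ∧ ∀ (I : Finset ℤ) (f : E → ℂ), Continuous f → HasCompactSupport f →
      eLpNorm (sqf a I f) (ENNReal.ofReal p) volume ≤ C * eLpNorm f (ENNReal.ofReal p) volume := by
  obtain ⟨A, hA, hcz⟩ := sum_cz ha ha0
  obtain ⟨C, hC, hLp⟩ := cz_Lp (E := E) A hA hp
  obtain ⟨B, hB, hkh⟩ := khinchine (ι := ℤ) p (by linarith)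
  have hp0 : 0 < p := by linarith
  refine ⟨(ENNReal.ofReal B * C ^ p) ^ (1 / p), ENNReal.rpow_ne_top_of_nonneg (by positivity)
    (ENNReal.mul_ne_top ENNReal.ofReal_ne_top (ENNReal.rpow_ne_top_of_nonneg hp0.le hC)), fun I f hf hs => ?_⟩
  have hfi : Integrable f := hf.integrable_of_hasCompactSupport hs
  apply eLp_le_of_pow hp0
  have hlin : ∀ s x, rs I (fun k => cv (kz a k) f x) s = cv (∑ k ∈ I, sg s k • kz a k : 𝓢(E, ℂ)) f x := by
    intro s x
    simp only [rs, cv, sum_apply, smul_apply, Finset.sum_mul]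
    rw [integral_finsetSum]
    · refine Finset.sum_congr rfl fun k _ => ?_
      rw [← integral_const_mul]; simp [mul_assoc]
    · intro k _
      simp only [smul_eq_mul, mul_assoc]
      exact (cv_integrand_int (kz a k) hfi x).const_mul _
  have hsg : ∀ (s : Finset ℤ) k, ‖sg s k‖ ≤ 1 := by
    intro s k; unfold sg; split_ifs <;> simp
  calc ∫⁻ x, ENNReal.ofReal (‖sqf a I f x‖ ^ p) 
      ≤ ∫⁻ x, ENNReal.ofReal (B * ((2:ℝ) ^ I.card)⁻¹) * ∑ s ∈ I.powerset, ENNReal.ofReal (‖cv (∑ k ∈ I, sg s k • kz a k : 𝓢(E, ℂ)) f x‖ ^ p) := by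
        refine lintegral_mono fun x => ?_
        rw [← ENNReal.ofReal_sum_of_nonneg (fun _ _ => by positivity), ← ENNReal.ofReal_mul (by positivity)]
        apply ENNReal.ofReal_le_ofReal
        rw [Real.norm_of_nonneg (sqf_nonneg _ _ _ _), sqf, Real.sqrt_eq_rpow, ← Real.rpow_mul (by positivity)]
        have := hkh I (fun k => cv (kz a k) f x)
        simp only [hlin] at this
        rwa [one_div_mul_eq_div]
    _ = ENNReal.ofReal (B * ((2:ℝ) ^ I.card)⁻¹) * ∑ s ∈ I.powerset, ∫⁻ x, ENNReal.ofReal (‖cv (∑ k ∈ I, sg s k • kz a k : 𝓢(E, ℂ)) f x‖ ^ p) := by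
        rw [lintegral_const_mul' _ _ ENNReal.ofReal_ne_top, lintegral_finsetSum']
        intro s _
        exact (((cv_cont_int _ hfi).norm.measurable.pow_const p).ennreal_ofReal).aemeasurable
    _ ≤ ENNReal.ofReal (B * ((2:ℝ) ^ I.card)⁻¹) * ∑ s ∈ I.powerset, C ^ p * ∫⁻ x, ENNReal.ofReal (‖f x‖ ^ p) := by
        gcongr with s hs'
        exact pow_le_of_eLp hp0 (hLp _ (hcz I (sg s) (hsg s)) f hf hs)
    _ = _ := by
        rw [Finset.sum_const, Finset.card_powerset, nsmul_eq_mul, ← mul_assoc, ← mul_assoc]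
        congr 2
        have : ((2 ^ I.card : ℕ) : ℝ≥0∞) = ENNReal.ofReal ((2:ℝ) ^ I.card) := by
          rw [ENNReal.ofReal_pow (by norm_num)]; simp
        rw [this, ← ENNReal.ofReal_mul (by positivity)]
        congr 1
        field_simp

lemma sqf_bdd [Nontrivial E] {a : 𝓢(E, ℂ)} (ha : ∀ ξ, a (-ξ) = a ξ) (ha0 : a 0 = 0) {p : ℝ} (hp : 1 < p) :
    ∃ C : ℝ≥0∞, C ≠ ∞ ∧ ∀ (I : Finset ℤ) (f : E → ℂ) (M : ℝ), Continuous f → (∀ x, ‖f x‖ ≤ M) →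
      eLpNorm (sqf a I f) (ENNReal.ofReal p) volume ≤ C * eLpNorm f (ENNReal.ofReal p) volume := by
  obtain ⟨C, hC, h⟩ := sqf_Cc ha ha0 hp
  refine ⟨C, hC, fun I f M hf hM => ?_⟩
  set F : ℕ → E → ℂ := fun n x => (tent n x : ℂ) * f x with hF
  have hFc : ∀ n, Continuous (F n) := fun n => (Complex.continuous_ofReal.comp (tent_cont n)).mul hf
  have hFs : ∀ n, HasCompactSupport (F n) := by
    intro n
    refine HasCompactSupport.mul_right ?_
    exact (tent_supp n).comp_left (g := fun t : ℝ => (t : ℂ)) (by simp)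
  have hFb : ∀ n x, ‖F n x‖ ≤ ‖f x‖ := by
    intro n x
    simp only [hF]
    rw [norm_mul, Complex.norm_real, Real.norm_of_nonneg (tent_nonneg n x)]
    exact mul_le_of_le_one_left (norm_nonneg _) (tent_le_one n x)
  have hcv : ∀ k x, Filter.Tendsto (fun n => cv (kz a k) (F n) x) Filter.atTop (nhds (cv (kz a k) f x)) := by
    intro k x
    refine tendsto_integral_of_dominated_convergence (fun y => ‖kz a k (x - y) * f y‖) ?_ ?_ ?_ ?_
    · intro n
      exact (cv_integrand_int (kz a k) ((hFc n).integrable_of_hasCompactSupport (hFs n)) x).1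
    · exact (cv_integrand_bdd (kz a k) hf.aestronglyMeasurable hM x).norm
    · intro n
      refine Filter.Eventually.of_forall fun y => ?_
      show ‖kz a k (x - y) * F n y‖ ≤ ‖kz a k (x - y) * f y‖
      rw [norm_mul (kz a k (x-y)) (F n y), norm_mul (kz a k (x-y)) (f y)]
      exact mul_le_mul_of_nonneg_left (hFb n y) (norm_nonneg (kz a k (x-y)))
    · refine Filter.Eventually.of_forall fun y => ?_
      have h1 : Filter.Tendsto (fun n => ((tent n y : ℝ) : ℂ) * f y) Filter.atTop (nhds (((1:ℝ):ℂ) * f y)) :=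
        ((Complex.continuous_ofReal.tendsto 1).comp (tent_tendsto y)).mul_const _
      simp only [Complex.ofReal_one, one_mul] at h1
      exact h1.const_mul _
  refine (Lp.eLpNorm_lim_le_liminf_eLpNorm (f := fun n => sqf a I (F n)) ?_ (sqf a I f) ?_).trans ?_
  · intro n
    refine Continuous.aestronglyMeasurable ?_
    exact Real.continuous_sqrt.comp (continuous_finsetSum _ fun k _ => 
      (cv_cont_int _ ((hFc n).integrable_of_hasCompactSupport (hFs n))).norm.pow 2)
  · refine Filter.Eventually.of_forall fun x => ?_
    refine (Real.continuous_sqrt.tendsto _).comp ?_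
    exact tendsto_finsetSum _ fun k _ => (hcv k x).norm.pow 2
  · refine Filter.liminf_le_of_le (by isBoundedDefault) fun b hb => ?_
    obtain ⟨n, hn⟩ := hb.exists
    refine hn.trans ((h I (F n) (hFc n) (hFs n)).trans ?_)
    gcongr
    exact eLpNorm_mono (hFb n)
end sq
end KP


namespace KP
set_option linter.unusedVariables false
set_option linter.unusedSectionVars false
set_option linter.style.haveILetI false

section sym
variable {E : Type*} [NormedAddCommGroup E] [InnerProductSpace ℝ E] [FiniteDimensional ℝ E]
  [MeasurableSpace E] [BorelSpace E]

/-- smooth bump -/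
noncomputable def bmp : ContDiffBump (0:E) := ⟨1, 2, one_pos, one_lt_two⟩

/-- smooth bump as a Schwartz function -/
noncomputable def phi : 𝓢(E, ℂ) :=
  HasCompactSupport.toSchwartzMap (f := fun x : E => (((bmp (E := E)) x : ℝ) : ℂ))
    ((bmp (E := E)).hasCompactSupport.comp_left (g := fun t : ℝ => (t:ℂ)) (by simp))
    (Complex.ofRealCLM.contDiff.comp (bmp (E := E)).contDiff)

lemma phi_apply (ξ : E) : phi ξ = (((bmp (E := E)) ξ : ℝ) : ℂ) := rfl
lemma phi_even (ξ : E) : phi (-ξ) = phi ξ := by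
  rw [phi_apply, phi_apply, ContDiffBump.neg]
lemma phi_one {ξ : E} (h : ‖ξ‖ ≤ 1) : phi ξ = 1 := by
  rw [phi_apply, ContDiffBump.one_of_mem_closedBall]
  · simp
  · simpa [bmp] using h
lemma phi_zero {ξ : E} (h : 2 ≤ ‖ξ‖) : phi ξ = 0 := by
  rw [phi_apply, ContDiffBump.zero_of_le_dist]
  · simp
  · simpa [bmp] using h
lemma phi_le (ξ : E) : ‖phi ξ‖ ≤ 1 := by
  rw [phi_apply, Complex.norm_real, Real.norm_of_nonneg (ContDiffBump.nonneg _)]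
  exact ContDiffBump.le_one _

/-- annulus bump -/
noncomputable def th (ξ : E) : ℂ := phi ((2:ℝ)⁻¹ • ξ) - phi ξ

lemma norm_half (ξ : E) : ‖(2:ℝ)⁻¹ • ξ‖ = ‖ξ‖ / 2 := by
  rw [norm_smul]; simp; ring
lemma th_zero {ξ : E} (h : ‖ξ‖ ≤ 1) : th ξ = 0 := by
  rw [th, phi_one (ξ := ξ) h, phi_one, sub_self]
  rw [norm_half]; linarith [norm_nonneg ξ]
lemma th_zero' {ξ : E} (h : 4 ≤ ‖ξ‖) : th ξ = 0 := by
  rw [th, phi_zero (ξ := ξ) (by linarith), phi_zero, sub_self]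
  rw [norm_half]; linarith [norm_nonneg ξ]
lemma th_even (ξ : E) : th (-ξ) = th ξ := by
  rw [th, th, smul_neg, phi_even, phi_even]
lemma th_smooth : ContDiff ℝ (↑(⊤:ℕ∞)) (th : E → ℂ) := by
  have h : ContDiff ℝ (↑(⊤:ℕ∞)) (phi : E → ℂ) := phi.smooth ⊤
  exact (h.comp (contDiff_const_smul _)).sub h

lemma aS_smooth (σ : ℝ) : ContDiff ℝ (↑(⊤:ℕ∞)) (fun ξ : E => ((‖ξ‖ ^ σ : ℝ) : ℂ) * th ξ) := by
  rw [contDiff_iff_contDiffAt]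
  intro ξ
  by_cases hξ : ξ = 0
  · have : (fun ξ : E => ((‖ξ‖ ^ σ : ℝ) : ℂ) * th ξ) =ᶠ[nhds ξ] fun _ => 0 := by
      filter_upwards [Metric.ball_mem_nhds ξ one_pos] with η hη
      rw [hξ, mem_ball_zero_iff] at hη
      rw [th_zero hη.le, mul_zero]
    exact contDiffAt_const.congr_of_eventuallyEq this
  · have h1 : ContDiffAt ℝ (↑(⊤:ℕ∞)) (fun ξ : E => (‖ξ‖ ^ σ : ℝ)) ξ :=
      ((contDiffAt_norm ℝ hξ).rpow_const_of_ne (norm_ne_zero_iff.2 hξ))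
    exact (Complex.ofRealCLM.contDiff.contDiffAt.comp ξ h1).mul (th_smooth.contDiffAt)

lemma aS_supp (σ : ℝ) : HasCompactSupport (fun ξ : E => ((‖ξ‖ ^ σ : ℝ) : ℂ) * th ξ) := by
  haveI : ProperSpace E := FiniteDimensional.proper_real E
  refine HasCompactSupport.intro (isCompact_closedBall (0:E) 4) fun x hx => ?_
  simp only [Metric.mem_closedBall, dist_zero_right, not_le] at hx
  rw [th_zero' hx.le, mul_zero]

/-- `|ξ|^σ` times annulus bump, Schwartz -/
noncomputable def aS (σ : ℝ) : 𝓢(E, ℂ) := (aS_supp σ).toSchwartzMap (aS_smooth σ)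

lemma aS_apply (σ : ℝ) (ξ : E) : aS σ ξ = ((‖ξ‖ ^ σ : ℝ) : ℂ) * th ξ := rfl
lemma aS_even (σ : ℝ) (ξ : E) : aS σ (-ξ) = aS σ ξ := by
  rw [aS_apply, aS_apply, th_even, norm_neg]
lemma aS_zero (σ : ℝ) {ξ : E} (h : ‖ξ‖ ≤ 1) : aS σ ξ = 0 := by
  rw [aS_apply, th_zero h, mul_zero]

/-- pointwise product of Schwartz functions -/
noncomputable def smu (f g : 𝓢(E, ℂ)) : 𝓢(E, ℂ) := 𝓕⁻ (scv (𝓕 f) (𝓕 g))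

lemma smu_apply (f g : 𝓢(E, ℂ)) (x : E) : smu f g x = f x * g x := by
  have h := scv_fourier (𝓕 f) (𝓕 g) (-x)
  have e : ∀ h : 𝓢(E, ℂ), (𝓕 h : 𝓢(E, ℂ)) (-x) = (𝓕⁻ h : 𝓢(E, ℂ)) x := by
    intro h
    rw [SchwartzMap.fourier_coe, SchwartzMap.fourierInv_coe, Real.fourierInv_eq_fourier_neg]
  rw [e, e, e] at h
  rw [smu, h, FourierTransform.fourierInv_fourier_eq, FourierTransform.fourierInv_fourier_eq]

/-- band-limited -/
def BL (R : ℝ) (v : 𝓢(E, ℂ)) : Prop := ∀ ξ : E, R < ‖ξ‖ → (𝓕 v : 𝓢(E, ℂ)) ξ = 0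

lemma BL_mul {R S : ℝ} {f g : 𝓢(E, ℂ)} (hf : BL R f) (hg : BL S g) : BL (R + S) (smu f g) := by
  intro ξ hξ
  rw [smu, FourierTransform.fourier_fourierInv_eq, scv_coe, cv]
  have : ∀ η, (𝓕 f : 𝓢(E, ℂ)) (ξ - η) * (𝓕 g : 𝓢(E, ℂ)) η = 0 := by
    intro η
    by_cases h : S < ‖η‖
    · rw [hg η h, mul_zero]
    · rw [hf, zero_mul]
      have : ‖ξ‖ ≤ ‖ξ - η‖ + ‖η‖ := by simpa using norm_add_le (ξ - η) η
      linarith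
  simp [this]

/-- conjugate -/
noncomputable def sconj (f : 𝓢(E, ℂ)) : 𝓢(E, ℂ) := f.postcompCLM (𝕜 := ℝ) (Complex.conjCLE : ℂ →L[ℝ] ℂ)

lemma sconj_apply (f : 𝓢(E, ℂ)) (x : E) : sconj f x = (starRingEnd ℂ) (f x) := rfl

lemma BL_conj {R : ℝ} {f : 𝓢(E, ℂ)} (hf : BL R f) : BL R (sconj f) := by
  intro ξ hξ
  have h := hf (-ξ) (by rwa [norm_neg])
  rw [SchwartzMap.fourier_coe, Real.fourier_eq] at h ⊢
  rw [← map_eq_zero (starRingEnd ℂ), ← integral_conj, ← h]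
  congr 1; funext v
  rw [sconj_apply, Circle.smul_def, Circle.smul_def, smul_eq_mul, map_mul, Complex.conj_conj, inner_neg_right, smul_eq_mul]
  congr 1
  rw [AddChar.map_neg_eq_inv 𝐞 (-⟪v, ξ⟫)]
  exact (Circle.coe_inv_eq_conj _).symm

lemma Fpow (v : 𝓢(E, ℂ)) (m : ℕ) : ∃ w : 𝓢(E, ℂ), (∀ x, w x = ((‖v x‖ ^ (2 * m) : ℝ) : ℂ) * v x) ∧
    ∀ R, BL R v → BL ((2 * m + 1) * R) w := by
  induction m with
  | zero => exact ⟨v, by simp, by simp⟩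
  | succ m ih =>
    obtain ⟨w, h1, h2⟩ := ih
    refine ⟨smu (smu v (sconj v)) w, ?_, ?_⟩
    · intro x
      rw [smu_apply, smu_apply, sconj_apply, h1, Complex.mul_conj, Complex.normSq_eq_norm_sq]
      push_cast; ring
    · intro R hR
      have := BL_mul (BL_mul hR (BL_conj hR)) (h2 R hR)
      convert this using 1
      push_cast; ring
end sym
end KP


namespace KP
set_option linter.unusedVariables false
set_option linter.unusedSectionVars false
set_option linter.style.haveILetI false

section idn
variable {E : Type*} [NormedAddCommGroup E] [InnerProductSpace ℝ E] [FiniteDimensional ℝ E]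
  [MeasurableSpace E] [BorelSpace E]

/-- fractional derivative on a general inner product space -/
noncomputable def lam (γ : ℝ) (f : E → ℂ) : E → ℂ := 𝓕⁻ (fun ξ => ((‖ξ‖ ^ γ : ℝ) : ℂ) * 𝓕 f ξ)

lemma inv_int {γ : ℝ} (hγ : 0 ≤ γ) (v : 𝓢(E, ℂ)) : Integrable (fun ξ => ((‖ξ‖ ^ γ : ℝ) : ℂ) * v ξ) := by
  have h1 : Integrable (fun ξ => ‖v ξ‖ + ‖ξ‖ ^ (Nat.ceil γ) * ‖v ξ‖) := 
    (v.integrable (μ := volume)).norm.add (SchwartzMap.integrable_pow_mul volume v (Nat.ceil γ))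
  refine h1.mono' ?_ ?_
  · refine Continuous.aestronglyMeasurable ?_
    exact (Complex.continuous_ofReal.comp (continuous_norm.rpow_const fun _ => Or.inr hγ)).mul v.continuous
  · refine Filter.Eventually.of_forall fun ξ => ?_
    rw [norm_mul, Complex.norm_real, Real.norm_of_nonneg (by positivity), ← one_add_mul]
    gcongr
    rcases le_total ‖ξ‖ 1 with h | h
    · have := Real.rpow_le_one (norm_nonneg ξ) h hγ
      have : 0 ≤ ‖ξ‖ ^ (Nat.ceil γ) := by positivity
      linarith
    · have := Real.rpow_le_rpow_of_exponent_le h (Nat.le_ceil γ)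
      rw [Real.rpow_natCast] at this
      linarith

lemma lam_int {γ : ℝ} (hγ : 0 ≤ γ) (u : 𝓢(E, ℂ)) : Integrable (fun ξ => ((‖ξ‖ ^ γ : ℝ) : ℂ) * 𝓕 (u : E → ℂ) ξ) := by
  have := inv_int hγ (𝓕 u : 𝓢(E, ℂ))
  rwa [SchwartzMap.fourier_coe] at this

lemma finv_bdd {h : E → ℂ} (x : E) : ‖𝓕⁻ h x‖ ≤ ∫ ξ, ‖h ξ‖ := by
  rw [Real.fourierInv_eq]
  refine (norm_integral_le_integral_norm _).trans (le_of_eq ?_)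
  simp

lemma finv_lim {h : ℕ → E → ℂ} {h0 : E → ℂ} {G : E → ℝ} (hG : Integrable G) (hm : ∀ n, AEStronglyMeasurable (h n) volume)
    (hb : ∀ n ξ, ‖h n ξ‖ ≤ G ξ) (hl : ∀ᵐ ξ, Filter.Tendsto (fun n => h n ξ) Filter.atTop (nhds (h0 ξ))) (x : E) :
    Filter.Tendsto (fun n => 𝓕⁻ (h n) x) Filter.atTop (nhds (𝓕⁻ h0 x)) := by
  simp only [Real.fourierInv_eq, Circle.smul_def]
  refine tendsto_integral_of_dominated_convergence G ?_ hG ?_ ?_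
  · intro n
    have h1 : Continuous fun ξ : E => 𝐞 ⟪ξ, x⟫ := Real.continuous_fourierChar.comp (by fun_prop)
    have h2 : Continuous fun ξ : E => ((𝐞 ⟪ξ, x⟫ : Circle) : ℂ) := continuous_subtype_val.comp h1
    exact h2.aestronglyMeasurable.mul (hm n)
  · intro n
    refine Filter.Eventually.of_forall fun ξ => ?_
    rw [norm_smul, Circle.norm_coe, one_mul]; exact hb n ξ
  · filter_upwards [hl] with ξ hξ
    exact hξ.const_smul _

lemma lam_cont {γ : ℝ} (hγ : 0 ≤ γ) (u : 𝓢(E, ℂ)) : Continuous (lam γ u) := by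
  have h := VectorFourier.fourierIntegral_continuous (μ := (volume : Measure E)) Real.continuous_fourierChar 
    (L := innerₗ E) (by simpa using continuous_inner) (lam_int hγ u)
  have e : lam γ u = fun x => VectorFourier.fourierIntegral 𝐞 volume (innerₗ E) (fun ξ => ((‖ξ‖ ^ γ : ℝ) : ℂ) * 𝓕 (u : E → ℂ) ξ) (-x) := by
    funext x
    rw [lam, Real.fourierInv_eq_fourier_neg]; rfl
  rw [e]
  exact h.comp continuous_neg

lemma self_inv (u : 𝓢(E, ℂ)) : 𝓕⁻ (𝓕 (u : E → ℂ)) = u := by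
  rw [← SchwartzMap.fourier_coe, ← SchwartzMap.fourierInv_coe, FourierTransform.fourierInv_fourier_eq]

lemma four_int (u : 𝓢(E, ℂ)) : Integrable (𝓕 (u : E → ℂ)) := by
  rw [← SchwartzMap.fourier_coe]; exact (𝓕 u : 𝓢(E, ℂ)).integrable

lemma cv_four (K u : 𝓢(E, ℂ)) (x : E) : cv K u x = 𝓕⁻ (fun ξ => 𝓕 (K : E → ℂ) ξ * 𝓕 (u : E → ℂ) ξ) x := by
  rw [← cv_fourier K (four_int u), self_inv]

lemma kz_four (a : 𝓢(E, ℂ)) (k : ℤ) (ξ : E) : 𝓕 (kz a k : E → ℂ) ξ = a (((2:ℝ)^k)⁻¹ • ξ) := by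
  rw [kz, ker_fourier]

lemma th_scale (k : ℤ) (ξ : E) : th (((2:ℝ)^k)⁻¹ • ξ) = phi (((2:ℝ)^(k+1))⁻¹ • ξ) - phi (((2:ℝ)^k)⁻¹ • ξ) := by
  rw [th, smul_smul]
  congr 3
  rw [zpow_add₀ two_ne_zero, mul_inv]; simp [mul_comm]

lemma aS_scale (σ : ℝ) (k : ℤ) (ξ : E) : aS σ (((2:ℝ)^k)⁻¹ • ξ) =
    ((((2:ℝ)^k)^(-σ) * ‖ξ‖ ^ σ : ℝ) : ℂ) * th (((2:ℝ)^k)⁻¹ • ξ) := by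
  have hk := tz k
  rw [aS_apply, norm_smul, norm_inv, Real.norm_of_nonneg hk.le, Real.mul_rpow (by positivity) (by positivity),
    Real.inv_rpow hk.le, Real.rpow_neg hk.le]

lemma delta {γ : ℝ} (hγ : 0 ≤ γ) (u : 𝓢(E, ℂ)) (k : ℤ) (x : E) :
    cv (kz phi (k+1)) u x - cv (kz phi k) u x = ((((2:ℝ)^k)^(-γ) : ℝ) : ℂ) * cv (kz (aS (-γ)) k) (lam γ u) x := by
  have hk := tz k
  set c : ℂ := ((((2:ℝ)^k)^(-γ) : ℝ) : ℂ) with hc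
  have e1 : cv (kz phi (k+1)) u x - cv (kz phi k) u x = cv (kz phi (k+1) - kz phi k : 𝓢(E, ℂ)) u x := by
    simp only [cv]
    rw [← integral_sub (cv_integrand_int _ u.integrable x) (cv_integrand_int _ u.integrable x)]
    congr 1; funext y; simp [sub_mul]
  have e2 : c * cv (kz (aS (-γ)) k) (lam γ u) x = cv (c • kz (aS (-γ)) k : 𝓢(E, ℂ)) (lam γ u) x := by
    simp only [cv]
    rw [← integral_const_mul]
    congr 1; funext y; simp [mul_assoc]
  rw [e1, e2, cv_four, lam, cv_fourier _ (lam_int hγ u)]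
  refine congrFun (congrArg _ (funext fun ξ => ?_)) x
  rw [← mul_assoc]
  congr 1
  rw [← SchwartzMap.fourier_coe, ← SchwartzMap.fourier_coe, sub_eq_add_neg, FourierTransform.fourier_add, FourierTransform.fourier_neg, ← sub_eq_add_neg, FourierTransform.fourier_smul]
  simp only [sub_apply, smul_apply]
  rw [SchwartzMap.fourier_coe, SchwartzMap.fourier_coe, SchwartzMap.fourier_coe, kz_four, kz_four, kz_four, ← th_scale, aS_scale]
  by_cases hξ : ξ = 0
  · rw [th_zero (by simp [hξ])]; simp
  have h0 : 0 < ‖ξ‖ := norm_pos_iff.2 hξ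
  rw [neg_neg, hc, smul_eq_mul, mul_right_comm, ← mul_assoc, ← Complex.ofReal_mul, ← Complex.ofReal_mul, ← mul_assoc]
  rw [Real.rpow_neg hk.le, Real.rpow_neg h0.le]
  have h1 : 0 < ((2:ℝ)^k)^γ := by positivity
  have h2 : 0 < ‖ξ‖ ^ γ := by positivity
  have h3 : (((2:ℝ)^k)^γ)⁻¹ * ‖ξ‖ ^ γ * ((2:ℝ)^k)^γ * (‖ξ‖ ^ γ)⁻¹ = 1 := by field_simp
  rw [h3]
  simp

lemma Iv_inj (N : ℕ) : Function.Injective (fun i : ℕ => (i : ℤ) - N) := fun a b h => by simpa using h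

/-- index interval `[-N, N]` -/
def Iv (N : ℕ) : Finset ℤ := (Finset.range (2 * N + 1)).map ⟨fun i : ℕ => (i : ℤ) - N, Iv_inj N⟩

lemma Iv_tele {A : Type*} [AddCommGroup A] (N : ℕ) (f : ℤ → A) : ∑ k ∈ Iv N, (f (k + 1) - f k) = f (N + 1) - f (-N) := by
  rw [Iv, Finset.sum_map]
  have := Finset.sum_range_sub (fun i : ℕ => f ((i:ℤ) - N)) (2 * N + 1)
  rw [show f (N + 1) - f (-N) = f (((2 * N + 1 : ℕ) : ℤ) - N) - f (((0:ℕ):ℤ) - N) by congr 2 <;> push_cast <;> ring, ← this]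
  refine Finset.sum_congr rfl fun i _ => ?_
  simp only [Function.Embedding.coeFn_mk]
  congr 2; push_cast; ring

/-- truncated kernel for the fractional derivative -/
noncomputable def TL (γ : ℝ) (L : ℕ) : 𝓢(E, ℂ) := ∑ l ∈ Iv L, ((((2:ℝ)^l)^γ : ℝ) : ℂ) • kz (aS γ) l

lemma TL_four (γ : ℝ) (L : ℕ) (ξ : E) : 𝓕 (TL γ L : E → ℂ) ξ = 
    ((‖ξ‖ ^ γ : ℝ) : ℂ) * (phi (((2:ℝ)^((L:ℤ)+1))⁻¹ • ξ) - phi (((2:ℝ)^(-(L:ℤ)))⁻¹ • ξ)) := by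
  rw [← SchwartzMap.fourier_coe, TL, FourierTransform.fourier_sum]
  simp only [sum_apply, FourierTransform.fourier_smul, smul_apply]
  rw [← Iv_tele L (fun k => phi (((2:ℝ)^k)⁻¹ • ξ)), Finset.mul_sum]
  refine Finset.sum_congr rfl fun l _ => ?_
  have hl := tz l
  rw [SchwartzMap.fourier_coe, kz_four, aS_scale, th_scale, smul_eq_mul, ← mul_assoc, ← Complex.ofReal_mul, ← mul_assoc,
    ← Real.rpow_add hl]
  simp

lemma ev_one (ξ : E) : ∀ᶠ N : ℕ in Filter.atTop, phi (((2:ℝ)^((N:ℤ)+1))⁻¹ • ξ) = 1 := by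
  have h := tendsto_pow_atTop_atTop_of_one_lt (one_lt_two (α := ℝ))
  filter_upwards [h.eventually_ge_atTop ‖ξ‖] with N hN
  apply phi_one
  rw [norm_smul, norm_inv, Real.norm_of_nonneg (by positivity), ← div_eq_inv_mul, div_le_one (by positivity),
    zpow_add₀ two_ne_zero, zpow_natCast]
  have : 0 < (2:ℝ)^N := by positivity
  simp; linarith

lemma ev_zero {ξ : E} (hξ : ξ ≠ 0) : ∀ᶠ N : ℕ in Filter.atTop, phi (((2:ℝ)^(-(N:ℤ)))⁻¹ • ξ) = 0 := by
  have h := tendsto_pow_atTop_atTop_of_one_lt (one_lt_two (α := ℝ))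
  have h0 : 0 < ‖ξ‖ := norm_pos_iff.2 hξ
  filter_upwards [h.eventually_ge_atTop (2 / ‖ξ‖)] with N hN
  apply phi_zero
  rw [norm_smul, norm_inv, Real.norm_of_nonneg (by positivity), zpow_neg, inv_inv, zpow_natCast]
  rwa [div_le_iff₀ h0] at hN

lemma ae_ne0 [Nontrivial E] : ∀ᵐ ξ : E, ξ ≠ 0 := by
  have : (volume : Measure E) {0} = 0 := measure_singleton 0
  exact compl_mem_ae_iff.2 this

lemma TL_lim [Nontrivial E] {γ : ℝ} (hγ : 0 ≤ γ) (w : 𝓢(E, ℂ)) (x : E) :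
    Filter.Tendsto (fun L => cv (TL γ L) w x) Filter.atTop (nhds (lam γ w x)) := by
  simp only [cv_four, lam]
  refine finv_lim (G := fun ξ => 2 * ‖((‖ξ‖ ^ γ : ℝ) : ℂ) * 𝓕 (w : E → ℂ) ξ‖) ((lam_int hγ w).norm.const_mul 2) ?_ ?_ ?_ x
  · intro n
    rw [← SchwartzMap.fourier_coe, ← SchwartzMap.fourier_coe]
    exact ((𝓕 (TL γ n) : 𝓢(E, ℂ)).continuous.mul (𝓕 w : 𝓢(E, ℂ)).continuous).aestronglyMeasurable
  · intro n ξ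
    rw [TL_four, mul_right_comm, norm_mul, mul_comm]
    gcongr
    exact (norm_sub_le _ _).trans (by linarith [phi_le (((2:ℝ)^((n:ℤ)+1))⁻¹ • ξ), phi_le (((2:ℝ)^(-(n:ℤ)))⁻¹ • ξ)])
  · filter_upwards [ae_ne0] with ξ hξ
    refine tendsto_const_nhds.congr' ?_
    filter_upwards [ev_one ξ, ev_zero hξ] with N h1 h2
    rw [TL_four, h1, h2]; simp

lemma P_lim1 (u : 𝓢(E, ℂ)) (x : E) :
    Filter.Tendsto (fun N : ℕ => cv (kz phi ((N:ℤ)+1)) u x) Filter.atTop (nhds (u x)) := by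
  conv_rhs => rw [← self_inv u]
  simp only [cv_four]
  refine finv_lim (G := fun ξ => ‖𝓕 (u : E → ℂ) ξ‖) (four_int u).norm ?_ ?_ ?_ x
  · intro n
    rw [← SchwartzMap.fourier_coe, ← SchwartzMap.fourier_coe]
    exact ((𝓕 (kz phi ((n:ℤ)+1)) : 𝓢(E, ℂ)).continuous.mul (𝓕 u : 𝓢(E, ℂ)).continuous).aestronglyMeasurable
  · intro n ξ
    rw [kz_four, norm_mul]
    exact mul_le_of_le_one_left (norm_nonneg _) (phi_le _)
  · refine Filter.Eventually.of_forall fun ξ => ?_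
    refine tendsto_const_nhds.congr' ?_
    filter_upwards [ev_one ξ] with N h1
    rw [kz_four, h1, one_mul]

lemma P_lim0 [Nontrivial E] (u : 𝓢(E, ℂ)) (x : E) :
    Filter.Tendsto (fun N : ℕ => cv (kz phi (-(N:ℤ))) u x) Filter.atTop (nhds 0) := by
  have e : (0:ℂ) = 𝓕⁻ (fun ξ : E => (0:ℂ)) x := by rw [Real.fourierInv_eq]; simp
  rw [e]
  simp only [cv_four]
  refine finv_lim (G := fun ξ => ‖𝓕 (u : E → ℂ) ξ‖) (four_int u).norm ?_ ?_ ?_ x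
  · intro n
    rw [← SchwartzMap.fourier_coe, ← SchwartzMap.fourier_coe]
    exact ((𝓕 (kz phi (-(n:ℤ))) : 𝓢(E, ℂ)).continuous.mul (𝓕 u : 𝓢(E, ℂ)).continuous).aestronglyMeasurable
  · intro n ξ
    rw [kz_four, norm_mul]
    exact mul_le_of_le_one_left (norm_nonneg _) (phi_le _)
  · filter_upwards [ae_ne0] with ξ hξ
    refine tendsto_const_nhds.congr' ?_
    filter_upwards [ev_zero hξ] with N h1
    rw [kz_four, h1, zero_mul]

lemma P_bdd (u : 𝓢(E, ℂ)) (k : ℤ) (x : E) : ‖cv (kz phi k) u x‖ ≤ ∫ ξ, ‖𝓕 (u : E → ℂ) ξ‖ := by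
  rw [cv_four]
  refine (finv_bdd x).trans (integral_mono_of_nonneg (Filter.Eventually.of_forall fun _ => norm_nonneg _) (four_int u).norm
    (Filter.Eventually.of_forall fun ξ => ?_))
  beta_reduce
  rw [kz_four, norm_mul]
  exact mul_le_of_le_one_left (norm_nonneg _) (phi_le _)
end idn
end KP


namespace KP
set_option linter.unusedVariables false
set_option linter.unusedSectionVars false
set_option linter.style.haveILetI false

lemma two_zrpow (γ : ℝ) (l : ℤ) : ((2:ℝ)^l)^γ = ((2:ℝ)^γ)^l := by
  rw [← Real.rpow_intCast, ← Real.rpow_intCast, ← Real.rpow_mul (by norm_num), ← Real.rpow_mul (by norm_num), mul_comm]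

lemma schur {γ : ℝ} (hγ : 0 < γ) (c : ℕ) : ∃ C : ℝ, 0 < C ∧ ∀ (I J : Finset ℤ) (A B : ℤ → ℝ), (∀ k, 0 ≤ A k) → (∀ k, 0 ≤ B k) →
    ∑ k ∈ I, ∑ l ∈ J, (if l < k + c then ((2:ℝ)^l)^γ * ((2:ℝ)^k)^(-γ) * (A k * B l) else 0)
      ≤ C * (√(∑ k ∈ I, A k ^ 2) * √(∑ l ∈ J, B l ^ 2)) := by
  set b : ℝ := (2:ℝ)^γ with hb
  have hb1 : 1 < b := Real.one_lt_rpow (by norm_num) hγ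
  have hb0 : 0 < b := by linarith
  set ρ : ℝ := b⁻¹ with hρ
  have hρ0 : 0 < ρ := by positivity
  have hρ1 : ρ < 1 := inv_lt_one_of_one_lt₀ hb1
  obtain ⟨C0, hC0, hz⟩ := zgeo hρ0.le hρ1
  set W : ℝ := b ^ (2 * c) with hW
  have hW0 : 0 < W := by positivity
  refine ⟨W * C0, by positivity, fun I J A B hA hB => ?_⟩
  have hw : ∀ k l : ℤ, l < k + c → ((2:ℝ)^l)^γ * ((2:ℝ)^k)^(-γ) ≤ W * ρ ^ (k - l).natAbs := by
    intro k l h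
    rw [Real.rpow_neg (tz k).le, two_zrpow, two_zrpow, ← hb, ← zpow_neg, ← zpow_add₀ hb0.ne', hW, hρ, ← zpow_natCast, ← zpow_natCast, inv_zpow', ← zpow_add₀ hb0.ne']
    apply zpow_le_zpow_right₀ hb1.le
    push_cast
    have := Int.natCast_natAbs (k - l)
    omega
  set f : ℤ × ℤ → ℝ := fun z => √(ρ ^ (z.1 - z.2).natAbs) * A z.1
  set g : ℤ × ℤ → ℝ := fun z => √(ρ ^ (z.1 - z.2).natAbs) * B z.2
  have hsq : ∀ n : ℕ, √(ρ ^ n) ^ 2 = ρ ^ n := fun n => Real.sq_sqrt (by positivity)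
  have h1 : ∑ k ∈ I, ∑ l ∈ J, (if l < k + c then ((2:ℝ)^l)^γ * ((2:ℝ)^k)^(-γ) * (A k * B l) else 0)
      ≤ W * ∑ z ∈ I ×ˢ J, f z * g z := by
    rw [Finset.sum_product, Finset.mul_sum]
    refine Finset.sum_le_sum fun k _ => ?_
    rw [Finset.mul_sum]
    refine Finset.sum_le_sum fun l _ => ?_
    have hfg : f (k, l) * g (k, l) = ρ ^ (k - l).natAbs * (A k * B l) := by
      rw [← hsq]; simp only [f, g]; ring
    rw [hfg, ← mul_assoc W]
    have hAB := mul_nonneg (hA k) (hB l)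
    split_ifs with h
    · exact mul_le_mul_of_nonneg_right (hw k l h) hAB
    · positivity
  have h2 : ∑ z ∈ I ×ˢ J, f z ^ 2 ≤ C0 * ∑ k ∈ I, A k ^ 2 := by
    rw [Finset.sum_product, Finset.mul_sum]
    refine Finset.sum_le_sum fun k _ => ?_
    simp only [f, mul_pow, hsq]
    rw [← Finset.sum_mul]
    refine mul_le_mul_of_nonneg_right ?_ (by positivity)
    refine le_trans (le_of_eq (Finset.sum_congr rfl fun l _ => ?_)) (hz J (-k))
    rw [← Int.natAbs_neg]; congr 2; ring
  have h3 : ∑ z ∈ I ×ˢ J, g z ^ 2 ≤ C0 * ∑ l ∈ J, B l ^ 2 := by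
    rw [Finset.sum_product_right, Finset.mul_sum]
    refine Finset.sum_le_sum fun l _ => ?_
    simp only [g, mul_pow, hsq]
    rw [← Finset.sum_mul]
    refine mul_le_mul_of_nonneg_right ?_ (by positivity)
    exact hz I (-l)
  calc _ ≤ W * ∑ z ∈ I ×ˢ J, f z * g z := h1
    _ ≤ W * (√(∑ z ∈ I ×ˢ J, f z ^ 2) * √(∑ z ∈ I ×ˢ J, g z ^ 2)) := by
        gcongr; exact Real.sum_mul_le_sqrt_mul_sqrt _ _ _
    _ ≤ W * (√(C0 * ∑ k ∈ I, A k ^ 2) * √(C0 * ∑ l ∈ J, B l ^ 2)) := by gcongr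
    _ = _ := by
        rw [Real.sqrt_mul hC0.le, Real.sqrt_mul hC0.le]
        have := Real.mul_self_sqrt hC0.le
        linear_combination W * √(∑ k ∈ I, A k ^ 2) * √(∑ l ∈ J, B l ^ 2) * this

lemma nl_diff (j : ℕ) {M : ℝ} {z w : ℂ} (hz : ‖z‖ ≤ M) (hw : ‖w‖ ≤ M) :
    ‖((‖z‖ ^ j : ℝ) : ℂ) * z - ((‖w‖ ^ j : ℝ) : ℂ) * w‖ ≤ (j + 1) * M ^ j * ‖z - w‖ := by
  have hM : 0 ≤ M := (norm_nonneg z).trans hz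
  induction j with
  | zero => simp
  | succ j ih =>
    have e : ((‖z‖ ^ (j+1) : ℝ) : ℂ) * z - ((‖w‖ ^ (j+1) : ℝ) : ℂ) * w = 
        (‖z‖ : ℂ) * (((‖z‖ ^ j : ℝ) : ℂ) * z - ((‖w‖ ^ j : ℝ) : ℂ) * w) + ((‖z‖ - ‖w‖ : ℝ) : ℂ) * (((‖w‖ ^ j : ℝ) : ℂ) * w) := by
      push_cast; ring
    rw [e]
    refine (norm_add_le _ _).trans ?_
    rw [norm_mul, norm_mul, norm_mul, Complex.norm_real, Complex.norm_real, Complex.norm_real, norm_norm,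
      Real.norm_of_nonneg (show 0 ≤ ‖w‖ ^ j by positivity), Real.norm_eq_abs]
    have h1 : ‖z‖ * ‖((‖z‖ ^ j : ℝ) : ℂ) * z - ((‖w‖ ^ j : ℝ) : ℂ) * w‖ ≤ M * ((j + 1) * M ^ j * ‖z - w‖) := by gcongr
    have h2 : |‖z‖ - ‖w‖| * (‖w‖ ^ j * ‖w‖) ≤ ‖z - w‖ * (M ^ j * M) := by
      gcongr
      exact abs_norm_sub_norm_le z w
    calc _ ≤ _ := add_le_add h1 h2
      _ = _ := by push_cast; ring

section asm
variable {E : Type*} [NormedAddCommGroup E] [InnerProductSpace ℝ E] [FiniteDimensional ℝ E]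
  [MeasurableSpace E] [BorelSpace E]

lemma hold_pow {r p q : ℝ≥0∞} {j : ℕ} (hj : 1 ≤ j) (h : 1 / r = 1 / p + (j : ℝ≥0∞) / q) {M S : E → ℝ}
    (hM : AEStronglyMeasurable M volume) (hS : AEStronglyMeasurable S volume) :
    eLpNorm (fun x => ‖M x‖ ^ j * S x) r volume ≤ eLpNorm M q volume ^ j * eLpNorm S p volume := by
  have hj0 : (j : ℝ≥0∞) ≠ 0 := by exact_mod_cast (by omega : j ≠ 0)
  have hjt : (j : ℝ≥0∞) ≠ ∞ := ENNReal.natCast_ne_top j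
  haveI : ENNReal.HolderTriple (q / j) p r := ⟨by
    rw [ENNReal.inv_div (Or.inl hjt) (Or.inl hj0)]
    simpa [add_comm] using h.symm⟩
  have e := eLpNorm_norm_rpow M (p := q / j) (μ := volume) (q := (j:ℝ)) (by exact_mod_cast (by omega : 0 < j))
  rw [ENNReal.ofReal_natCast, ENNReal.div_mul_cancel hj0 hjt] at e
  simp only [Real.rpow_natCast, ENNReal.rpow_natCast] at e
  rw [← e]
  exact eLpNorm_smul_le_mul_eLpNorm (φ := fun x => ‖M x‖ ^ j) hS (hM.norm.pow j)

/-- the nonlinearity as a Schwartz function -/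
noncomputable def FP (m : ℕ) (v : 𝓢(E, ℂ)) : 𝓢(E, ℂ) := (Fpow v m).choose

lemma FP_apply (m : ℕ) (v : 𝓢(E, ℂ)) (x : E) : FP m v x = ((‖v x‖ ^ (2 * m) : ℝ) : ℂ) * v x := (Fpow v m).choose_spec.1 x
lemma FP_BL (m : ℕ) (v : 𝓢(E, ℂ)) {R : ℝ} (h : BL R v) : BL ((2*m+1)*R) (FP m v) := (Fpow v m).choose_spec.2 R h

/-- dyadic differences of the nonlinearity -/
noncomputable def Dk (m : ℕ) (u : 𝓢(E, ℂ)) (k : ℤ) : 𝓢(E, ℂ) := FP m (scv (kz phi (k+1)) u) - FP m (scv (kz phi k) u)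

/-- the truncated nonlinearity -/
noncomputable def WN (m : ℕ) (u : 𝓢(E, ℂ)) (N : ℕ) : 𝓢(E, ℂ) := FP m (scv (kz phi ((N:ℤ)+1)) u) - FP m (scv (kz phi (-(N:ℤ))) u)

lemma WN_sum (m : ℕ) (u : 𝓢(E, ℂ)) (N : ℕ) : WN m u N = ∑ k ∈ Iv N, Dk m u k :=
  (Iv_tele N (fun k => FP m (scv (kz phi k) u))).symm

lemma P_BL (u : 𝓢(E, ℂ)) (k : ℤ) : BL (2 * (2:ℝ)^k) (scv (kz phi k) u) := by
  intro ξ h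
  have e := scv_fourier (kz phi k) u ξ
  have hk := tz k
  rw [e, SchwartzMap.fourier_coe, kz_four, phi_zero, zero_mul]
  rw [norm_smul, norm_inv, Real.norm_of_nonneg hk.le, ← div_eq_inv_mul, le_div_iff₀ hk]
  exact h.le

lemma Dk_BL (m : ℕ) (u : 𝓢(E, ℂ)) (k : ℤ) : BL ((2*m+1) * (4 * (2:ℝ)^k)) (Dk m u k) := by
  intro ξ h
  have hk := tz k
  rw [Dk, sub_eq_add_neg, FourierTransform.fourier_add, FourierTransform.fourier_neg, ← sub_eq_add_neg, sub_apply]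
  have h1 := FP_BL m _ (P_BL u (k+1)) ξ (by
    refine lt_of_eq_of_lt ?_ h
    rw [zpow_add₀ two_ne_zero, zpow_one]; ring)
  have h2 := FP_BL m _ (P_BL u k) ξ (by
    refine lt_of_le_of_lt ?_ h
    gcongr; norm_num)
  rw [h1, h2, sub_zero]

lemma cv_Dk_zero (γ : ℝ) (m : ℕ) (u : 𝓢(E, ℂ)) {k l : ℤ} (h : ¬ l < k + ((2*m+3:ℕ):ℤ)) (x : E) : cv (kz (aS γ) l) (Dk m u k) x = 0 := by
  have hl := tz l
  have hk := tz k
  rw [cv_four]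
  have e : (fun ξ : E => 𝓕 (kz (aS γ) l : E → ℂ) ξ * 𝓕 (Dk m u k : E → ℂ) ξ) = fun _ => 0 := by
    funext ξ
    by_cases hξ : ‖ξ‖ ≤ (2:ℝ)^l
    · rw [kz_four, aS_zero, zero_mul]
      rw [norm_smul, norm_inv, Real.norm_of_nonneg hl.le, ← div_eq_inv_mul, div_le_one hl]
      exact hξ
    · push Not at hξ
      have := Dk_BL m u k ξ (lt_of_le_of_lt ?_ hξ)
      · rw [SchwartzMap.fourier_coe] at this
        rw [this, mul_zero]
      · have h1 : (2*m+1:ℝ) ≤ 2^(2*m+1) := by exact_mod_cast (Nat.lt_two_pow_self (n := 2*m+1)).le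
        calc (2*m+1:ℝ) * (4 * (2:ℝ)^k) ≤ 2^(2*m+1) * (4 * (2:ℝ)^k) := by gcongr
          _ = (2:ℝ)^(k + ((2*m+3:ℕ):ℤ)) := by
            rw [zpow_add₀ two_ne_zero, zpow_natCast]; ring
          _ ≤ (2:ℝ)^l := zpow_le_zpow_right₀ (by norm_num) (by omega)
  rw [e, Real.fourierInv_eq]; simp

lemma Dk_bound {γ : ℝ} (hγ : 0 ≤ γ) (m : ℕ) (u : 𝓢(E, ℂ)) (k : ℤ) (x : E) {M : ℝ} (h1 : ‖cv (kz phi (k+1)) u x‖ ≤ M)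
    (h2 : ‖cv (kz phi k) u x‖ ≤ M) :
    ‖Dk m u k x‖ ≤ (2*m+1) * M^(2*m) * (((2:ℝ)^k)^(-γ) * ‖cv (kz (aS (-γ)) k) (lam γ u) x‖) := by
  have := nl_diff (2*m) h1 h2
  rw [delta hγ, norm_mul, Complex.norm_real, Real.norm_of_nonneg (by have := tz k; positivity)] at this
  rw [Dk, sub_apply, FP_apply, FP_apply, scv_coe, scv_coe]
  exact_mod_cast this

lemma cv_TL (γ : ℝ) (L : ℕ) (m : ℕ) (u : 𝓢(E, ℂ)) (N : ℕ) (x : E) : cv (TL γ L) (WN m u N) x =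
    ∑ k ∈ Iv N, ∑ l ∈ Iv L, ((((2:ℝ)^l)^γ : ℝ) : ℂ) * cv (kz (aS γ) l) (Dk m u k) x := by
  simp only [cv]
  rw [WN_sum, TL]
  have hi : ∀ k l, Integrable (fun y => ((((2:ℝ)^l)^γ : ℝ) : ℂ) * ((kz (aS γ) l : 𝓢(E, ℂ)) (x - y) * Dk m u k y)) := fun k l =>
    (cv_integrand_int _ (Dk m u k).integrable x).const_mul _
  have e : ∀ k l, ((((2:ℝ)^l)^γ : ℝ) : ℂ) * ∫ y, (kz (aS γ) l : 𝓢(E, ℂ)) (x - y) * Dk m u k y = 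
      ∫ y, ((((2:ℝ)^l)^γ : ℝ) : ℂ) * ((kz (aS γ) l : 𝓢(E, ℂ)) (x - y) * Dk m u k y) := fun k l => (integral_const_mul _ _).symm
  simp only [e]
  have e2 : ∀ k, ∑ l ∈ Iv L, ∫ y, ((((2:ℝ)^l)^γ : ℝ) : ℂ) * ((kz (aS γ) l : 𝓢(E, ℂ)) (x - y) * Dk m u k y) = 
      ∫ y, ∑ l ∈ Iv L, ((((2:ℝ)^l)^γ : ℝ) : ℂ) * ((kz (aS γ) l : 𝓢(E, ℂ)) (x - y) * Dk m u k y) := fun k =>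
    (integral_finsetSum _ fun l _ => hi k l).symm
  simp only [e2]
  rw [← integral_finsetSum _ fun k _ => integrable_finsetSum _ fun l _ => hi k l]
  congr 1; funext y
  rw [sum_apply, sum_apply, Finset.sum_mul_sum, Finset.sum_comm]
  refine Finset.sum_congr rfl fun k _ => Finset.sum_congr rfl fun l _ => ?_
  simp [mul_assoc]

lemma pair_eq (γ : ℝ) (L : ℕ) (m : ℕ) (u : 𝓢(E, ℂ)) (N : ℕ) {g : E → ℂ} (hg : Continuous g) (hgc : HasCompactSupport g) : 
    ∫ x, cv (TL γ L) (WN m u N) x * g x = ∫ x, ∑ k ∈ Iv N, ∑ l ∈ Iv L, 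
      (if l < k + ((2*m+3:ℕ):ℤ) then ((((2:ℝ)^l)^γ : ℝ) : ℂ) * (Dk m u k x * cv (kz (aS γ) l) g x) else 0) := by
  have hgi : Integrable g := hg.integrable_of_hasCompactSupport hgc
  obtain ⟨M, hM⟩ := hgc.exists_bound_of_continuous hg
  have i1 : ∀ k l, Integrable (fun x => ((((2:ℝ)^l)^γ : ℝ) : ℂ) * (cv (kz (aS γ) l) (Dk m u k) x * g x)) := fun k l => by
    rw [← scv_coe]
    exact (((scv (kz (aS γ) l) (Dk m u k)).integrable (μ := volume)).mul_bdd (c := M) hg.aestronglyMeasurable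
      (Filter.Eventually.of_forall hM)).const_mul _
  have i2 : ∀ k l, Integrable (fun x => (if l < k + ((2*m+3:ℕ):ℤ) then ((((2:ℝ)^l)^γ : ℝ) : ℂ) * (Dk m u k x * cv (kz (aS γ) l) g x) else 0)) := fun k l => by
    split_ifs
    · refine (((Dk m u k).integrable (μ := volume)).mul_bdd (c := (∫ y, ‖kz (aS γ) l y‖) * M) (cv_cont_int _ hgi).aestronglyMeasurable
        (Filter.Eventually.of_forall fun x => cv_bound _ hM x)).const_mul _
    · exact integrable_zero _ _ _
  have e : ∀ x, cv (TL γ L) (WN m u N) x * g x = ∑ k ∈ Iv N, ∑ l ∈ Iv L, ((((2:ℝ)^l)^γ : ℝ) : ℂ) * (cv (kz (aS γ) l) (Dk m u k) x * g x) := by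
    intro x
    rw [cv_TL, Finset.sum_mul]
    refine Finset.sum_congr rfl fun k _ => ?_
    rw [Finset.sum_mul]
    refine Finset.sum_congr rfl fun l _ => ?_
    ring
  simp only [e]
  rw [integral_finsetSum _ fun k _ => integrable_finsetSum _ fun l _ => i1 k l, integral_finsetSum _ fun k _ => integrable_finsetSum _ fun l _ => i2 k l]
  refine Finset.sum_congr rfl fun k _ => ?_
  rw [integral_finsetSum _ fun l _ => i1 k l, integral_finsetSum _ fun l _ => i2 k l]
  refine Finset.sum_congr rfl fun l _ => ?_
  by_cases h : l < k + ((2*m+3:ℕ):ℤ)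
  · simp only [if_pos h]
    rw [integral_const_mul, integral_const_mul, cv_symm (K := kz (aS γ) l) (fun x => ker_even (aS_even γ) _ x) (Dk m u k).integrable hgi]
  · simp only [if_neg h, cv_Dk_zero γ m u h]
    simp
end asm
end KP


namespace KP
set_option linter.unusedVariables false
set_option linter.unusedSectionVars false
set_option linter.style.haveILetI false

section fin
variable {E : Type*} [NormedAddCommGroup E] [InnerProductSpace ℝ E] [FiniteDimensional ℝ E]
  [MeasurableSpace E] [BorelSpace E]

/-- indices used by the maximal function -/
def Jv (N : ℕ) : Finset ℤ := Iv N ∪ (Iv N).image (· + 1)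

lemma pt_bound {γ : ℝ} (hγ : 0 < γ) (m : ℕ) : ∃ C : ℝ, 0 < C ∧ ∀ (u : 𝓢(E, ℂ)) (N L : ℕ) (g : E → ℂ) (x : E),
    ‖∑ k ∈ Iv N, ∑ l ∈ Iv L, 
      (if l < k + ((2*m+3:ℕ):ℤ) then ((((2:ℝ)^l)^γ : ℝ) : ℂ) * (Dk m u k x * cv (kz (aS γ) l) g x) else 0)‖ ≤
    C * ((‖mx phi (Jv N) u x‖ ^ (2*m) * sqf (aS (-γ)) (Iv N) (lam γ u) x) * sqf (aS γ) (Iv L) g x) := by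
  obtain ⟨C, hC, h⟩ := schur hγ (2*m+3)
  refine ⟨(2*m+1) * C, by positivity, fun u N L g x => ?_⟩
  set M := mx phi (Jv N) u x with hM
  have hM0 : 0 ≤ M := mx_nonneg _ _ _ _
  rw [Real.norm_of_nonneg hM0]
  set A : ℤ → ℝ := fun k => ‖cv (kz (aS (-γ)) k) (lam γ u) x‖
  set B : ℤ → ℝ := fun l => ‖cv (kz (aS γ) l) g x‖
  have h1 := h (Iv N) (Iv L) A B (fun k => norm_nonneg _) (fun k => norm_nonneg _)
  calc _ ≤ ∑ k ∈ Iv N, ∑ l ∈ Iv L, (2*m+1) * M^(2*m) * (if l < k + ((2*m+3:ℕ):ℤ) then ((2:ℝ)^l)^γ * ((2:ℝ)^k)^(-γ) * (A k * B l) else 0) := by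
        refine (norm_sum_le _ _).trans (Finset.sum_le_sum fun k hk => ?_)
        refine (norm_sum_le _ _).trans (Finset.sum_le_sum fun l hl => ?_)
        split_ifs with hkl
        · have hl0 := tz l
          have hD := Dk_bound hγ.le m u k x (M := M) (le_mx _ _ _ (Finset.mem_union_right _ (Finset.mem_image_of_mem _ hk)))
            (le_mx _ _ _ (Finset.mem_union_left _ hk))
          rw [norm_mul, norm_mul, Complex.norm_real, Real.norm_of_nonneg (by positivity)]
          calc _ ≤ ((2:ℝ)^l)^γ * (((2*m+1) * M^(2*m) * (((2:ℝ)^k)^(-γ) * A k)) * B l) := by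
                gcongr
            _ = _ := by ring
        · simp
    _ = (2*m+1) * M^(2*m) * ∑ k ∈ Iv N, ∑ l ∈ Iv L, (if l < k + ((2*m+3:ℕ):ℤ) then ((2:ℝ)^l)^γ * ((2:ℝ)^k)^(-γ) * (A k * B l) else 0) := by
        simp only [Finset.mul_sum]
    _ ≤ (2*m+1) * M^(2*m) * (C * (√(∑ k ∈ Iv N, A k ^ 2) * √(∑ l ∈ Iv L, B l ^ 2))) := by
        gcongr
    _ = _ := by
        simp only [sqf, A, B]; ring

lemma sqf_cont (a : 𝓢(E, ℂ)) (I : Finset ℤ) {f : E → ℂ} (hf : ∀ k, Continuous (cv (kz a k) f)) : Continuous (sqf a I f) :=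
  Real.continuous_sqrt.comp (continuous_finsetSum _ fun k _ => (hf k).norm.pow 2)

lemma toR {p : ℝ≥0∞} (h1 : 1 < p) (h2 : p ≠ ∞) : 1 < p.toReal ∧ ENNReal.ofReal p.toReal = p := by
  refine ⟨?_, ENNReal.ofReal_toReal h2⟩
  rw [← ENNReal.toReal_one]
  exact (ENNReal.toReal_lt_toReal ENNReal.one_ne_top h2).2 h1

lemma trunc_bound [Nontrivial E] {γ : ℝ} (hγ : 0 < γ) {m : ℕ} (hm : 1 ≤ m) {r p q : ℝ≥0∞} (hr : 1 < r) (hr' : r ≠ ∞) (hp : 1 < p)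
    (hp' : p ≠ ∞) (hq : 1 < q) (h : 1 / r = 1 / p + ((2*m:ℕ) : ℝ≥0∞) / q) :
    ∃ C : ℝ≥0∞, C ≠ ∞ ∧ ∀ (u : 𝓢(E, ℂ)) (N L : ℕ),
      eLpNorm (cv (TL γ L) (WN m u N)) r volume ≤ C * (eLpNorm u q volume ^ (2*m) * eLpNorm (lam γ u) p volume) := by
  obtain ⟨hr1, er⟩ := toR hr hr'
  obtain ⟨hp1, ep⟩ := toR hp hp'
  have hc : r.toReal.HolderConjugate (r.toReal.conjExponent) := Real.HolderConjugate.conjExponent hr1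
  set s := r.toReal.conjExponent
  haveI hT := hc.ennrealOfReal
  obtain ⟨C0, hC0, h0⟩ := pt_bound (E := E) hγ m
  obtain ⟨C1, hC1, h1⟩ := mx_Lp (E := E) phi hq
  obtain ⟨C2, hC2, h2⟩ := sqf_bdd (E := E) (a := aS (-γ)) (aS_even _) (aS_zero _ (by simp)) hp1
  obtain ⟨C3, hC3, h3⟩ := sqf_Cc (E := E) (a := aS γ) (aS_even _) (aS_zero _ (by simp)) hc.symm.lt
  rw [ep] at h2
  refine ⟨ENNReal.ofReal C0 * C1 ^ (2*m) * C2 * C3, ?_, fun u N L => ?_⟩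
  · exact ENNReal.mul_ne_top (ENNReal.mul_ne_top (ENNReal.mul_ne_top ENNReal.ofReal_ne_top (ENNReal.pow_ne_top hC1)) hC2) hC3
  rw [← er]
  refine dual_bound hc (cv_cont_int _ (WN m u N).integrable) _ fun g hg hgc => ?_
  have hgi : Integrable g := hg.integrable_of_hasCompactSupport hgc
  have hlc := lam_cont hγ.le u
  have hlb : ∀ x, ‖lam γ u x‖ ≤ _ := fun x => finv_bdd x
  set M := mx phi (Jv N) u
  set S := sqf (aS (-γ)) (Iv N) (lam γ u)
  set T := sqf (aS γ) (Iv L) g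
  have mM : AEStronglyMeasurable M volume := (mx_cont phi (Jv N) u).aestronglyMeasurable
  have mS : AEStronglyMeasurable S volume := (sqf_cont _ _ fun k => cv_cont_bdd _ hlc hlb).aestronglyMeasurable
  have mT : AEStronglyMeasurable T volume := (sqf_cont _ _ fun k => cv_cont_int _ hgi).aestronglyMeasurable
  set H : E → ℝ := fun x => ‖M x‖ ^ (2*m) * S x
  have mH : AEStronglyMeasurable H volume := (mM.norm.pow _).mul mS
  rw [pair_eq γ L m u N hg hgc]
  calc _ ≤ ENNReal.ofReal C0 * eLpNorm (fun x => H x * T x) 1 volume := by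
        refine (enorm_integral_le_lintegral_enorm _).trans ?_
        rw [eLpNorm_one_eq_lintegral_enorm, ← lintegral_const_mul' _ _ ENNReal.ofReal_ne_top]
        refine lintegral_mono fun x => ?_
        rw [← ofReal_norm, ← ofReal_norm, ← ENNReal.ofReal_mul hC0.le]
        refine ENNReal.ofReal_le_ofReal ((h0 u N L g x).trans ?_)
        exact mul_le_mul_of_nonneg_left (le_abs_self _) hC0.le
    _ ≤ ENNReal.ofReal C0 * (eLpNorm H (ENNReal.ofReal r.toReal) volume * eLpNorm T (ENNReal.ofReal s) volume) := by
        gcongr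
        exact eLpNorm_smul_le_mul_eLpNorm (φ := H) mT mH
    _ ≤ ENNReal.ofReal C0 * ((eLpNorm M q volume ^ (2*m) * eLpNorm S p volume) * eLpNorm T (ENNReal.ofReal s) volume) := by
        rw [er]
        gcongr
        exact hold_pow (by omega) h mM mS
    _ ≤ ENNReal.ofReal C0 * (((C1 * eLpNorm u q volume) ^ (2*m) * (C2 * eLpNorm (lam γ u) p volume)) * (C3 * eLpNorm g (ENNReal.ofReal s) volume)) := by
        gcongr
        · exact h1 _ u
        · exact h2 _ _ _ hlc hlb
        · exact h3 _ g hg hgc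
    _ = _ := by rw [mul_pow]; ring

lemma WN_lim [Nontrivial E] (K : 𝓢(E, ℂ)) (m : ℕ) (u : 𝓢(E, ℂ)) (x : E) :
    Filter.Tendsto (fun N => cv K (WN m u N) x) Filter.atTop (nhds (cv K (FP m u) x)) := by
  set B := ∫ ξ, ‖𝓕 (u : E → ℂ) ξ‖
  have hB : 0 ≤ B := integral_nonneg fun _ => norm_nonneg _
  have hF : Continuous fun z : ℂ => ((‖z‖ ^ (2*m) : ℝ) : ℂ) * z := by fun_prop
  have hb : ∀ z : ℂ, ‖z‖ ≤ B → ‖((‖z‖ ^ (2*m) : ℝ) : ℂ) * z‖ ≤ B ^ (2*m) * B := by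
    intro z hz
    rw [norm_mul, Complex.norm_real, Real.norm_of_nonneg (by positivity)]
    gcongr
  refine tendsto_integral_of_dominated_convergence (fun y => ‖K (x - y)‖ * (B ^ (2*m) * B + B ^ (2*m) * B)) ?_ ?_ ?_ ?_
  · intro n
    exact (cv_integrand_int K (WN m u n).integrable x).1
  · exact (K.integrable.comp_sub_left x).norm.mul_const _
  · intro n
    refine Filter.Eventually.of_forall fun y => ?_
    rw [norm_mul (K (x - y))]
    refine mul_le_mul_of_nonneg_left ?_ (norm_nonneg _)
    rw [WN, sub_apply, FP_apply, FP_apply, scv_coe, scv_coe]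
    exact (norm_sub_le _ _).trans (add_le_add (hb _ (P_bdd u _ y)) (hb _ (P_bdd u _ y)))
  · refine Filter.Eventually.of_forall fun y => ?_
    refine Filter.Tendsto.const_mul _ ?_
    have h1 := (hF.tendsto _).comp (P_lim1 u y)
    have h2 := (hF.tendsto _).comp (P_lim0 u y)
    have h3 := h1.sub h2
    rw [FP_apply]
    simp only [mul_zero, sub_zero] at h3
    refine h3.congr fun n => ?_
    rw [WN, sub_apply, FP_apply, FP_apply, scv_coe, scv_coe]
    rfl

lemma fatou {r A : ℝ≥0∞} {f : ℕ → E → ℂ} {f0 : E → ℂ} (hf : ∀ n, Continuous (f n)) 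
    (hl : ∀ x, Filter.Tendsto (fun n => f n x) Filter.atTop (nhds (f0 x))) (hA : ∀ n, eLpNorm (f n) r volume ≤ A) :
    eLpNorm f0 r volume ≤ A := by
  refine (Lp.eLpNorm_lim_le_liminf_eLpNorm (f := f) (fun n => (hf n).aestronglyMeasurable) f0 (Filter.Eventually.of_forall hl)).trans ?_
  refine Filter.liminf_le_of_le (by isBoundedDefault) fun b hb => ?_
  obtain ⟨n, hn⟩ := hb.exists
  exact hn.trans (hA n)

lemma main_pos [Nontrivial E] {γ : ℝ} (hγ : 0 < γ) {m : ℕ} (hm : 1 ≤ m) {r p q : ℝ≥0∞} (hr : 1 < r) (hr' : r ≠ ∞) (hp : 1 < p)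
    (hp' : p ≠ ∞) (hq : 1 < q) (h : 1 / r = 1 / p + ((2*m:ℕ) : ℝ≥0∞) / q) :
    ∃ C : ℝ≥0∞, C ≠ ∞ ∧ ∀ (u : 𝓢(E, ℂ)),
      eLpNorm (lam γ (FP m u)) r volume ≤ C * (eLpNorm u q volume ^ (2*m) * eLpNorm (lam γ u) p volume) := by
  obtain ⟨C, hC, hb⟩ := trunc_bound (E := E) hγ hm hr hr' hp hp' hq h
  refine ⟨C, hC, fun u => ?_⟩
  have h1 : ∀ L, eLpNorm (cv (TL γ L) (FP m u)) r volume ≤ C * (eLpNorm u q volume ^ (2*m) * eLpNorm (lam γ u) p volume) := by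
    intro L
    have c1 : ∀ N, Continuous (cv (TL γ L) (WN m u N)) := fun N => cv_cont_int _ (WN m u N).integrable
    have c2 := fun x => WN_lim (TL γ L) m u x
    have c3 := fun N => hb u N L
    generalize C * (eLpNorm u q volume ^ (2*m) * eLpNorm (lam γ u) p volume) = A at c3 ⊢
    exact fatou (f := fun N => cv (TL γ L) (WN m u N)) c1 c2 c3
  have c1 : ∀ L, Continuous (cv (TL γ L) (FP m u)) := fun L => cv_cont_int _ (FP m u).integrable
  have c2 := fun x => TL_lim hγ.le (FP m u) x
  generalize C * (eLpNorm u q volume ^ (2*m) * eLpNorm (lam γ u) p volume) = A at h1 ⊢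
  exact fatou (f := fun L => cv (TL γ L) (FP m u)) c1 c2 h1

lemma lam_zero (u : 𝓢(E, ℂ)) : lam 0 u = u := by
  simp only [lam, Real.rpow_zero, Complex.ofReal_one, one_mul]
  exact self_inv u

lemma main_all [Nontrivial E] {γ : ℝ} (hγ : 0 ≤ γ) {m : ℕ} (hm : 1 ≤ m) {r p q : ℝ≥0∞} (hr : 1 < r) (hr' : r ≠ ∞) (hp : 1 < p)
    (hp' : p ≠ ∞) (hq : 1 < q) (h : 1 / r = 1 / p + ((2*m:ℕ) : ℝ≥0∞) / q) :
    ∃ C : ℝ≥0∞, C ≠ ∞ ∧ ∀ (u : 𝓢(E, ℂ)),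
      eLpNorm (lam γ (FP m u)) r volume ≤ C * (eLpNorm u q volume ^ (2*m) * eLpNorm (lam γ u) p volume) := by
  rcases hγ.eq_or_lt with h0 | h0
  · subst h0
    refine ⟨1, ENNReal.one_ne_top, fun u => ?_⟩
    rw [lam_zero, lam_zero, one_mul]
    have hc : AEStronglyMeasurable (fun x => ‖u x‖) volume := u.continuous.norm.aestronglyMeasurable
    have := hold_pow (by omega) h hc hc
    rw [eLpNorm_norm, eLpNorm_norm] at this
    refine le_trans (le_of_eq ?_) this
    refine eLpNorm_congr_norm_ae (Filter.Eventually.of_forall fun x => ?_)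
    rw [FP_apply]
    simp
  · exact main_pos h0 hm hr hr' hp hp' hq h
end fin
end KP


namespace KP
lemma lamPow_eq {d : ℕ} (γ : ℝ) (f : EuclideanSpace ℝ (Fin d) → ℂ) : lamPow γ f = lam γ f := by
  funext x
  rw [lamPow, lam, Real.fourierInv_eq]
  congr 1; funext ξ
  rw [Circle.smul_def, Real.fourierChar_apply, smul_eq_mul, real_inner_comm, mul_assoc]
  congr 2
  push_cast; ring
end KP

/-- nonlinear fractional derivative estimate for `F(z) = |z|^{ν-1}z`
with `ν ≥ 3` an odd integer. -/
theorem stmt9 (d : ℕ) (hd : 1 ≤ d) (ν : ℕ) (hν : 3 ≤ ν) (hodd : Odd ν)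
    (γ : ℝ) (hγ : 0 ≤ γ)
    (r p q : ℝ≥0∞) (hr : 1 < r) (hr' : r ≠ ∞) (hp : 1 < p) (hp' : p ≠ ∞) (hq : 1 < q)
    (hrpq : 1 / r = 1 / p + ((ν : ℝ≥0∞) - 1) / q) :
    ∃ C > (0 : ℝ), ∀ u : 𝓢(EuclideanSpace ℝ (Fin d), ℂ),
      eLpNorm (lamPow γ (fun x => ((‖u x‖ ^ (ν - 1) : ℝ) : ℂ) * u x)) r
          MeasureTheory.volume ≤
        ENNReal.ofReal C * eLpNorm ⇑u q MeasureTheory.volume ^ (ν - 1) *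
          eLpNorm (lamPow γ ⇑u) p MeasureTheory.volume := by
  obtain ⟨m, rfl⟩ := hodd
  have e : 2 * m + 1 - 1 = 2 * m := by omega
  have hm : 1 ≤ m := by omega
  haveI : Nonempty (Fin d) := ⟨⟨0, hd⟩⟩
  haveI : Nontrivial (EuclideanSpace ℝ (Fin d)) := inferInstance
  have h : 1 / r = 1 / p + ((2*m:ℕ) : ℝ≥0∞) / q := by
    rw [hrpq]
    congr 2
    push_cast
    exact ENNReal.add_sub_cancel_right ENNReal.one_ne_top
  obtain ⟨C, hC, hb⟩ := KP.main_all (E := EuclideanSpace ℝ (Fin d)) hγ hm hr hr' hp hp' hq h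
  refine ⟨C.toReal + 1, by positivity, fun u => ?_⟩
  have hC' : C ≤ ENNReal.ofReal (C.toReal + 1) := by
    rw [ENNReal.le_ofReal_iff_toReal_le hC (by positivity)]; linarith
  rw [e, KP.lamPow_eq, KP.lamPow_eq, mul_assoc]
  have ef : (fun x => ((‖u x‖ ^ (2 * m) : ℝ) : ℂ) * u x) = KP.FP m u := by
    funext x; rw [KP.FP_apply]
  rw [ef]
  exact (hb u).trans (mul_le_mul_left hC' _)
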